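/- There exist absolute constants C₁, C₂, C₃, C₄, c₁, c₂, c₃, c₄, C > 0 with the following property. Let X ∈ ℝ^{n₁×n₂} have rank r, let y = 𝒜(X), and assume 𝒜 satisfies the RIP of order 2r+1 with constant δ ≤ c₁/(κ³√r). Let k ≥ r, let 0 < ε < 1, and run factorized gradient descent from V₀ = αV, W₀ = αW with V, W having i.i.d. N(0,1) entries. Assume the step size satisfies μ ≤ (c₂/(κ⁵‖X‖)) · 1/ln(2√(2‖X‖)/(εα(√k − √(r−1)))) and the initialization scale satisfies α ≤ (c₃√‖X‖/(k⁵(max{n₁+n₂, k})²)) · (ε(√k − √(r−1))/(C₁κ²√(max{n₁+n₂, k})))^{C₂κ}. Then there is a number of iterations T ≤ C · ln(2√(2‖X‖)/(εα(√k − √(r−1))))/(μσ_min(X)) such that, with probability at least 1 − C₃exp(−c₄k) − (C₄ε)^{k−r+1}, it holds that ‖V_T W_Tᵀ − X‖/‖X‖ ≤ C · α^{3/5}/‖X‖^{3/10}. -/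

import Mathlib

open Matrix MeasureTheory ProbabilityTheory

noncomputable section

namespace AsymMatrixSensing

/-- Euclidean norm of a real vector. -/
def euclNorm {ι : Type*} [Fintype ι] (v : ι → ℝ) : ℝ :=
  Real.sqrt (∑ i, v i ^ 2)

/-- Spectral norm of a real matrix. -/
def specNorm {ι₁ ι₂ : Type*} [Fintype ι₁] [Fintype ι₂] (M : Matrix ι₁ ι₂ ℝ) : ℝ :=
  sSup {c : ℝ | ∃ x : ι₂ → ℝ, euclNorm x ≤ 1 ∧ c = euclNorm (M.mulVec x)}

/-- Frobenius norm of a real matrix. -/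
def frobNorm {ι₁ ι₂ : Type*} [Fintype ι₁] [Fintype ι₂] (M : Matrix ι₁ ι₂ ℝ) : ℝ :=
  Real.sqrt (∑ i, ∑ j, M i j ^ 2)

/-- Nuclear norm of a real matrix (characterized by duality with the spectral norm). -/
def nucNorm {ι₁ ι₂ : Type*} [Fintype ι₁] [Fintype ι₂] (M : Matrix ι₁ ι₂ ℝ) : ℝ :=
  sSup {c : ℝ | ∃ B : Matrix ι₁ ι₂ ℝ, specNorm B ≤ 1 ∧ c = ∑ i, ∑ j, M i j * B i j}

/-- Smallest singular value `σ_{min(a,b)}(M)` of a matrix. -/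
def sigmaMin {ι₁ ι₂ : Type*} [Fintype ι₁] [Fintype ι₂] (M : Matrix ι₁ ι₂ ℝ) : ℝ :=
  max (sInf {c : ℝ | ∃ x : ι₂ → ℝ, euclNorm x = 1 ∧ c = euclNorm (M.mulVec x)})
      (sInf {c : ℝ | ∃ y : ι₁ → ℝ, euclNorm y = 1 ∧ c = euclNorm (Mᵀ.mulVec y)})

/-- Smallest nonzero singular value `σ_rank(M)`: the minimum of `‖Mx‖` over unit
vectors `x` orthogonal to the kernel of `M`. -/
def sigmaPos {ι₁ ι₂ : Type*} [Fintype ι₁] [Fintype ι₂] (M : Matrix ι₁ ι₂ ℝ) : ℝ :=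
  sInf {c : ℝ | ∃ x : ι₂ → ℝ, euclNorm x = 1 ∧
    (∀ y : ι₂ → ℝ, M.mulVec y = 0 → x ⬝ᵥ y = 0) ∧ c = euclNorm (M.mulVec x)}

/-- Condition number `κ = ‖M‖ / σ_min(M)`. -/
def condNum {ι₁ ι₂ : Type*} [Fintype ι₁] [Fintype ι₂] (M : Matrix ι₁ ι₂ ℝ) : ℝ :=
  specNorm M / sigmaPos M

/-- Trace inner product `⟨M, N⟩ = trace(Mᵀ N)`. -/
def minner {ι₁ ι₂ : Type*} [Fintype ι₁] [Fintype ι₂] (M N : Matrix ι₁ ι₂ ℝ) : ℝ :=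
  ∑ i, ∑ j, M i j * N i j

/-- `P` is a matrix with orthonormal columns spanning the column space of `M`. -/
def IsOrthCol {ι κ₁ κ₂ : Type*} [Fintype ι] [Fintype κ₁] [Fintype κ₂] [DecidableEq κ₂]
    (P : Matrix ι κ₂ ℝ) (M : Matrix ι κ₁ ℝ) : Prop :=
  Pᵀ * P = 1 ∧ (∃ C : Matrix κ₁ κ₂ ℝ, P = M * C) ∧ P * Pᵀ * M = M

/-- `L` has orthonormal columns spanning the subspace spanned by eigenvectors of the
symmetric matrix `F` corresponding to its `r` largest eigenvalues. -/
def IsTopEigenspace {ι : Type*} [Fintype ι] [DecidableEq ι] {r : ℕ} (F : Matrix ι ι ℝ)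
    (L : Matrix ι (Fin r) ℝ) : Prop :=
  Lᵀ * L = 1 ∧ ∃ d : Fin r → ℝ, F * L = L * Matrix.diagonal d ∧
    ∀ (v : ι → ℝ) (lam : ℝ), v ≠ 0 → F.mulVec v = lam • v →
      Lᵀ.mulVec v = 0 → ∀ i, lam ≤ d i

variable {n₁ n₂ m k r : ℕ}

/-- The measurement operator `𝒜`, given by `[𝒜(Z)]ᵢ = ⟨Aᵢ, Z⟩`. -/
def calA (A : Fin m → Matrix (Fin n₁) (Fin n₂) ℝ) (Z : Matrix (Fin n₁) (Fin n₂) ℝ) :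
    Fin m → ℝ := fun i => minner (A i) Z

/-- The restricted isometry property of order `s` with constant `δ`. -/
def HasRIP (A : Fin m → Matrix (Fin n₁) (Fin n₂) ℝ) (s : ℕ) (δ : ℝ) : Prop :=
  ∀ M : Matrix (Fin n₁) (Fin n₂) ℝ, M.rank ≤ s →
    (1 - δ) * frobNorm M ^ 2 ≤ ∑ i, calA A M i ^ 2 ∧
      ∑ i, calA A M i ^ 2 ≤ (1 + δ) * frobNorm M ^ 2

/-- `𝒜*𝒜`. -/
def AstarA (A : Fin m → Matrix (Fin n₁) (Fin n₂) ℝ) (Z : Matrix (Fin n₁) (Fin n₂) ℝ) :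
    Matrix (Fin n₁) (Fin n₂) ℝ := ∑ i, minner (A i) Z • A i

/-- The symmetrization `sym(X) = [[0, X], [Xᵀ, 0]]`. -/
def symMat (X : Matrix (Fin n₁) (Fin n₂) ℝ) :
    Matrix (Fin n₁ ⊕ Fin n₂) (Fin n₁ ⊕ Fin n₂) ℝ := Matrix.fromBlocks 0 X Xᵀ 0

/-- The symmetrized measurement matrices `Bᵢ = (1/√2)[[0, Aᵢ], [Aᵢᵀ, 0]]`. -/
def Bmat (A : Fin m → Matrix (Fin n₁) (Fin n₂) ℝ) (i : Fin m) :
    Matrix (Fin n₁ ⊕ Fin n₂) (Fin n₁ ⊕ Fin n₂) ℝ :=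
  (Real.sqrt 2)⁻¹ • Matrix.fromBlocks 0 (A i) (A i)ᵀ 0

/-- `ℬ*ℬ`. -/
def BstarB (A : Fin m → Matrix (Fin n₁) (Fin n₂) ℝ)
    (S : Matrix (Fin n₁ ⊕ Fin n₂) (Fin n₁ ⊕ Fin n₂) ℝ) :
    Matrix (Fin n₁ ⊕ Fin n₂) (Fin n₁ ⊕ Fin n₂) ℝ :=
  ∑ i, minner (Bmat A i) S • Bmat A i

/-- The factorized gradient descent iterates `(V_t, W_t)`. -/
def iter (A : Fin m → Matrix (Fin n₁) (Fin n₂) ℝ) (X : Matrix (Fin n₁) (Fin n₂) ℝ)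
    (μ : ℝ) (V₀ : Matrix (Fin n₁) (Fin k) ℝ) (W₀ : Matrix (Fin n₂) (Fin k) ℝ) :
    ℕ → Matrix (Fin n₁) (Fin k) ℝ × Matrix (Fin n₂) (Fin k) ℝ
  | 0 => (V₀, W₀)
  | t + 1 =>
    let p := iter A X μ V₀ W₀ t
    let G := AstarA A (p.1 * p.2ᵀ - X)
    (p.1 - μ • (G * p.2), p.2 - μ • (Gᵀ * p.1))

/-- The vertical stacking `(1/√2)[V; W]`. -/
def Zstack {κ : ℕ} (V : Matrix (Fin n₁) (Fin κ) ℝ) (W : Matrix (Fin n₂) (Fin κ) ℝ) :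
    Matrix (Fin n₁ ⊕ Fin n₂) (Fin κ) ℝ :=
  (Real.sqrt 2)⁻¹ • Matrix.fromRows V W

/-- `Z_t = (1/√2)[V_t; W_t]`. -/
def Zit (A : Fin m → Matrix (Fin n₁) (Fin n₂) ℝ) (X : Matrix (Fin n₁) (Fin n₂) ℝ)
    (μ : ℝ) (V₀ : Matrix (Fin n₁) (Fin k) ℝ) (W₀ : Matrix (Fin n₂) (Fin k) ℝ) (t : ℕ) :
    Matrix (Fin n₁ ⊕ Fin n₂) (Fin k) ℝ :=
  Zstack (iter A X μ V₀ W₀ t).1 (iter A X μ V₀ W₀ t).2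

/-- `Z̃_t = (1/√2)[V_t; −W_t]`. -/
def Ztil (A : Fin m → Matrix (Fin n₁) (Fin n₂) ℝ) (X : Matrix (Fin n₁) (Fin n₂) ℝ)
    (μ : ℝ) (V₀ : Matrix (Fin n₁) (Fin k) ℝ) (W₀ : Matrix (Fin n₂) (Fin k) ℝ) (t : ℕ) :
    Matrix (Fin n₁ ⊕ Fin n₂) (Fin k) ℝ :=
  Zstack (iter A X μ V₀ W₀ t).1 (-(iter A X μ V₀ W₀ t).2)

/-- `Δ_t = (Id − ℬ*ℬ)(Z_tZ_tᵀ − Z̃_tZ̃_tᵀ − sym(X))`. -/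
def Δit (A : Fin m → Matrix (Fin n₁) (Fin n₂) ℝ) (X : Matrix (Fin n₁) (Fin n₂) ℝ)
    (μ : ℝ) (V₀ : Matrix (Fin n₁) (Fin k) ℝ) (W₀ : Matrix (Fin n₂) (Fin k) ℝ) (t : ℕ) :
    Matrix (Fin n₁ ⊕ Fin n₂) (Fin n₁ ⊕ Fin n₂) ℝ :=
  let D := Zit A X μ V₀ W₀ t * (Zit A X μ V₀ W₀ t)ᵀ
    - Ztil A X μ V₀ W₀ t * (Ztil A X μ V₀ W₀ t)ᵀ - symMat X
  D - BstarB A D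

/-- The block diagonal matrix `diag(Id_{n₁}, −Id_{n₂})`. -/
def flipSign (n₁ n₂ : ℕ) : Matrix (Fin n₁ ⊕ Fin n₂) (Fin n₁ ⊕ Fin n₂) ℝ :=
  Matrix.fromBlocks 1 0 0 (-1)

/-- Product Gaussian measure modelling the random initialization pair `(V, W)`
with i.i.d. standard Gaussian entries. -/
def gaussPair (n₁ n₂ k : ℕ) :
    Measure ((Fin n₁ → Fin k → ℝ) × (Fin n₂ → Fin k → ℝ)) :=
  (Measure.pi fun _ : Fin n₁ => Measure.pi fun _ : Fin k => gaussianReal 0 1).prod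
    (Measure.pi fun _ : Fin n₂ => Measure.pi fun _ : Fin k => gaussianReal 0 1)

/-! ### Norm toolbox -/
section Norms
open scoped Matrix.Norms.L2Operator

variable {a b c d : Type*} [Fintype a] [Fintype b] [Fintype c] [Fintype d]

lemma nv_eq (v : a → ℝ) : euclNorm v = ‖(WithLp.toLp 2 v : EuclideanSpace ℝ a)‖ := by
  rw [EuclideanSpace.norm_eq]; simp [euclNorm]

lemma nv_nonneg (v : a → ℝ) : 0 ≤ euclNorm v := Real.sqrt_nonneg _

lemma nv_sq (v : a → ℝ) : euclNorm v ^ 2 = v ⬝ᵥ v := by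
  rw [euclNorm, Real.sq_sqrt (Finset.sum_nonneg fun i _ => sq_nonneg _)]
  simp [dotProduct, sq]

lemma nv_zero : euclNorm (0 : a → ℝ) = 0 := by simp [euclNorm]

lemma nv_eq_zero {v : a → ℝ} (h : euclNorm v = 0) : v = 0 := by
  have := nv_sq v
  rw [h] at this
  exact dotProduct_self_eq_zero.1 (by simpa using this.symm)

lemma nv_add (v w : a → ℝ) : euclNorm (v + w) ≤ euclNorm v + euclNorm w := by
  simp only [nv_eq]
  exact norm_add_le (WithLp.toLp 2 v : EuclideanSpace ℝ a) (WithLp.toLp 2 w)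

lemma nv_sub (v w : a → ℝ) : euclNorm (v - w) ≤ euclNorm v + euclNorm w := by
  simp only [nv_eq]
  exact norm_sub_le (WithLp.toLp 2 v : EuclideanSpace ℝ a) (WithLp.toLp 2 w)

lemma nv_smul (s : ℝ) (v : a → ℝ) : euclNorm (s • v) = |s| * euclNorm v := by
  simp only [nv_eq]
  exact norm_smul s (WithLp.toLp 2 v : EuclideanSpace ℝ a)

lemma nv_neg (v : a → ℝ) : euclNorm (-v) = euclNorm v := by
  simp [euclNorm]

lemma dot_abs_le (v w : a → ℝ) : |v ⬝ᵥ w| ≤ euclNorm v * euclNorm w := by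
  have := abs_real_inner_le_norm (WithLp.toLp 2 v : EuclideanSpace ℝ a) (WithLp.toLp 2 w)
  rw [EuclideanSpace.inner_toLp_toLp] at this
  simp only [nv_eq]
  simpa [dotProduct_comm] using this

lemma dot_le (v w : a → ℝ) : v ⬝ᵥ w ≤ euclNorm v * euclNorm w :=
  (le_abs_self _).trans (dot_abs_le v w)

lemma neg_le_dot (v w : a → ℝ) : -(euclNorm v * euclNorm w) ≤ v ⬝ᵥ w :=
  (neg_le_neg (dot_abs_le v w)).trans (neg_abs_le _)

lemma nv_mulVec [DecidableEq b] (M : Matrix a b ℝ) (v : b → ℝ) :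
    euclNorm (M *ᵥ v) ≤ ‖M‖ * euclNorm v := by
  simp only [nv_eq]
  exact Matrix.l2_opNorm_mulVec M (WithLp.toLp 2 v)

lemma opn_le [DecidableEq b] (M : Matrix a b ℝ) {C : ℝ} (hC : 0 ≤ C)
    (h : ∀ v, euclNorm (M *ᵥ v) ≤ C * euclNorm v) : ‖M‖ ≤ C := by
  rw [Matrix.l2_opNorm_def]
  refine ContinuousLinearMap.opNorm_le_bound _ hC fun x => ?_
  have := h x.ofLp
  simp only [nv_eq] at this
  exact this

lemma specNorm_eq [DecidableEq b] (M : Matrix a b ℝ) : specNorm M = ‖M‖ := by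
  have hb : ∀ c ∈ {c : ℝ | ∃ x : b → ℝ, euclNorm x ≤ 1 ∧ c = euclNorm (M.mulVec x)}, c ≤ ‖M‖ := by
    rintro c ⟨x, hx, rfl⟩
    exact (nv_mulVec M x).trans (mul_le_of_le_one_right (norm_nonneg _) hx)
  apply le_antisymm
  · exact csSup_le ⟨0, 0, by simp [nv_zero], by simp [nv_zero]⟩ hb
  · refine opn_le M (Real.sSup_nonneg (by rintro c ⟨x, hx, rfl⟩; exact nv_nonneg _)) fun v => ?_
    by_cases h : euclNorm v = 0
    · rw [nv_eq_zero h]; simp [nv_zero]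
    have hp : 0 < euclNorm v := lt_of_le_of_ne (nv_nonneg v) (Ne.symm h)
    have h1 : euclNorm (M *ᵥ ((euclNorm v)⁻¹ • v)) ≤ specNorm M := by
      refine le_csSup ⟨_, hb⟩ ⟨_, ?_, rfl⟩
      rw [nv_smul, abs_of_pos (inv_pos.2 hp), inv_mul_cancel₀ h]
    rw [Matrix.mulVec_smul, nv_smul, abs_of_pos (inv_pos.2 hp), inv_mul_le_iff₀ hp] at h1
    rw [mul_comm] at h1
    exact h1

lemma opn_mul [DecidableEq b] [DecidableEq c] (A : Matrix a b ℝ) (B : Matrix b c ℝ) :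
    ‖A * B‖ ≤ ‖A‖ * ‖B‖ := Matrix.l2_opNorm_mul A B

lemma opn_transpose [DecidableEq a] [DecidableEq b] (A : Matrix a b ℝ) : ‖Aᵀ‖ = ‖A‖ := by
  have := Matrix.l2_opNorm_conjTranspose A
  simpa [Matrix.conjTranspose_eq_transpose_of_trivial] using this

lemma opn_one_le [DecidableEq a] : ‖(1 : Matrix a a ℝ)‖ ≤ 1 := by
  refine opn_le _ zero_le_one fun v => by simp

lemma opn_mul_le [DecidableEq b] [DecidableEq c] {A : Matrix a b ℝ} {B : Matrix b c ℝ} {x y : ℝ}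
    (hA : ‖A‖ ≤ x) (hB : ‖B‖ ≤ y) : ‖A * B‖ ≤ x * y :=
  (opn_mul A B).trans (mul_le_mul hA hB (norm_nonneg _) ((norm_nonneg _).trans hA))

lemma opn_diag_le [DecidableEq a] (l : a → ℝ) {C : ℝ} (hC : 0 ≤ C) (h : ∀ i, |l i| ≤ C) :
    ‖Matrix.diagonal l‖ ≤ C := by
  rw [Matrix.l2_opNorm_diagonal]
  exact (pi_norm_le_iff_of_nonneg hC).2 (by simpa using h)

lemma dot_mulVec_comm (M : Matrix a b ℝ) (v : a → ℝ) (w : b → ℝ) :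
    v ⬝ᵥ (M *ᵥ w) = (Mᵀ *ᵥ v) ⬝ᵥ w := by
  rw [Matrix.dotProduct_mulVec, Matrix.mulVec_transpose]

/-- small perturbation of identity is invertible -/
lemma inv_one_add [DecidableEq a] (Q : Matrix a a ℝ) (h : ‖Q‖ ≤ 1 / 2) :
    (1 + Q) * (1 + Q)⁻¹ = 1 ∧ (1 + Q)⁻¹ * (1 + Q) = 1 ∧ ‖(1 + Q)⁻¹‖ ≤ 2 ∧
      ‖(1 + Q)⁻¹ - 1‖ ≤ 2 * ‖Q‖ := by
  have hinj : ∀ v, (1 + Q) *ᵥ v = 0 → v = 0 := by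
    intro v hv
    rw [Matrix.add_mulVec, Matrix.one_mulVec] at hv
    have h1 : v = -(Q *ᵥ v) := eq_neg_of_add_eq_zero_left hv
    have h2 : euclNorm v ≤ ‖Q‖ * euclNorm v := by
      conv_lhs => rw [h1, nv_neg]
      exact nv_mulVec Q v
    exact nv_eq_zero (le_antisymm (by nlinarith [nv_nonneg v]) (nv_nonneg v))
  have hu : IsUnit (1 + Q) := by
    rw [← Matrix.mulVec_injective_iff_isUnit]
    intro v w hvw
    have := hinj (v - w) (by rw [Matrix.mulVec_sub, hvw, sub_self])
    exact sub_eq_zero.1 this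
  have hd := (Matrix.isUnit_iff_isUnit_det _).1 hu
  have e1 := Matrix.mul_nonsing_inv _ hd
  have e2 := Matrix.nonsing_inv_mul _ hd
  have n2 : ‖(1 + Q)⁻¹‖ ≤ 2 := by
    refine opn_le _ (by norm_num) fun v => ?_
    set w := (1 + Q)⁻¹ *ᵥ v
    have hv : v = w + Q *ᵥ w := by
      have : (1 + Q) *ᵥ w = v := by simp only [w, Matrix.mulVec_mulVec, e1, Matrix.one_mulVec]
      rw [← this, Matrix.add_mulVec, Matrix.one_mulVec]
    have hw : w = v - Q *ᵥ w := by rw [hv]; simp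
    have h3 : euclNorm w ≤ euclNorm v + euclNorm (Q *ᵥ w) := by
      conv_lhs => rw [hw]
      exact nv_sub _ _
    have := nv_mulVec Q w
    nlinarith [nv_nonneg w]
  refine ⟨e1, e2, n2, ?_⟩
  have : (1 + Q)⁻¹ - 1 = -((1 + Q)⁻¹ * Q) := by
    have : (1 + Q)⁻¹ * (1 + Q) = (1 + Q)⁻¹ + (1 + Q)⁻¹ * Q := by rw [mul_add, mul_one]
    rw [e2] at this
    rw [sub_eq_iff_eq_add, ← sub_eq_neg_add, eq_sub_iff_add_eq, ← this]
  rw [this, norm_neg]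
  exact opn_mul_le n2 le_rfl

/-! Frobenius norm and inner product -/

lemma fro_nonneg (M : Matrix a b ℝ) : 0 ≤ frobNorm M := Real.sqrt_nonneg _

lemma fro_eq_nv (M : Matrix a b ℝ) : frobNorm M = euclNorm (fun p : a × b => M p.1 p.2) := by
  rw [frobNorm, euclNorm, Fintype.sum_prod_type]

lemma minner_eq_dot (M N : Matrix a b ℝ) :
    minner M N = (fun p : a × b => M p.1 p.2) ⬝ᵥ (fun p : a × b => N p.1 p.2) := by
  rw [minner, dotProduct, Fintype.sum_prod_type]

lemma fro_sq (M : Matrix a b ℝ) : frobNorm M ^ 2 = minner M M := by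
  rw [fro_eq_nv, nv_sq, minner_eq_dot]

lemma minner_abs_le (M N : Matrix a b ℝ) : |minner M N| ≤ frobNorm M * frobNorm N := by
  rw [fro_eq_nv, fro_eq_nv, minner_eq_dot]; exact dot_abs_le _ _

lemma fro_add (M N : Matrix a b ℝ) : frobNorm (M + N) ≤ frobNorm M + frobNorm N := by
  simp only [fro_eq_nv]; exact nv_add _ _

lemma fro_sub (M N : Matrix a b ℝ) : frobNorm (M - N) ≤ frobNorm M + frobNorm N := by
  simp only [fro_eq_nv]; exact nv_sub _ _

lemma fro_smul (s : ℝ) (M : Matrix a b ℝ) : frobNorm (s • M) = |s| * frobNorm M := by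
  simp only [fro_eq_nv]; exact nv_smul _ _

lemma fro_transpose (M : Matrix a b ℝ) : frobNorm Mᵀ = frobNorm M := by
  rw [frobNorm, frobNorm, Finset.sum_comm]; rfl

lemma minner_comm (M N : Matrix a b ℝ) : minner M N = minner N M := by
  simp [minner, mul_comm]

lemma minner_add_left (M M' N : Matrix a b ℝ) : minner (M + M') N = minner M N + minner M' N := by
  simp [minner, add_mul, Finset.sum_add_distrib]

lemma minner_add_right (M N N' : Matrix a b ℝ) : minner M (N + N') = minner M N + minner M N' := by
  simp [minner, mul_add, Finset.sum_add_distrib]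

lemma minner_sub_right (M N N' : Matrix a b ℝ) : minner M (N - N') = minner M N - minner M N' := by
  simp [minner, mul_sub, Finset.sum_sub_distrib]

lemma minner_sub_left (M M' N : Matrix a b ℝ) : minner (M - M') N = minner M N - minner M' N := by
  simp [minner, sub_mul, Finset.sum_sub_distrib]

lemma minner_smul_left (s : ℝ) (M N : Matrix a b ℝ) : minner (s • M) N = s * minner M N := by
  simp [minner, mul_assoc, Finset.mul_sum]

lemma minner_smul_right (s : ℝ) (M N : Matrix a b ℝ) : minner M (s • N) = s * minner M N := by
  rw [minner_comm, minner_smul_left, minner_comm]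

lemma minner_eq_trace (M N : Matrix a b ℝ) : minner M N = (Mᵀ * N).trace := by
  rw [minner, Finset.sum_comm]; simp [Matrix.trace, Matrix.mul_apply]

lemma minner_mul_left (A : Matrix a b ℝ) (B : Matrix b c ℝ) (C : Matrix a c ℝ) :
    minner (A * B) C = minner B (Aᵀ * C) := by
  rw [minner_eq_trace, minner_eq_trace, Matrix.transpose_mul, Matrix.mul_assoc]

lemma minner_mul_right (A : Matrix a b ℝ) (B : Matrix b c ℝ) (C : Matrix a c ℝ) :
    minner (A * B) C = minner A (C * Bᵀ) := by
  rw [minner_eq_trace, minner_eq_trace, Matrix.transpose_mul, Matrix.mul_assoc,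
    Matrix.trace_mul_comm, Matrix.mul_assoc]

lemma fro_sq_cols (M : Matrix a b ℝ) : frobNorm M ^ 2 = ∑ j, euclNorm (fun i => M i j) ^ 2 := by
  rw [frobNorm, Real.sq_sqrt (by positivity), Finset.sum_comm]
  refine Finset.sum_congr rfl fun j _ => ?_
  rw [euclNorm, Real.sq_sqrt (Finset.sum_nonneg fun i _ => sq_nonneg _)]

lemma fro_mul_left [DecidableEq b] (A : Matrix a b ℝ) (B : Matrix b c ℝ) :
    frobNorm (A * B) ≤ ‖A‖ * frobNorm B := by
  refine abs_le_of_sq_le_sq' ?_ (mul_nonneg (norm_nonneg _) (fro_nonneg _)) |>.2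
  rw [mul_pow, fro_sq_cols, fro_sq_cols, Finset.mul_sum]
  refine Finset.sum_le_sum fun j _ => ?_
  rw [← mul_pow]
  have : (fun i => (A * B) i j) = A *ᵥ (fun i => B i j) := by
    ext i; simp [Matrix.mul_apply, Matrix.mulVec, dotProduct]
  rw [this]
  exact pow_le_pow_left₀ (nv_nonneg _) (nv_mulVec A _) 2

lemma fro_mul_right [DecidableEq b] [DecidableEq c] (A : Matrix a b ℝ) (B : Matrix b c ℝ) :
    frobNorm (A * B) ≤ frobNorm A * ‖B‖ := by
  rw [← fro_transpose, Matrix.transpose_mul, ← fro_transpose A, ← opn_transpose B, mul_comm]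
  exact fro_mul_left _ _

lemma opn_le_fro [DecidableEq b] (M : Matrix a b ℝ) : ‖M‖ ≤ frobNorm M := by
  refine opn_le M (fro_nonneg _) fun v => ?_
  refine abs_le_of_sq_le_sq' ?_ (mul_nonneg (fro_nonneg _) (nv_nonneg _)) |>.2
  rw [mul_pow]
  have e1 : euclNorm (M *ᵥ v) ^ 2 = ∑ i, ((fun j => M i j) ⬝ᵥ v) ^ 2 := by
    rw [euclNorm, Real.sq_sqrt (Finset.sum_nonneg fun i _ => sq_nonneg _)]; rfl
  have e2 : frobNorm M ^ 2 = ∑ i, euclNorm (fun j => M i j) ^ 2 := by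
    rw [← fro_transpose, fro_sq_cols]; rfl
  rw [e1, e2, Finset.sum_mul]
  refine Finset.sum_le_sum fun i _ => ?_
  rw [← mul_pow]
  exact sq_le_sq' (neg_le_dot _ _) (dot_le _ _)

lemma fro_le_cols [DecidableEq b] (M : Matrix a b ℝ) :
    frobNorm M ≤ Real.sqrt (Fintype.card b) * ‖M‖ := by
  refine abs_le_of_sq_le_sq' ?_ (mul_nonneg (Real.sqrt_nonneg _) (norm_nonneg _)) |>.2
  rw [mul_pow, Real.sq_sqrt (Nat.cast_nonneg _), fro_sq_cols]
  have : ∀ j ∈ Finset.univ, euclNorm (fun i => M i j) ^ 2 ≤ ‖M‖ ^ 2 := by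
    intro j _
    have h := nv_mulVec M (Pi.single j 1)
    have e1 : M *ᵥ Pi.single j 1 = fun i => M i j := by
      ext i; simp
    have e2 : euclNorm (Pi.single j (1:ℝ) : b → ℝ) = 1 := by
      rw [nv_eq]; simp
    rw [e1, e2, mul_one] at h
    exact pow_le_pow_left₀ (nv_nonneg _) h 2
  simpa using Finset.sum_le_sum this

lemma fro_le_rows [DecidableEq a] [DecidableEq b] (M : Matrix a b ℝ) :
    frobNorm M ≤ Real.sqrt (Fintype.card a) * ‖M‖ := by
  rw [← fro_transpose, ← opn_transpose]; exact fro_le_cols _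

/-- Frobenius norm of a product with small inner dimension. -/
lemma fro_mul_inner [DecidableEq b] [DecidableEq c] (A : Matrix a b ℝ) (B : Matrix b c ℝ) :
    frobNorm (A * B) ≤ Real.sqrt (Fintype.card b) * ‖A‖ * ‖B‖ :=
  (fro_mul_right A B).trans (mul_le_mul_of_nonneg_right (fro_le_cols A) (norm_nonneg _))

lemma fro_eq_zero {M : Matrix a b ℝ} (h : frobNorm M = 0) : M = 0 := by
  rw [fro_eq_nv] at h
  ext i j
  exact congrFun (nv_eq_zero h) (i, j)

lemma fro_neg (M : Matrix a b ℝ) : frobNorm (-M) = frobNorm M := by simp [frobNorm]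

/-- rank `r` matrices have Frobenius norm at most `√r` times the operator norm -/
lemma fro_le_rank [DecidableEq a] [DecidableEq b] (M : Matrix a b ℝ) {r : ℕ} (h : M.rank = r) :
    frobNorm M ≤ Real.sqrt r * ‖M‖ := by
  classical
  -- orthonormal basis of the column space
  let L : Submodule ℝ (EuclideanSpace ℝ a) :=
    (LinearMap.range M.mulVecLin).map (WithLp.linearEquiv 2 ℝ (a → ℝ)).symm.toLinearMap
  have hL : Module.finrank ℝ L = r := by
    rw [← h, Matrix.rank]
    exact LinearEquiv.finrank_map_eq _ _
  let e := (stdOrthonormalBasis ℝ L).reindex (finCongr hL)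
  let P : Matrix a (Fin r) ℝ := Matrix.of fun i j => (e j : EuclideanSpace ℝ a) i
  have hPP : Pᵀ * P = 1 := by
    ext i j
    have := e.orthonormal
    rw [orthonormal_iff_ite] at this
    have h2 := this j i
    rw [Submodule.coe_inner, PiLp.inner_apply] at h2
    rw [Matrix.mul_apply, Matrix.one_apply]
    simp only [Matrix.transpose_apply, P, Matrix.of_apply]
    simp only [RCLike.inner_apply, conj_trivial] at h2
    rw [h2]
    simp [eq_comm]
  have hPM : P * (Pᵀ * M) = M := by
    ext i j
    let v : EuclideanSpace ℝ a := WithLp.toLp 2 (fun i => M i j)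
    have hv : v ∈ L := by
      refine ⟨fun i => M i j, ⟨Pi.single j 1, ?_⟩, rfl⟩
      ext i; simp
    have h3 := e.sum_repr ⟨v, hv⟩
    have h4 := congrArg (fun w : L => (w : EuclideanSpace ℝ a) i) h3
    simp only [Submodule.coe_sum, Submodule.coe_smul, WithLp.ofLp_sum, Finset.sum_apply] at h4
    have h5 : v i = M i j := rfl
    rw [h5] at h4
    rw [← h4, Matrix.mul_apply]
    refine Finset.sum_congr rfl fun l _ => ?_
    rw [e.repr_apply_apply, Submodule.coe_inner, PiLp.inner_apply]
    simp only [P, Matrix.of_apply, Matrix.mul_apply, Matrix.transpose_apply, PiLp.smul_apply,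
      smul_eq_mul, RCLike.inner_apply, conj_trivial]
    rw [mul_comm]
    congr 1
    refine Finset.sum_congr rfl fun x _ => ?_
    rw [mul_comm]
  have hP1 : ‖P‖ ≤ 1 := by
    refine opn_le _ zero_le_one fun v => ?_
    refine abs_le_of_sq_le_sq' ?_ (by simpa using nv_nonneg v) |>.2
    rw [one_mul, nv_sq, nv_sq, dot_mulVec_comm, Matrix.mulVec_mulVec, hPP, Matrix.one_mulVec]
  have h6 : ‖Pᵀ * M‖ ≤ ‖M‖ := by
    refine (opn_mul_le (x := 1) ?_ le_rfl).trans (by simp)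
    rw [opn_transpose]; exact hP1
  calc frobNorm M = frobNorm (P * (Pᵀ * M)) := by rw [hPM]
    _ ≤ ‖P‖ * frobNorm (Pᵀ * M) := fro_mul_left _ _
    _ ≤ 1 * (Real.sqrt r * ‖M‖) := by
        refine mul_le_mul hP1 ?_ (fro_nonneg _) zero_le_one
        refine (fro_le_rows _).trans ?_
        simp only [Fintype.card_fin]
        exact mul_le_mul_of_nonneg_left h6 (Real.sqrt_nonneg _)
    _ = _ := one_mul _

lemma orth_opn_le [DecidableEq b] (P : Matrix a b ℝ) (hPP : Pᵀ * P = 1) : ‖P‖ ≤ 1 := by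
  refine opn_le _ zero_le_one fun v => ?_
  refine abs_le_of_sq_le_sq' ?_ (by simpa using nv_nonneg v) |>.2
  rw [one_mul, nv_sq, nv_sq, dot_mulVec_comm, Matrix.mulVec_mulVec, hPP, Matrix.one_mulVec]

end Norms

/-! ### RIP consequences -/
section Rip
open scoped Matrix.Norms.L2Operator

variable {n₁ n₂ m k r : ℕ}

lemma AstarA_add (A : Fin m → Matrix (Fin n₁) (Fin n₂) ℝ) (X Y : Matrix (Fin n₁) (Fin n₂) ℝ) :
    AstarA A (X + Y) = AstarA A X + AstarA A Y := by
  simp [AstarA, minner_add_right, add_smul, Finset.sum_add_distrib]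

lemma AstarA_sub (A : Fin m → Matrix (Fin n₁) (Fin n₂) ℝ) (X Y : Matrix (Fin n₁) (Fin n₂) ℝ) :
    AstarA A (X - Y) = AstarA A X - AstarA A Y := by
  simp [AstarA, minner_sub_right, sub_smul, Finset.sum_sub_distrib]

lemma AstarA_smul (A : Fin m → Matrix (Fin n₁) (Fin n₂) ℝ) (s : ℝ)
    (X : Matrix (Fin n₁) (Fin n₂) ℝ) : AstarA A (s • X) = s • AstarA A X := by
  simp [AstarA, minner_smul_right, mul_smul, Finset.smul_sum]

lemma minner_sum_left {a b ι : Type*} [Fintype a] [Fintype b] (s : Finset ι)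
    (f : ι → Matrix a b ℝ) (N : Matrix a b ℝ) :
    minner (∑ i ∈ s, f i) N = ∑ i ∈ s, minner (f i) N := by
  classical
  induction s using Finset.induction_on with
  | empty => simp [minner]
  | insert i s hi ih => rw [Finset.sum_insert hi, Finset.sum_insert hi, minner_add_left, ih]

lemma minner_AstarA (A : Fin m → Matrix (Fin n₁) (Fin n₂) ℝ) (X Y : Matrix (Fin n₁) (Fin n₂) ℝ) :
    minner (AstarA A X) Y = ∑ i, calA A X i * calA A Y i := by
  simp [AstarA, minner_sum_left, minner_smul_left, calA]

/-- the error operator `𝒜*𝒜 - I` -/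
def Qop (A : Fin m → Matrix (Fin n₁) (Fin n₂) ℝ) (Z : Matrix (Fin n₁) (Fin n₂) ℝ) :
    Matrix (Fin n₁) (Fin n₂) ℝ := AstarA A Z - Z

lemma Qop_add (A : Fin m → Matrix (Fin n₁) (Fin n₂) ℝ) (X Y : Matrix (Fin n₁) (Fin n₂) ℝ) :
    Qop A (X + Y) = Qop A X + Qop A Y := by
  simp only [Qop, AstarA_add]; abel

lemma Qop_sub (A : Fin m → Matrix (Fin n₁) (Fin n₂) ℝ) (X Y : Matrix (Fin n₁) (Fin n₂) ℝ) :
    Qop A (X - Y) = Qop A X - Qop A Y := by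
  simp only [Qop, AstarA_sub]; abel

lemma Qop_smul (A : Fin m → Matrix (Fin n₁) (Fin n₂) ℝ) (s : ℝ) (X : Matrix (Fin n₁) (Fin n₂) ℝ) :
    Qop A (s • X) = s • Qop A X := by
  simp only [Qop, AstarA_smul, smul_sub]

lemma Qop_zero (A : Fin m → Matrix (Fin n₁) (Fin n₂) ℝ) :
    Qop A 0 = 0 := by
  have := Qop_smul A 0 0
  simpa using this

lemma rip_aux (A : Fin m → Matrix (Fin n₁) (Fin n₂) ℝ) {s : ℕ} {δ : ℝ} (hA : HasRIP A s δ)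
    (Y Y' : Matrix (Fin n₁) (Fin n₂) ℝ) (h : ∀ t : ℝ, (Y + t • Y').rank ≤ s) (t : ℝ) :
    2 * t * minner (Qop A Y) Y' ≤ δ * (frobNorm Y ^ 2 + t ^ 2 * frobNorm Y' ^ 2) := by
  have h1 := (hA _ (h t)).2
  have h2 := (hA _ (h (-t))).1
  have e : ∀ t : ℝ, ∑ i, calA A (Y + t • Y') i ^ 2 =
      minner (AstarA A Y) Y + 2 * t * minner (AstarA A Y) Y' + t ^ 2 * minner (AstarA A Y') Y' := by
    intro t
    simp only [minner_AstarA, calA, minner_add_right, minner_smul_right, Finset.mul_sum,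
      ← Finset.sum_add_distrib]
    refine Finset.sum_congr rfl fun i _ => by ring
  have e' : ∀ t : ℝ, frobNorm (Y + t • Y') ^ 2 =
      minner Y Y + 2 * t * minner Y Y' + t ^ 2 * minner Y' Y' := by
    intro t
    rw [fro_sq]
    simp only [minner_add_right, minner_smul_right, minner_add_left, minner_smul_left]
    rw [minner_comm Y' Y]; ring
  rw [e, e'] at h1 h2
  rw [Qop, minner_sub_left, fro_sq, fro_sq]
  nlinarith

lemma rip_polar (A : Fin m → Matrix (Fin n₁) (Fin n₂) ℝ) {s : ℕ} {δ : ℝ} (hA : HasRIP A s δ)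
    (Y Y' : Matrix (Fin n₁) (Fin n₂) ℝ) (h : ∀ t : ℝ, (Y + t • Y').rank ≤ s) :
    |minner (Qop A Y) Y'| ≤ δ * frobNorm Y * frobNorm Y' := by
  by_cases hY : frobNorm Y = 0
  · have := fro_eq_zero hY
    subst this
    rw [Qop_zero]; simp [minner, frobNorm]
  by_cases hY' : frobNorm Y' = 0
  · have := fro_eq_zero hY'
    subst this
    simp [minner, frobNorm]
  have p : 0 < frobNorm Y := lt_of_le_of_ne (fro_nonneg _) (Ne.symm hY)
  have p' : 0 < frobNorm Y' := lt_of_le_of_ne (fro_nonneg _) (Ne.symm hY')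
  have key : ∀ q : ℝ, 2 * (frobNorm Y / frobNorm Y') * q ≤
      δ * (frobNorm Y ^ 2 + (frobNorm Y / frobNorm Y') ^ 2 * frobNorm Y' ^ 2) →
      q ≤ δ * frobNorm Y * frobNorm Y' := by
    intro q hq
    have e : (frobNorm Y / frobNorm Y') ^ 2 * frobNorm Y' ^ 2 = frobNorm Y ^ 2 := by
      field_simp
    rw [e] at hq
    have h2 : (frobNorm Y / frobNorm Y') * q ≤ (frobNorm Y / frobNorm Y') *
        (δ * frobNorm Y * frobNorm Y') := by
      have : (frobNorm Y / frobNorm Y') * (δ * frobNorm Y * frobNorm Y') = δ * frobNorm Y ^ 2 := by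
        field_simp
      rw [this]; linarith
    exact le_of_mul_le_mul_left h2 (div_pos p p')
  refine abs_le.2 ⟨?_, ?_⟩
  · have := rip_aux A hA Y Y' h (-(frobNorm Y / frobNorm Y'))
    have := key (-minner (Qop A Y) Y') (by rw [neg_sq] at this; linarith)
    linarith
  · exact key _ (rip_aux A hA Y Y' h _)

lemma rank_add_le' {a b : Type*} [Fintype a] [Fintype b] (X Y : Matrix a b ℝ) :
    (X + Y).rank ≤ X.rank + Y.rank := by
  rw [Matrix.rank, Matrix.rank, Matrix.rank, Matrix.mulVecLin_add]
  refine (Submodule.finrank_mono (LinearMap.range_add_le _ _)).trans ?_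
  exact Submodule.finrank_add_le_finrank_add_finrank _ _

lemma rank_sub_le' {a b : Type*} [Fintype a] [Fintype b] (X Y : Matrix a b ℝ) :
    (X - Y).rank ≤ X.rank + Y.rank := by
  rw [sub_eq_add_neg]
  refine (rank_add_le' X (-Y)).trans ?_
  have : (-Y).rank ≤ Y.rank := by
    classical
    have h := Matrix.rank_mul_le_left Y (-(1 : Matrix b b ℝ))
    simpa using h
  omega

lemma rank_smul_le' {a b : Type*} [Fintype a] [Fintype b] (t : ℝ) (Y : Matrix a b ℝ) :
    (t • Y).rank ≤ Y.rank := by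
  classical
  have h := Matrix.rank_mul_le_left Y (t • (1 : Matrix b b ℝ))
  simpa using h

lemma opn_le_bilin {a b : Type*} [Fintype a] [Fintype b] [DecidableEq b] (M : Matrix a b ℝ) {C : ℝ}
    (hC : 0 ≤ C) (h : ∀ u v, u ⬝ᵥ (M *ᵥ v) ≤ C * (euclNorm u * euclNorm v)) : ‖M‖ ≤ C := by
  refine opn_le M hC fun v => ?_
  have h1 := h (M *ᵥ v) v
  rw [← nv_sq] at h1
  by_cases h0 : euclNorm (M *ᵥ v) = 0
  · rw [h0]; exact mul_nonneg hC (nv_nonneg _)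
  have hp : 0 < euclNorm (M *ᵥ v) := lt_of_le_of_ne (nv_nonneg _) (Ne.symm h0)
  nlinarith

lemma fro_vecMulVec {a b : Type*} [Fintype a] [Fintype b] (u : a → ℝ) (v : b → ℝ) :
    frobNorm (vecMulVec u v) = euclNorm u * euclNorm v := by
  rw [frobNorm, euclNorm, euclNorm, ← Real.sqrt_mul (by positivity), Finset.sum_mul_sum]
  simp [vecMulVec_apply, mul_pow]

lemma minner_vecMulVec {a b : Type*} [Fintype a] [Fintype b] (M : Matrix a b ℝ) (u : a → ℝ)
    (v : b → ℝ) : minner M (vecMulVec u v) = u ⬝ᵥ (M *ᵥ v) := by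
  simp only [minner, vecMulVec_apply, dotProduct, mulVec, Finset.mul_sum]
  refine Finset.sum_congr rfl fun i _ => Finset.sum_congr rfl fun j _ => by ring

lemma Qop_opn (A : Fin m → Matrix (Fin n₁) (Fin n₂) ℝ) {s : ℕ} {δ : ℝ} (hδ : 0 ≤ δ)
    (hA : HasRIP A (s + 1) δ) (Y : Matrix (Fin n₁) (Fin n₂) ℝ) (h : Y.rank ≤ s) :
    ‖Qop A Y‖ ≤ δ * frobNorm Y := by
  refine opn_le_bilin _ (mul_nonneg hδ (fro_nonneg _)) fun u v => ?_
  rw [← minner_vecMulVec, ← fro_vecMulVec]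
  refine (le_abs_self _).trans (rip_polar A hA Y _ fun t => ?_)
  refine (rank_add_le' _ _).trans ?_
  have h1 := rank_smul_le' t (vecMulVec u v)
  have h2 := Matrix.rank_vecMulVec_le u v
  omega

/-- noise: sum of rank-one terms -/
lemma Qop_opn_prod (A : Fin m → Matrix (Fin n₁) (Fin n₂) ℝ) {s : ℕ} {δ : ℝ} (hδ : 0 ≤ δ)
    (hs : 1 ≤ s) (hA : HasRIP A (s + 1) δ) (P : Matrix (Fin n₁) (Fin k) ℝ)
    (R : Matrix (Fin n₂) (Fin k) ℝ) :
    ‖Qop A (P * Rᵀ)‖ ≤ δ * (k * (‖P‖ * ‖R‖)) := by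
  have e : P * Rᵀ = ∑ j, vecMulVec (fun i => P i j) (fun i => R i j) := by
    ext i l
    simp [Matrix.mul_apply, Matrix.sum_apply, vecMulVec_apply]
  have e2 : ∀ S : Finset (Fin k), Qop A (∑ j ∈ S, vecMulVec (fun i => P i j) (fun i => R i j)) =
      ∑ j ∈ S, Qop A (vecMulVec (fun i => P i j) (fun i => R i j)) := by
    intro S
    induction S using Finset.induction_on with
    | empty => simp [Qop_zero]
    | insert i S hi ih => rw [Finset.sum_insert hi, Finset.sum_insert hi, Qop_add, ih]
  rw [e, e2]
  refine (norm_sum_le _ _).trans ?_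
  have col : ∀ {n : ℕ} (P : Matrix (Fin n) (Fin k) ℝ) (j : Fin k),
      euclNorm (fun i => P i j) ≤ ‖P‖ := by
    intro n P j
    have h := nv_mulVec P (Pi.single j 1)
    have e1 : P *ᵥ Pi.single j 1 = fun i => P i j := by
      ext i; simp
    have e2 : euclNorm (Pi.single j (1:ℝ) : Fin k → ℝ) = 1 := by
      rw [nv_eq]; simp
    rwa [e1, e2, mul_one] at h
  have : ∀ j ∈ Finset.univ, ‖Qop A (vecMulVec (fun i => P i j) (fun i => R i j))‖ ≤
      δ * (‖P‖ * ‖R‖) := by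
    intro j _
    refine (Qop_opn A hδ hA _ ((Matrix.rank_vecMulVec_le _ _).trans hs)).trans ?_
    rw [fro_vecMulVec]
    exact mul_le_mul_of_nonneg_left (mul_le_mul (col P j) (col R j) (nv_nonneg _) (norm_nonneg _)) hδ
  refine (Finset.sum_le_sum this).trans (le_of_eq ?_)
  simp; ring

lemma Qop_opn_low (A : Fin m → Matrix (Fin n₁) (Fin n₂) ℝ) {δ : ℝ} (hδ : 0 ≤ δ)
    (hA : HasRIP A (2 * r + 1) δ) (P : Matrix (Fin n₁) (Fin r) ℝ)
    (R : Matrix (Fin r) (Fin n₂) ℝ) :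
    ‖Qop A (P * R)‖ ≤ δ * (Real.sqrt r * ‖P‖ * ‖R‖) := by
  have h1 : (P * R).rank ≤ 2 * r := by
    have := Matrix.rank_mul_le_left P R
    have := Matrix.rank_le_width P
    omega
  refine (Qop_opn A hδ hA _ h1).trans (mul_le_mul_of_nonneg_left ?_ hδ)
  simpa using fro_mul_inner P R

/-! blocks -/
section blocks
variable {a₁ a₂ b : Type*} [Fintype a₁] [Fintype a₂] [Fintype b] [DecidableEq b]

lemma nv_sum_sq (v : a₁ ⊕ a₂ → ℝ) :
    euclNorm v ^ 2 = euclNorm (v ∘ Sum.inl) ^ 2 + euclNorm (v ∘ Sum.inr) ^ 2 := by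
  simp only [nv_sq, dotProduct, Fintype.sum_sum_type, Function.comp]

lemma rows1_le (Z : Matrix (a₁ ⊕ a₂) b ℝ) : ‖Z.toRows₁‖ ≤ ‖Z‖ := by
  refine opn_le _ (norm_nonneg _) fun v => le_trans ?_ (nv_mulVec Z v)
  refine abs_le_of_sq_le_sq' ?_ (nv_nonneg _) |>.2
  rw [nv_sum_sq (Z *ᵥ v)]
  have : Z.toRows₁ *ᵥ v = (Z *ᵥ v) ∘ Sum.inl := rfl
  rw [this]
  nlinarith [sq_nonneg (euclNorm ((Z *ᵥ v) ∘ Sum.inr))]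

lemma rows2_le (Z : Matrix (a₁ ⊕ a₂) b ℝ) : ‖Z.toRows₂‖ ≤ ‖Z‖ := by
  refine opn_le _ (norm_nonneg _) fun v => le_trans ?_ (nv_mulVec Z v)
  refine abs_le_of_sq_le_sq' ?_ (nv_nonneg _) |>.2
  rw [nv_sum_sq (Z *ᵥ v)]
  have : Z.toRows₂ *ᵥ v = (Z *ᵥ v) ∘ Sum.inr := rfl
  rw [this]
  nlinarith [sq_nonneg (euclNorm ((Z *ᵥ v) ∘ Sum.inl))]

end blocks

lemma symMat_opn (X : Matrix (Fin n₁) (Fin n₂) ℝ) : ‖symMat X‖ ≤ ‖X‖ := by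
  refine opn_le _ (norm_nonneg _) fun v => ?_
  refine abs_le_of_sq_le_sq' ?_ (mul_nonneg (norm_nonneg _) (nv_nonneg _)) |>.2
  have e1 : (symMat X *ᵥ v) ∘ Sum.inl = X *ᵥ (v ∘ Sum.inr) := by
    rw [symMat, Matrix.fromBlocks_mulVec]; simp
  have e2 : (symMat X *ᵥ v) ∘ Sum.inr = Xᵀ *ᵥ (v ∘ Sum.inl) := by
    rw [symMat, Matrix.fromBlocks_mulVec]; simp
  rw [nv_sum_sq, mul_pow, nv_sum_sq v, e1, e2]
  have h1 := nv_mulVec X (v ∘ Sum.inr)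
  have h2 := nv_mulVec Xᵀ (v ∘ Sum.inl)
  rw [opn_transpose] at h2
  have h1' := pow_le_pow_left₀ (nv_nonneg _) h1 2
  have h2' := pow_le_pow_left₀ (nv_nonneg _) h2 2
  rw [mul_pow] at h1' h2'
  linarith

lemma symMat_add (X Y : Matrix (Fin n₁) (Fin n₂) ℝ) : symMat (X + Y) = symMat X + symMat Y := by
  simp [symMat, Matrix.fromBlocks_add]

lemma symMat_neg (X : Matrix (Fin n₁) (Fin n₂) ℝ) : symMat (-X) = -symMat X := by
  simp [symMat, Matrix.fromBlocks_neg]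

lemma symMat_sub (X Y : Matrix (Fin n₁) (Fin n₂) ℝ) : symMat (X - Y) = symMat X - symMat Y := by
  rw [sub_eq_add_neg, symMat_add, symMat_neg, sub_eq_add_neg]

lemma symMat_transpose (X : Matrix (Fin n₁) (Fin n₂) ℝ) : (symMat X)ᵀ = symMat X := by
  simp [symMat, Matrix.fromBlocks_transpose]

lemma flip_symMat (X : Matrix (Fin n₁) (Fin n₂) ℝ) :
    flipSign n₁ n₂ * symMat X = -(symMat X * flipSign n₁ n₂) := by
  simp [symMat, flipSign, Matrix.fromBlocks_multiply, Matrix.fromBlocks_neg]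

lemma flip_transpose : (flipSign n₁ n₂)ᵀ = flipSign n₁ n₂ := by
  simp [flipSign, Matrix.fromBlocks_transpose]

lemma flip_mul_self : flipSign n₁ n₂ * flipSign n₁ n₂ = 1 := by
  simp [flipSign, Matrix.fromBlocks_multiply, Matrix.fromBlocks_one]

lemma flip_opn : ‖flipSign n₁ n₂‖ ≤ 1 := by
  apply orth_opn_le
  rw [flip_transpose, flip_mul_self]

lemma flip_mul_Z (Z : Matrix (Fin n₁ ⊕ Fin n₂) (Fin k) ℝ) :
    flipSign n₁ n₂ * Z = fromRows Z.toRows₁ (-Z.toRows₂) := by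
  conv_lhs => rw [← Matrix.fromRows_toRows Z, flipSign, Matrix.fromBlocks_mul_fromRows]
  simp

/-- `½(ZZᵀ - JZZᵀJ) = sym(Z₁Z₂ᵀ)`. -/
lemma sym_prod (Z : Matrix (Fin n₁ ⊕ Fin n₂) (Fin k) ℝ) :
    symMat (Z.toRows₁ * Z.toRows₂ᵀ) = (1/2 : ℝ) • (Z * Zᵀ)
      - (1/2 : ℝ) • (flipSign n₁ n₂ * Z * (flipSign n₁ n₂ * Z)ᵀ) := by
  rw [flip_mul_Z]
  nth_rewrite 3 4 [← Matrix.fromRows_toRows Z]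
  simp only [symMat, Matrix.transpose_fromRows, Matrix.fromRows_mul_fromCols, Matrix.fromBlocks_smul,
    Matrix.transpose_neg, Matrix.mul_neg, Matrix.neg_mul, neg_neg, smul_neg,
    sub_eq_add_neg, Matrix.fromBlocks_neg, Matrix.fromBlocks_add]
  congr 1
  · simp
  · rw [← add_smul]; norm_num
  · rw [Matrix.transpose_mul, Matrix.transpose_transpose, ← add_smul]; norm_num
  · simp

/-- bound on the RIP error term -/
lemma D_bound (A : Fin m → Matrix (Fin n₁) (Fin n₂) ℝ) {δ : ℝ} (hδ : 0 ≤ δ) (hr : 1 ≤ r)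
    (hA : HasRIP A (2 * r + 1) δ) (Z N : Matrix (Fin n₁ ⊕ Fin n₂) (Fin k) ℝ)
    (Γ : Matrix (Fin n₁ ⊕ Fin n₂) (Fin r) ℝ) (S : Matrix (Fin r) (Fin k) ℝ) (hZ : Z = Γ * S + N) :
    ‖Qop A (Z.toRows₁ * Z.toRows₂ᵀ)‖ ≤ δ * Real.sqrt r * (‖Γ‖ * ‖S‖) ^ 2
      + δ * k * ((‖Γ‖ * ‖S‖ + ‖Z‖) * ‖N‖) := by
  have z1 : Z.toRows₁ = Γ.toRows₁ * S + N.toRows₁ := by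
    rw [hZ]; ext i j; simp [Matrix.toRows₁, Matrix.mul_apply]
  have z2 : Z.toRows₂ = Γ.toRows₂ * S + N.toRows₂ := by
    rw [hZ]; ext i j; simp [Matrix.toRows₂, Matrix.mul_apply]
  have e : Z.toRows₁ * Z.toRows₂ᵀ = Γ.toRows₁ * (S * (Γ.toRows₂ * S)ᵀ)
      + Γ.toRows₁ * S * N.toRows₂ᵀ + N.toRows₁ * Z.toRows₂ᵀ := by
    have : Z.toRows₁ * Z.toRows₂ᵀ = Γ.toRows₁ * S * Z.toRows₂ᵀ + N.toRows₁ * Z.toRows₂ᵀ := by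
      rw [← Matrix.add_mul, ← z1]
    rw [this]
    congr 1
    rw [z2, Matrix.transpose_add, Matrix.mul_add, Matrix.mul_assoc]
  rw [e, Qop_add, Qop_add]
  have g1 := rows1_le Γ
  have g2 := rows2_le Γ
  have b1 := Qop_opn_low A hδ hA Γ.toRows₁ (S * (Γ.toRows₂ * S)ᵀ)
  have b2 := Qop_opn_prod A hδ (by omega : 1 ≤ 2 * r) hA (Γ.toRows₁ * S) N.toRows₂
  have b3 := Qop_opn_prod A hδ (by omega : 1 ≤ 2 * r) hA N.toRows₁ Z.toRows₂
  have c1 : ‖S * (Γ.toRows₂ * S)ᵀ‖ ≤ ‖S‖ * (‖Γ‖ * ‖S‖) := by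
    refine opn_mul_le le_rfl ?_
    rw [opn_transpose]
    exact opn_mul_le g2 le_rfl
  have c2 : ‖Γ.toRows₁ * S‖ ≤ ‖Γ‖ * ‖S‖ := opn_mul_le g1 le_rfl
  have n1 := rows1_le N
  have n2 := rows2_le N
  have d1 : δ * (Real.sqrt r * ‖Γ.toRows₁‖ * ‖S * (Γ.toRows₂ * S)ᵀ‖) ≤
      δ * Real.sqrt r * (‖Γ‖ * ‖S‖) ^ 2 := by
    have : δ * Real.sqrt r * (‖Γ‖ * ‖S‖) ^ 2 =
      δ * (Real.sqrt r * ‖Γ‖ * (‖S‖ * (‖Γ‖ * ‖S‖))) := by ring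
    rw [this]
    gcongr
  have d2 : δ * (k * (‖Γ.toRows₁ * S‖ * ‖N.toRows₂‖)) ≤ δ * (k * (‖Γ‖ * ‖S‖ * ‖N‖)) := by
    gcongr
  have d3 : δ * (k * (‖N.toRows₁‖ * ‖Z.toRows₂‖)) ≤ δ * (k * (‖N‖ * ‖Z‖)) := by
    have := rows2_le Z
    gcongr
  refine (norm_add_le _ _).trans ?_
  refine (add_le_add (norm_add_le _ _) le_rfl).trans ?_
  calc _ ≤ δ * Real.sqrt r * (‖Γ‖ * ‖S‖) ^ 2 + δ * (k * (‖Γ‖ * ‖S‖ * ‖N‖))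
        + δ * (k * (‖N‖ * ‖Z‖)) := by linarith
    _ = _ := by ring

end Rip

/-! ### The top eigenspace of the perturbed matrix -/
section Eig
open scoped Matrix.Norms.L2Operator

variable {n₁ n₂ m k r : ℕ}

lemma eig_select (X M0 : Matrix (Fin n₁) (Fin n₂) ℝ) (hX : X.rank = r) (σ d0 : ℝ)
    (hσ : ∀ x : Fin n₂ → ℝ, (∀ y, X *ᵥ y = 0 → x ⬝ᵥ y = 0) → σ * euclNorm x ≤ euclNorm (X *ᵥ x))
    (hd : ‖M0 - X‖ ≤ d0) (h2 : 2 * d0 < σ) :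
    ∃ (V : Matrix (Fin n₂) (Fin r) ℝ) (l : Fin r → ℝ), Vᵀ * V = 1 ∧ (∀ i, σ - d0 ≤ l i) ∧
      M0ᵀ * M0 * V = V * Matrix.diagonal (fun i => l i ^ 2) ∧
      ∀ q, Vᵀ *ᵥ q = 0 → euclNorm (M0 *ᵥ q) ≤ d0 * euclNorm q := by
  classical
  have hd0 : 0 ≤ d0 := (norm_nonneg _).trans hd
  have hH : (M0ᵀ * M0).IsHermitian := by
    have := Matrix.isHermitian_conjTranspose_mul_self M0
    simpa [Matrix.conjTranspose_eq_transpose_of_trivial] using this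
  set b := hH.eigenvectorBasis with hb
  set ev := hH.eigenvalues with hev
  -- coordinates
  let c : (Fin n₂ → ℝ) → Fin n₂ → ℝ := fun y j => (b j).ofLp ⬝ᵥ y
  have hcn : ∀ y, euclNorm y ^ 2 = ∑ j, c y j ^ 2 := by
    intro y
    have := b.sum_sq_norm_inner_right (WithLp.toLp 2 y)
    rw [nv_eq, ← this]
    refine Finset.sum_congr rfl fun j _ => ?_
    simp only [c]
    rw [EuclideanSpace.inner_eq_star_dotProduct]
    simp [dotProduct_comm]
  have hrec : ∀ y, y = ∑ j, c y j • (b j).ofLp := by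
    intro y
    have := b.sum_repr (WithLp.toLp 2 y)
    have h3 := congrArg (fun w : EuclideanSpace ℝ (Fin n₂) => w.ofLp) this
    simp only [WithLp.ofLp_sum, WithLp.ofLp_smul] at h3
    rw [← h3]
    refine Finset.sum_congr rfl fun j _ => ?_
    congr 1
    simp only [c]
    rw [b.repr_apply_apply, EuclideanSpace.inner_eq_star_dotProduct]
    simp only [star_trivial, h3]
    rw [dotProduct_comm]
  have hMn : ∀ y, euclNorm (M0 *ᵥ y) ^ 2 = ∑ j, ev j * c y j ^ 2 := by
    intro y
    rw [nv_sq, dot_mulVec_comm, Matrix.mulVec_mulVec]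
    conv_lhs => rw [dotProduct_comm]; arg 2; rw [hrec y]
    rw [Matrix.mulVec_sum, dotProduct_sum]
    refine Finset.sum_congr rfl fun j _ => ?_
    rw [Matrix.mulVec_smul, hH.mulVec_eigenvectorBasis, dotProduct_smul, dotProduct_smul,
      dotProduct_comm]
    simp only [c, smul_eq_mul, hev]
    rw [hb]; ring
  have hev0 : ∀ j, 0 ≤ ev j := by
    intro j
    have h3 := hMn (b j).ofLp
    have hc : ∀ i, c (b j).ofLp i = if i = j then 1 else 0 := by
      intro i
      have := (orthonormal_iff_ite.1 b.orthonormal) j i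
      simp only [c]
      rw [EuclideanSpace.inner_eq_star_dotProduct] at this
      simp only [star_trivial] at this
      rw [this]; simp [eq_comm]
    simp only [hc] at h3
    simp at h3
    rw [← h3]; positivity
  have hcb : ∀ i j, c (b j).ofLp i = if i = j then 1 else 0 := by
    intro i j
    have := (orthonormal_iff_ite.1 b.orthonormal) j i
    simp only [c]
    rw [EuclideanSpace.inner_eq_star_dotProduct] at this
    simp only [star_trivial] at this
    rw [this]; simp [eq_comm]
  -- kernel and its complement
  let φ := (WithLp.linearEquiv 2 ℝ (Fin n₂ → ℝ))
  let L : Submodule ℝ (EuclideanSpace ℝ (Fin n₂)) := (LinearMap.ker X.mulVecLin).comap φ.toLinearMap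
  have hLmem : ∀ y : EuclideanSpace ℝ (Fin n₂), y ∈ L ↔ X *ᵥ y.ofLp = 0 := by
    intro y; simp [L, φ]
  have hLdim : Module.finrank ℝ L + r = n₂ := by
    have h3 := LinearMap.finrank_range_add_finrank_ker X.mulVecLin
    have h4 : Module.finrank ℝ L = Module.finrank ℝ (LinearMap.ker X.mulVecLin) := by
      have e : L = (LinearMap.ker X.mulVecLin).map φ.symm.toLinearMap := by
        simp only [L]
        exact Submodule.comap_equiv_eq_map_symm φ _
      rw [e]
      exact LinearEquiv.finrank_map_eq _ _
    rw [← Matrix.rank, hX] at h3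
    simp at h3
    omega
  have hLo : Module.finrank ℝ Lᗮ = r := by
    have := Submodule.finrank_add_finrank_orthogonal L
    simp at this; omega
  have hKlow : ∀ y ∈ L, euclNorm (M0 *ᵥ y.ofLp) ≤ d0 * euclNorm y.ofLp := by
    intro y hy
    rw [hLmem] at hy
    have : M0 *ᵥ y.ofLp = (M0 - X) *ᵥ y.ofLp := by rw [Matrix.sub_mulVec, hy, sub_zero]
    rw [this]
    exact (nv_mulVec _ _).trans (mul_le_mul_of_nonneg_right hd (nv_nonneg _))
  have hKhigh : ∀ y ∈ Lᗮ, (σ - d0) * euclNorm y.ofLp ≤ euclNorm (M0 *ᵥ y.ofLp) := by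
    intro y hy
    have h3 : σ * euclNorm y.ofLp ≤ euclNorm (X *ᵥ y.ofLp) := by
      refine hσ _ fun z hz => ?_
      have := (Submodule.mem_orthogonal L y).1 hy (WithLp.toLp 2 z) ((hLmem _).2 hz)
      rw [EuclideanSpace.inner_eq_star_dotProduct] at this
      simpa using this
    have h4 : X *ᵥ y.ofLp = M0 *ᵥ y.ofLp - (M0 - X) *ᵥ y.ofLp := by
      rw [Matrix.sub_mulVec]; abel
    have h5 := nv_sub (M0 *ᵥ y.ofLp) ((M0 - X) *ᵥ y.ofLp)
    rw [← h4] at h5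
    have h6 := (nv_mulVec (M0 - X) y.ofLp).trans (mul_le_mul_of_nonneg_right hd (nv_nonneg _))
    linarith
  -- dimension counting
  have hspan : ∀ S : Finset (Fin n₂), ∀ y ∈ Submodule.span ℝ (b '' S), ∀ j ∉ S, c y.ofLp j = 0 := by
    intro S y hy j hj
    induction hy using Submodule.span_induction with
    | mem x hx =>
      obtain ⟨i, hi, rfl⟩ := hx
      rw [hcb, if_neg]
      rintro rfl; exact hj hi
    | zero => simp [c]
    | add x y _ _ hx hy =>
      simp only [c] at hx hy ⊢
      rw [WithLp.ofLp_add, dotProduct_add, hx, hy, add_zero]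
    | smul t x _ hx =>
      simp only [c] at hx ⊢
      rw [WithLp.ofLp_smul, dotProduct_smul, hx, smul_zero]
  have hdim : ∀ (S : Finset (Fin n₂)) (L' : Submodule ℝ (EuclideanSpace ℝ (Fin n₂))),
      (∀ y ∈ L', (∀ j ∉ S, c y.ofLp j = 0) → y.ofLp = 0) → S.card + Module.finrank ℝ L' ≤ n₂ := by
    intro S L' h
    have hS : Module.finrank ℝ (Submodule.span ℝ (b '' S)) = S.card := by
      have := finrank_span_eq_card (R := ℝ) (b := fun i : S => b i)
        (b.orthonormal.linearIndependent.comp _ Subtype.val_injective)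
      rw [← Fintype.card_coe S, ← this]
      have hset : b '' S = Set.range fun i : S => b i := by
        ext x; simp
      rw [hset]
    rw [← hS]
    have hdis : Disjoint (Submodule.span ℝ (b '' S)) L' := by
      rw [Submodule.disjoint_def]
      intro y hy hy'
      have := h y hy' (hspan S y hy)
      ext i; simp [this]
    have := Submodule.finrank_add_finrank_le_of_disjoint hdis
    simpa using this
  set S : Finset (Fin n₂) := Finset.univ.filter (fun j => d0 ^ 2 < ev j) with hS
  set S' : Finset (Fin n₂) := Finset.univ.filter (fun j => (σ - d0) ^ 2 ≤ ev j) with hS'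
  have hsub : S' ⊆ S := by
    intro j hj
    simp only [hS, hS', Finset.mem_filter, Finset.mem_univ, true_and] at hj ⊢
    nlinarith
  have hc1 : S.card + Module.finrank ℝ L ≤ n₂ := by
    refine hdim S L fun y hy hyS => ?_
    have h3 := pow_le_pow_left₀ (nv_nonneg _) (hKlow y hy) 2
    rw [mul_pow, hMn, hcn, Finset.mul_sum] at h3
    have hc0 : ∀ j, c y.ofLp j = 0 := by
      by_contra hne
      push Not at hne
      obtain ⟨j, hj⟩ := hne
      have hjS : j ∈ S := by by_contra h; exact hj (hyS j h)
      refine absurd h3 (not_le.2 (Finset.sum_lt_sum (fun i _ => ?_) ⟨j, Finset.mem_univ _, ?_⟩))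
      · by_cases hi : i ∈ S
        · simp only [hS, Finset.mem_filter, Finset.mem_univ, true_and] at hi
          exact mul_le_mul_of_nonneg_right hi.le (sq_nonneg _)
        · rw [hyS i hi]; simp
      · simp only [hS, Finset.mem_filter, Finset.mem_univ, true_and] at hjS
        exact mul_lt_mul_of_pos_right hjS (by positivity)
    rw [hrec y.ofLp]
    simp [hc0]
  have hc2 : S'ᶜ.card + Module.finrank ℝ Lᗮ ≤ n₂ := by
    refine hdim S'ᶜ Lᗮ fun y hy hyS => ?_
    have h3 := pow_le_pow_left₀ (mul_nonneg (by linarith) (nv_nonneg _)) (hKhigh y hy) 2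
    rw [mul_pow, hMn, hcn, Finset.mul_sum] at h3
    have hc0 : ∀ j, c y.ofLp j = 0 := by
      by_contra hne
      push Not at hne
      obtain ⟨j, hj⟩ := hne
      have hjS : j ∉ S' := by
        intro h; exact hj (hyS j (by simpa using h))
      refine absurd h3 (not_le.2 (Finset.sum_lt_sum (fun i _ => ?_) ⟨j, Finset.mem_univ _, ?_⟩))
      · by_cases hi : i ∈ S'
        · rw [hyS i (by simpa using hi)]; simp
        · simp only [hS', Finset.mem_filter, Finset.mem_univ, true_and, not_le] at hi
          exact mul_le_mul_of_nonneg_right hi.le (sq_nonneg _)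
      · simp only [hS', Finset.mem_filter, Finset.mem_univ, true_and, not_le] at hjS
        exact mul_lt_mul_of_pos_right hjS (by positivity)
    rw [hrec y.ofLp]
    simp [hc0]
  have hcc : S'ᶜ.card + S'.card = n₂ := by
    rw [add_comm, Finset.card_add_card_compl]; simp
  have hcardle := Finset.card_le_card hsub
  have hcard : S'.card = r := by omega
  have hSS : S' = S := Finset.eq_of_subset_of_card_le hsub (by omega)
  let e : Fin r ≃ S' := (finCongr hcard.symm).trans S'.equivFin.symm
  refine ⟨Matrix.of fun i j => (b (e j)).ofLp i, fun j => Real.sqrt (ev (e j)), ?_, ?_, ?_, ?_⟩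
  · ext i j
    have := hcb (e i) (e j)
    simp only [c] at this
    rw [Matrix.mul_apply, Matrix.one_apply]
    simp only [Matrix.transpose_apply, Matrix.of_apply]
    rw [dotProduct] at this
    rw [this]
    simp [Subtype.val_inj]
  · intro i
    have := (e i).2
    simp only [hS', Finset.mem_filter, Finset.mem_univ, true_and] at this
    exact Real.le_sqrt_of_sq_le this
  · ext i j
    have h3 := congrFun (hH.mulVec_eigenvectorBasis (e j)) i
    rw [Matrix.mul_diagonal]
    simp only [Matrix.of_apply]
    rw [Real.sq_sqrt (hev0 _), Matrix.mul_apply]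
    rw [Matrix.mulVec, dotProduct] at h3
    simp only [Matrix.of_apply]
    rw [h3]
    simp [mul_comm, hev, hb]
  · intro q hq
    refine abs_le_of_sq_le_sq' ?_ (mul_nonneg hd0 (nv_nonneg _)) |>.2
    rw [mul_pow, hMn, hcn, Finset.mul_sum]
    refine Finset.sum_le_sum fun j _ => ?_
    by_cases hj : j ∈ S'
    · have h3 := congrFun hq (e.symm ⟨j, hj⟩)
      rw [Matrix.mulVec, dotProduct] at h3
      simp only [Matrix.transpose_apply, Matrix.of_apply, Equiv.apply_symm_apply,
        Pi.zero_apply] at h3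
      have : c q j = 0 := h3
      rw [this]; simp
    · rw [hSS] at hj
      simp only [hS, Finset.mem_filter, Finset.mem_univ, true_and, not_lt] at hj
      exact mul_le_mul_of_nonneg_right hj (sq_nonneg _)

lemma eig_U (X M0 : Matrix (Fin n₁) (Fin n₂) ℝ) (hX : X.rank = r) (σ d0 : ℝ)
    (hσ : ∀ x : Fin n₂ → ℝ, (∀ y, X *ᵥ y = 0 → x ⬝ᵥ y = 0) → σ * euclNorm x ≤ euclNorm (X *ᵥ x))
    (hd : ‖M0 - X‖ ≤ d0) (h2 : 2 * d0 < σ) :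
    ∃ (U : Matrix (Fin n₁ ⊕ Fin n₂) (Fin r) ℝ) (l : Fin r → ℝ), Uᵀ * U = 1 ∧
      (∀ i, σ - d0 ≤ l i) ∧ (∀ i, l i ≤ ‖M0‖) ∧
      symMat M0 * U = U * Matrix.diagonal l ∧
      (∀ v, Uᵀ *ᵥ v = 0 → v ⬝ᵥ (symMat M0 *ᵥ v) ≤ d0 * euclNorm v ^ 2) ∧
      Uᵀ * (flipSign n₁ n₂ * U) = 0 := by
  obtain ⟨V, l, hV, hl, hMV, hq⟩ := eig_select X M0 hX σ d0 hσ hd h2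
  have hd0 : 0 ≤ d0 := (norm_nonneg _).trans hd
  have lpos : ∀ i, 0 < l i := fun i => by linarith [hl i]
  set P : Matrix (Fin n₁) (Fin r) ℝ := M0 * V * Matrix.diagonal (fun i => (l i)⁻¹) with hP
  have dd : Matrix.diagonal (fun i => (l i)⁻¹) * Matrix.diagonal l = (1 : Matrix (Fin r) (Fin r) ℝ) := by
    rw [Matrix.diagonal_mul_diagonal, ← Matrix.diagonal_one]
    congr 1; ext i; simp [inv_mul_cancel₀ (lpos i).ne']
  have d2 : Matrix.diagonal (fun i => l i ^ 2) * Matrix.diagonal (fun i => (l i)⁻¹) =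
      (Matrix.diagonal l : Matrix (Fin r) (Fin r) ℝ) := by
    rw [Matrix.diagonal_mul_diagonal]
    congr 1; ext i
    have := (lpos i).ne'
    field_simp
  have hMP : M0ᵀ * P = V * Matrix.diagonal l := by
    rw [hP, ← Matrix.mul_assoc, ← Matrix.mul_assoc, hMV, Matrix.mul_assoc, d2]
  have hMV' : M0 * V = P * Matrix.diagonal l := by
    rw [hP, Matrix.mul_assoc _ (Matrix.diagonal _) (Matrix.diagonal _), dd, Matrix.mul_one]
  have hPP : Pᵀ * P = 1 := by
    have : Pᵀ = Matrix.diagonal (fun i => (l i)⁻¹) * (Vᵀ * M0ᵀ) := by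
      rw [hP, Matrix.transpose_mul, Matrix.transpose_mul, Matrix.diagonal_transpose]
    rw [this, Matrix.mul_assoc, Matrix.mul_assoc, hMP, ← Matrix.mul_assoc Vᵀ, hV, Matrix.one_mul, dd]
  have hs : ((Real.sqrt 2)⁻¹ * (Real.sqrt 2)⁻¹ : ℝ) = 1 / 2 := by
    rw [← mul_inv, Real.mul_self_sqrt (by norm_num)]; norm_num
  set U : Matrix (Fin n₁ ⊕ Fin n₂) (Fin r) ℝ := (Real.sqrt 2)⁻¹ • fromRows P V with hU
  have hUt : Uᵀ = (Real.sqrt 2)⁻¹ • fromCols Pᵀ Vᵀ := by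
    rw [hU, Matrix.transpose_smul, Matrix.transpose_fromRows]
  refine ⟨U, l, ?_, hl, ?_, ?_, ?_, ?_⟩
  · rw [hUt, hU, Matrix.smul_mul, Matrix.mul_smul, Matrix.fromCols_mul_fromRows, hPP, hV, smul_smul,
      hs, ← two_smul ℝ (1 : Matrix (Fin r) (Fin r) ℝ), smul_smul]
    norm_num
  · intro i
    have h1 : ∀ (Q : Matrix (Fin n₁) (Fin r) ℝ), Qᵀ * Q = 1 → euclNorm (Q *ᵥ Pi.single i 1) = 1 := by
      intro Q hQ
      have : euclNorm (Q *ᵥ Pi.single i 1) ^ 2 = 1 := by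
        rw [nv_sq, dot_mulVec_comm, Matrix.mulVec_mulVec, hQ]; simp
      nlinarith [nv_nonneg (Q *ᵥ Pi.single i 1)]
    have h3 : euclNorm (V *ᵥ Pi.single i (1:ℝ)) = 1 := by
      have : euclNorm (V *ᵥ Pi.single i (1:ℝ)) ^ 2 = 1 := by
        rw [nv_sq, dot_mulVec_comm, Matrix.mulVec_mulVec, hV]; simp
      nlinarith [nv_nonneg (V *ᵥ Pi.single i (1:ℝ))]
    have h4 := nv_mulVec M0 (V *ᵥ Pi.single i 1)
    rw [h3, mul_one, Matrix.mulVec_mulVec, hMV', ← Matrix.mulVec_mulVec] at h4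
    have h5 : Matrix.diagonal l *ᵥ Pi.single i 1 = l i • Pi.single i (1:ℝ) := by
      ext j
      rw [Matrix.mulVec_diagonal]
      by_cases h : j = i
      · subst h; simp
      · simp [h]
    rw [h5, Matrix.mulVec_smul, nv_smul, h1 P hPP, abs_of_pos (lpos i), mul_one] at h4
    exact h4
  · rw [hU, symMat, Matrix.mul_smul, Matrix.smul_mul, Matrix.fromBlocks_mul_fromRows,
      Matrix.fromRows_mul]
    simp [hMP, hMV']
  · intro v hv
    set p := v ∘ Sum.inl with hp
    set q := v ∘ Sum.inr with hq'
    have hv' : Pᵀ *ᵥ p + Vᵀ *ᵥ q = 0 := by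
      rw [hUt, Matrix.smul_mulVec] at hv
      have h3 : fromCols Pᵀ Vᵀ *ᵥ v = 0 := by
        have hne : (Real.sqrt 2)⁻¹ ≠ 0 := by positivity
        exact (smul_eq_zero.1 hv).resolve_left hne
      rwa [Matrix.fromCols_mulVec] at h3
    have e1 : v ⬝ᵥ (symMat M0 *ᵥ v) = 2 * (p ⬝ᵥ (M0 *ᵥ q)) := by
      rw [symMat, Matrix.fromBlocks_mulVec]
      simp only [Matrix.zero_mulVec, zero_add, add_zero]
      rw [dotProduct, Fintype.sum_sum_type]
      simp only [Sum.elim_inl, Sum.elim_inr]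
      have h3 : ∑ x, v (Sum.inl x) * (M0 *ᵥ v ∘ Sum.inr) x = p ⬝ᵥ (M0 *ᵥ q) := rfl
      have h4 : ∑ x, v (Sum.inr x) * (M0ᵀ *ᵥ v ∘ Sum.inl) x = q ⬝ᵥ (M0ᵀ *ᵥ p) := rfl
      rw [h3, h4, dot_mulVec_comm M0ᵀ, Matrix.transpose_transpose, dotProduct_comm (M0 *ᵥ q)]
      ring
    set aa := Pᵀ *ᵥ p with ha
    set bb := Vᵀ *ᵥ q with hb
    set p' := p - P *ᵥ aa with hp'
    set q' := q - V *ᵥ bb with hq''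
    have hbb : bb = -aa := (eq_neg_of_add_eq_zero_right hv')
    have hp0 : Pᵀ *ᵥ p' = 0 := by
      rw [hp', Matrix.mulVec_sub, Matrix.mulVec_mulVec, hPP, Matrix.one_mulVec, ha, sub_self]
    have hq0 : Vᵀ *ᵥ q' = 0 := by
      rw [hq'', Matrix.mulVec_sub, Matrix.mulVec_mulVec, hV, Matrix.one_mulVec, hb, sub_self]
    have hpn : euclNorm p' ^ 2 ≤ euclNorm p ^ 2 := by
      have : euclNorm p ^ 2 = euclNorm p' ^ 2 + euclNorm (P *ᵥ aa) ^ 2 := by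
        have e : p = p' + P *ᵥ aa := by rw [hp']; abel
        conv_lhs => rw [e]
        rw [nv_sq, nv_sq, nv_sq, add_dotProduct, dotProduct_add, dotProduct_add,
          dot_mulVec_comm P p' aa, hp0, dotProduct_comm (P *ᵥ aa) p', dot_mulVec_comm P p' aa, hp0]
        simp
      nlinarith [sq_nonneg (euclNorm (P *ᵥ aa))]
    have hqn : euclNorm q' ^ 2 ≤ euclNorm q ^ 2 := by
      have : euclNorm q ^ 2 = euclNorm q' ^ 2 + euclNorm (V *ᵥ bb) ^ 2 := by
        have e : q = q' + V *ᵥ bb := by rw [hq'']; abel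
        conv_lhs => rw [e]
        rw [nv_sq, nv_sq, nv_sq, add_dotProduct, dotProduct_add, dotProduct_add,
          dot_mulVec_comm V q' bb, hq0, dotProduct_comm (V *ᵥ bb) q', dot_mulVec_comm V q' bb, hq0]
        simp
      nlinarith [sq_nonneg (euclNorm (V *ᵥ bb))]
    have e2 : p ⬝ᵥ (M0 *ᵥ q) = p' ⬝ᵥ (M0 *ᵥ q') + aa ⬝ᵥ (Matrix.diagonal l *ᵥ bb) := by
      have eq : q = q' + V *ᵥ bb := by rw [hq'']; abel
      have ep : p = p' + P *ᵥ aa := by rw [hp']; abel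
      have h3 : M0 *ᵥ (V *ᵥ bb) = P *ᵥ (Matrix.diagonal l *ᵥ bb) := by
        rw [Matrix.mulVec_mulVec, hMV', ← Matrix.mulVec_mulVec]
      have h4 : (P *ᵥ aa) ⬝ᵥ (M0 *ᵥ q') = 0 := by
        rw [dot_mulVec_comm, Matrix.mulVec_mulVec, hMP, ← Matrix.mulVec_mulVec, dotProduct_comm,
          dot_mulVec_comm, hq0, zero_dotProduct]
      have h5 : p ⬝ᵥ (P *ᵥ (Matrix.diagonal l *ᵥ bb)) = aa ⬝ᵥ (Matrix.diagonal l *ᵥ bb) := by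
        rw [dot_mulVec_comm]
      conv_lhs => rw [eq, Matrix.mulVec_add, dotProduct_add, h3, h5, ep, add_dotProduct, h4, add_zero]
    have e3 : aa ⬝ᵥ (Matrix.diagonal l *ᵥ bb) ≤ 0 := by
      rw [hbb, Matrix.mulVec_neg, dotProduct_neg, neg_nonpos]
      simp only [dotProduct, Matrix.mulVec_diagonal]
      refine Finset.sum_nonneg fun i _ => ?_
      nlinarith [lpos i, mul_self_nonneg (aa i), mul_nonneg (lpos i).le (mul_self_nonneg (aa i))]
    have e4 : p' ⬝ᵥ (M0 *ᵥ q') ≤ euclNorm p' * (d0 * euclNorm q') :=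
      (dot_le _ _).trans (mul_le_mul_of_nonneg_left (hq q' hq0) (nv_nonneg _))
    have e5 : euclNorm v ^ 2 = euclNorm p ^ 2 + euclNorm q ^ 2 := nv_sum_sq v
    rw [e1, e2, e5]
    have e6 : 2 * (euclNorm p' * euclNorm q') ≤ euclNorm p ^ 2 + euclNorm q ^ 2 := by
      nlinarith [sq_nonneg (euclNorm p' - euclNorm q')]
    nlinarith
  · rw [hU, Matrix.mul_smul, flipSign, Matrix.fromBlocks_mul_fromRows, ← hU, hUt, Matrix.smul_mul,
      Matrix.mul_smul, Matrix.fromCols_mul_fromRows]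
    simp [hPP, hV]

end Eig

/-! ### The abstract dynamics -/
section Dynamics
open scoped Matrix.Norms.L2Operator

/-- abstract symmetrized gradient descent together with the reference eigenspace -/
structure Dyn (ι : Type) [Fintype ι] [DecidableEq ι] (k r : ℕ) where
  μ : ℝ
  σ : ℝ
  ρ : ℝ
  J : Matrix ι ι ℝ
  H : Matrix ι ι ℝ
  U : Matrix ι (Fin r) ℝ
  l : Fin r → ℝ
  Z : ℕ → Matrix ι (Fin k) ℝ
  M : ℕ → Matrix ι ι ℝ
  D : ℕ → Matrix ι ι ℝ
  hμ : 0 < μ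
  hσ : 0 < σ
  hσ1 : σ ≤ 1
  hμσ : μ ≤ 1 / 10 ^ 20 * σ ^ 5
  hρ0 : 0 ≤ ρ
  hρ : ρ ≤ 1 / 10 ^ 10 * σ ^ 3
  hJJ : J * J = 1
  hJt : Jᵀ = J
  hM : ∀ t, M t = H + D t - (1/2 : ℝ) • (Z t * (Z t)ᵀ) + (1/2 : ℝ) • (J * Z t * (J * Z t)ᵀ)
  hMt : ∀ t, (M t)ᵀ = M t
  hJM : ∀ t, J * M t = -(M t * J)
  hZ : ∀ t, Z (t + 1) = Z t + μ • (M t * Z t)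
  hHt : Hᵀ = H
  hHn : ‖H‖ ≤ 101 / 100
  hU : Uᵀ * U = 1
  hHU : H * U = U * Matrix.diagonal l
  hl : ∀ i, σ - ρ ≤ l i
  hl1 : ∀ i, l i ≤ 101 / 100
  hQ : ∀ v, Uᵀ *ᵥ v = 0 → v ⬝ᵥ (H *ᵥ v) ≤ ρ * euclNorm v ^ 2
  hD : ∀ t (Γ : Matrix ι (Fin r) ℝ) (S : Matrix (Fin r) (Fin k) ℝ) (N : Matrix ι (Fin k) ℝ),
    Z t = Γ * S + N → ‖D t‖ ≤ ρ * (‖Γ‖ * ‖S‖) ^ 2 + ρ * k * ((‖Γ‖ * ‖S‖ + ‖Z t‖) * ‖N‖)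

namespace Dyn
variable {ι : Type} [Fintype ι] [DecidableEq ι] {k r : ℕ} (s : Dyn ι k r)

/-- projection onto the orthogonal complement of the reference eigenspace -/
def Pc : Matrix ι ι ℝ := 1 - s.U * s.Uᵀ

/-- graph matrices -/
def K : ℕ → Matrix ι (Fin r) ℝ
  | 0 => 0
  | t + 1 => (K t + s.μ • (s.Pc * (s.M t * (s.U + K t)))) *
      (1 + s.μ • (s.Uᵀ * (s.M t * (s.U + K t))))⁻¹

def Γ (t : ℕ) : Matrix ι (Fin r) ℝ := s.U + s.K t
def P (t : ℕ) : Matrix (Fin r) (Fin r) ℝ := s.Uᵀ * (s.M t * s.Γ t)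
def Θ (t : ℕ) : Matrix (Fin r) (Fin r) ℝ := 1 + s.μ • s.P t
def A (t : ℕ) : Matrix (Fin r) (Fin k) ℝ := s.Uᵀ * s.Z t
def N (t : ℕ) : Matrix ι (Fin k) ℝ := s.Z t - s.Γ t * s.A t
def F (t : ℕ) : Matrix (Fin k) (Fin r) ℝ := (s.Z t)ᵀ * (s.J * s.Γ t)
def W (t : ℕ) : Matrix (Fin k) (Fin k) ℝ := (s.Z t)ᵀ * (s.J * s.N t)
def B (t : ℕ) : Matrix (Fin k) (Fin k) ℝ := (s.Z t)ᵀ * (s.J * s.Z t)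
def Y : ℕ → Matrix (Fin r) (Fin r) ℝ
  | 0 => 1
  | t + 1 => Y t * (s.Θ t)⁻¹
def Φ : ℕ → Matrix (Fin r) (Fin r) ℝ
  | 0 => 1
  | t + 1 => s.Θ t * Φ t
def Ξ (t : ℕ) : Matrix (Fin r) (Fin k) ℝ := s.Y t * s.A t - s.A 0
def L : Matrix (Fin r) (Fin r) ℝ := Matrix.diagonal s.l

lemma Zsplit (t : ℕ) : s.Z t = s.Γ t * s.A t + s.N t := by rw [N]; abel

lemma K_succ (t : ℕ) : s.K (t + 1) = (s.K t + s.μ • (s.Pc * (s.M t * s.Γ t))) * (s.Θ t)⁻¹ := rfl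

lemma UtPi : s.Uᵀ * s.Pc = 0 := by
  rw [Pc, Matrix.mul_sub, ← Matrix.mul_assoc, s.hU, Matrix.mul_one, Matrix.one_mul, sub_self]

lemma PiU : s.Pc * s.U = 0 := by
  rw [Pc, Matrix.sub_mul, Matrix.mul_assoc, s.hU, Matrix.mul_one, Matrix.one_mul, sub_self]

lemma UtK (t : ℕ) : s.Uᵀ * s.K t = 0 := by
  induction t with
  | zero => simp [K]
  | succ t ih =>
    rw [K_succ, ← Matrix.mul_assoc, Matrix.mul_add, ih, Matrix.mul_smul, ← Matrix.mul_assoc, UtPi]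
    simp

lemma UtΓ (t : ℕ) : s.Uᵀ * s.Γ t = 1 := by
  rw [Γ, Matrix.mul_add, s.hU, UtK, add_zero]

lemma UtN (t : ℕ) : s.Uᵀ * s.N t = 0 := by
  rw [N, Matrix.mul_sub, ← Matrix.mul_assoc, UtΓ, Matrix.one_mul, A, sub_self]

lemma PiK (t : ℕ) : s.Pc * s.K t = s.K t := by
  rw [Pc, Matrix.sub_mul, Matrix.mul_assoc, UtK]; simp

lemma PiN (t : ℕ) : s.Pc * s.N t = s.N t := by
  rw [Pc, Matrix.sub_mul, Matrix.mul_assoc, UtN]; simp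

lemma UtH : s.Uᵀ * s.H = s.L * s.Uᵀ := by
  have := congrArg Matrix.transpose s.hHU
  rwa [Matrix.transpose_mul, Matrix.transpose_mul, s.hHt, Matrix.diagonal_transpose] at this

lemma A_succ (t : ℕ) :
    s.A (t + 1) = s.Θ t * s.A t + s.μ • (s.Uᵀ * (s.M t * s.N t)) := by
  have h : s.M t * s.Z t = s.M t * s.Γ t * s.A t + s.M t * s.N t := by
    conv_lhs => rw [s.Zsplit t, Matrix.mul_add, ← Matrix.mul_assoc]
  rw [A, s.hZ, Matrix.mul_add, Matrix.mul_smul, h, Matrix.mul_add, Θ, Matrix.add_mul,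
    Matrix.one_mul, P, Matrix.smul_mul, smul_add, A, ← add_assoc]
  simp only [Matrix.mul_assoc]

lemma Gam_succ (t : ℕ) (h : (s.Θ t)⁻¹ * s.Θ t = 1) :
    s.Γ (t + 1) * s.Θ t = s.Γ t + s.μ • (s.M t * s.Γ t) := by
  rw [Γ, Matrix.add_mul, K_succ, Matrix.mul_assoc, h, Matrix.mul_one, Θ, P, Pc]
  simp only [Matrix.mul_add, Matrix.mul_one, Matrix.mul_smul, Matrix.sub_mul, Matrix.one_mul,
    Matrix.mul_assoc]
  rw [Γ]
  module

lemma N_succ (t : ℕ) (h : (s.Θ t)⁻¹ * s.Θ t = 1) :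
    s.N (t + 1) = s.N t + s.μ • (s.M t * s.N t)
      - s.μ • (s.Γ (t + 1) * (s.Uᵀ * (s.M t * s.N t))) := by
  have h1 : s.M t * s.Z t = s.M t * s.Γ t * s.A t + s.M t * s.N t := by
    conv_lhs => rw [s.Zsplit t, Matrix.mul_add, ← Matrix.mul_assoc]
  rw [N, A_succ, Matrix.mul_add, ← Matrix.mul_assoc, Gam_succ _ _ h, s.hZ, h1, Matrix.add_mul,
    Matrix.smul_mul, Matrix.mul_smul]
  conv_lhs => rw [s.Zsplit t]
  module

lemma F_succ (t : ℕ) (h : (s.Θ t)⁻¹ * s.Θ t = 1) :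
    s.F (t + 1) * s.Θ t = s.F t - s.μ ^ 2 • ((s.Z t)ᵀ * (s.J * (s.M t * (s.M t * s.Γ t)))) := by
  rw [F, Matrix.mul_assoc, Matrix.mul_assoc, Gam_succ _ _ h, s.hZ, F]
  have e : ∀ Q : Matrix ι (Fin r) ℝ, (s.Z t)ᵀ * (s.M t * (s.J * Q)) = -((s.Z t)ᵀ * (s.J * (s.M t * Q))) := by
    intro Q
    rw [← Matrix.mul_assoc (s.M t), ← Matrix.mul_assoc s.J, s.hJM, Matrix.neg_mul, Matrix.mul_neg,
      neg_neg]
  simp only [Matrix.transpose_add, Matrix.transpose_smul, Matrix.transpose_mul, s.hMt,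
    Matrix.mul_add, Matrix.add_mul, Matrix.mul_smul, Matrix.smul_mul, Matrix.mul_assoc, e]
  module

lemma W_succ (t : ℕ) (h : (s.Θ t)⁻¹ * s.Θ t = 1) :
    s.W (t + 1) = s.W t - s.μ ^ 2 • ((s.Z t)ᵀ * (s.J * (s.M t * (s.M t * s.N t))))
      - s.μ • (s.F (t + 1) * (s.Uᵀ * (s.M t * s.N t))) := by
  have e : ∀ Q : Matrix ι (Fin k) ℝ, (s.Z t)ᵀ * (s.M t * (s.J * Q)) = -((s.Z t)ᵀ * (s.J * (s.M t * Q))) := by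
    intro Q
    rw [← Matrix.mul_assoc (s.M t), ← Matrix.mul_assoc s.J, s.hJM, Matrix.neg_mul, Matrix.mul_neg,
      neg_neg]
  rw [W, N_succ _ _ h, Matrix.mul_sub, Matrix.mul_sub]
  have e2 : (s.Z (t + 1))ᵀ * (s.J * s.μ • (s.Γ (t + 1) * (s.Uᵀ * (s.M t * s.N t)))) =
      s.μ • (s.F (t + 1) * (s.Uᵀ * (s.M t * s.N t))) := by
    rw [F]
    simp only [Matrix.mul_smul, Matrix.mul_assoc]
  rw [e2, s.hZ, W]
  simp only [Matrix.transpose_add, Matrix.transpose_smul, Matrix.transpose_mul, s.hMt,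
    Matrix.mul_add, Matrix.add_mul, Matrix.mul_smul, Matrix.smul_mul, Matrix.mul_assoc, e]
  module

lemma B_succ (t : ℕ) :
    s.B (t + 1) = s.B t - s.μ ^ 2 • ((s.Z t)ᵀ * (s.J * (s.M t * (s.M t * s.Z t)))) := by
  have e : ∀ Q : Matrix ι (Fin k) ℝ, (s.Z t)ᵀ * (s.M t * (s.J * Q)) = -((s.Z t)ᵀ * (s.J * (s.M t * Q))) := by
    intro Q
    rw [← Matrix.mul_assoc (s.M t), ← Matrix.mul_assoc s.J, s.hJM, Matrix.neg_mul, Matrix.mul_neg,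
      neg_neg]
  rw [B, s.hZ, B]
  simp only [Matrix.transpose_add, Matrix.transpose_smul, Matrix.transpose_mul, s.hMt,
    Matrix.mul_add, Matrix.add_mul, Matrix.mul_smul, Matrix.smul_mul, Matrix.mul_assoc, e]
  module

lemma YPhi_succ (t : ℕ) (h : (s.Θ t)⁻¹ * s.Θ t = 1) (hY : s.Y t * s.Φ t = 1) :
    s.Y (t + 1) * s.Φ (t + 1) = 1 := by
  rw [Y, Φ, Matrix.mul_assoc, ← Matrix.mul_assoc _ (s.Θ t), h, Matrix.one_mul, hY]

lemma Xi_succ (t : ℕ) (h : (s.Θ t)⁻¹ * s.Θ t = 1) :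
    s.Ξ (t + 1) = s.Ξ t + s.μ • (s.Y (t + 1) * (s.Uᵀ * (s.M t * s.N t))) := by
  rw [Ξ, A_succ, Matrix.mul_add, Matrix.mul_smul, Ξ]
  have : s.Y (t + 1) * (s.Θ t * s.A t) = s.Y t * s.A t := by
    rw [Y, ← Matrix.mul_assoc, Matrix.mul_assoc _ _ (s.Θ t), h, Matrix.mul_one]
  rw [this]; abel

/-- expansion of `M * Q` -/
lemma M_mul {c : Type*} [Fintype c] [DecidableEq c] (t : ℕ) (Q : Matrix ι c ℝ) :
    s.M t * Q = s.H * Q + s.D t * Q - (1/2 : ℝ) • (s.Z t * ((s.Z t)ᵀ * Q))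
      + (1/2 : ℝ) • (s.J * (s.Z t * ((s.Z t)ᵀ * (s.J * Q)))) := by
  conv_lhs => rw [s.hM]
  simp only [Matrix.add_mul, Matrix.sub_mul, Matrix.smul_mul, Matrix.transpose_mul, s.hJt,
    Matrix.mul_assoc]

def G (t : ℕ) : Matrix (Fin k) (Fin r) ℝ := (s.Z t)ᵀ * s.Γ t
def R2 (t : ℕ) : Matrix (Fin r) (Fin r) ℝ :=
  s.Uᵀ * (s.D t * s.Γ t) + (1/2 : ℝ) • (s.Uᵀ * (s.J * (s.Z t * s.F t)))
def R1 (t : ℕ) : Matrix ι (Fin r) ℝ :=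
  s.Pc * (s.D t * s.Γ t) - (1/2 : ℝ) • (s.N t * s.G t) + (1/2 : ℝ) • (s.Pc * (s.J * (s.Z t * s.F t)))

lemma P_eq (t : ℕ) : s.P t = s.L + s.R2 t - (1/2 : ℝ) • (s.A t * s.G t) := by
  have e : s.Uᵀ * (s.H * s.Γ t) = s.L := by
    rw [← Matrix.mul_assoc, UtH, Matrix.mul_assoc, UtΓ, Matrix.mul_one]
  rw [P, M_mul, R2]
  simp only [Matrix.mul_add, Matrix.mul_sub, Matrix.mul_smul, e]
  rw [A, G, F]
  simp only [Matrix.mul_assoc]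
  module

lemma PiM_eq (t : ℕ) : s.Pc * (s.M t * s.Γ t) =
    s.Pc * (s.H * s.K t) - (1/2 : ℝ) • (s.K t * (s.A t * s.G t)) + s.R1 t := by
  have e : s.Pc * (s.H * s.Γ t) = s.Pc * (s.H * s.K t) := by
    rw [Γ, Matrix.mul_add, Matrix.mul_add, s.hHU, ← Matrix.mul_assoc s.Pc s.U, PiU]; simp
  have e2 : s.Pc * s.Z t = s.K t * s.A t + s.N t := by
    conv_lhs => rw [s.Zsplit t, Matrix.mul_add, PiN, Γ, ← Matrix.mul_assoc, Matrix.mul_add, PiU, PiK,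
      zero_add]
  rw [M_mul, R1]
  simp only [Matrix.mul_add, Matrix.mul_sub, Matrix.mul_smul, e]
  have e3 : s.Pc * (s.Z t * ((s.Z t)ᵀ * s.Γ t)) = s.K t * (s.A t * s.G t) + s.N t * s.G t := by
    rw [← Matrix.mul_assoc, e2, Matrix.add_mul, ← G, Matrix.mul_assoc]
  rw [e3, ← F]
  module

lemma K_step (t : ℕ) (h : (s.Θ t)⁻¹ * s.Θ t = 1) (h' : s.Θ t * (s.Θ t)⁻¹ = 1) :
    s.K (t + 1) = s.K t + s.μ • ((s.Pc * (s.H * s.K t) - s.K t * s.L) * (s.Θ t)⁻¹)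
      + s.μ • ((s.R1 t - s.K t * s.R2 t) * (s.Θ t)⁻¹) := by
  have e : s.K t + s.μ • (s.Pc * (s.M t * s.Γ t)) = s.K t * s.Θ t +
      s.μ • (s.Pc * (s.H * s.K t) - s.K t * s.L) + s.μ • (s.R1 t - s.K t * s.R2 t) := by
    rw [PiM_eq, Θ, P_eq]
    simp only [Matrix.mul_add, Matrix.mul_sub, Matrix.mul_smul, Matrix.mul_one]
    module
  rw [K_succ, e, Matrix.add_mul, Matrix.add_mul, Matrix.mul_assoc, h', Matrix.mul_one,
    Matrix.smul_mul, Matrix.smul_mul]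

end Dyn
end Dynamics

section Invariants
lemma le_of_sq2 {a b : ℝ} (h : a ^ 2 ≤ b ^ 2) (hb : 0 ≤ b) : a ≤ b :=
  (le_abs_self a).trans (abs_le_of_sq_le_sq h hb)

open scoped Matrix.Norms.L2Operator
namespace Dyn
variable {ι : Type} [Fintype ι] [DecidableEq ι] {k r : ℕ} (s : Dyn ι k r)

/-- growth envelope of the noise part -/
def nh (z0 : ℝ) (t : ℕ) : ℝ := z0 * Real.exp (1 / 10 ^ 7 * s.σ * s.μ * t)

/-- envelope of the perturbation of the signal part -/
def xi (z0 : ℝ) (t : ℕ) : ℝ :=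
  ((5 * z0 ^ (1 + s.σ / 5) + 6 * k * z0 ^ 2) / (4 / 10 * s.σ)) *
      (1 - Real.exp (-(1 / 2 * s.σ * s.μ * t)))
    + (10 / s.σ * z0 / (1 / 10 ^ 7 * s.σ)) * (s.nh z0 t - z0)

/-- standing assumptions up to the horizon `T` -/
structure Hyp (z0 s0 : ℝ) (T : ℕ) : Prop where
  hk : 1 ≤ k
  hz0 : 0 < z0
  hs0 : 0 < s0
  hZ0 : ‖s.Z 0‖ ≤ z0
  hA0 : ∀ x, s0 * euclNorm x ≤ euclNorm ((s.A 0)ᵀ *ᵥ x)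
  hz : z0 ≤ 1 / 10 ^ 20 * s.σ ^ 4
  hT : s.μ ^ 2 * T ≤ 1 / 10 ^ 21 * s.σ ^ 4
  hn : k * s.nh z0 T ≤ 1 / 10 ^ 10 * s.σ ^ 3
  hxi : s.xi z0 T ≤ s0 / 2

structure Inv (z0 s0 : ℝ) (t : ℕ) : Prop where
  hZ2 : ‖s.Z t‖ ≤ 2
  hZe : ‖s.Z t‖ ≤ z0 * Real.exp (13 / 10 * s.μ * t)
  hB : ‖s.B t‖ ≤ z0 ^ 2 + 144 * s.μ ^ 2 * t
  hK : ‖s.K t‖ ≤ 1 / 10 ^ 8 * s.σ ^ 2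
  hN : ‖s.N t‖ ≤ s.nh z0 t
  hW : ‖s.W t‖ ≤ z0 ^ 2 + 1 / 10 ^ 9 * s.σ ^ 2 * (s.nh z0 t - z0)
  hF : ‖s.F t‖ ≤ 1 / 10 ^ 17 * s.σ ^ 3
  hΞ : ‖s.Ξ t‖ ≤ s.xi z0 t
  hYΦ : s.Y t * s.Φ t = 1
  hg1 : ∀ x, euclNorm ((s.Y t)ᵀ *ᵥ x) ^ 2 ≤ ((1 + 19 / 10 * s.μ * s.σ) ^ t)⁻¹ * euclNorm x ^ 2
    + 3 / s.σ * euclNorm ((s.A 0)ᵀ *ᵥ x) ^ 2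
  hg2 : ∀ t' ≤ t, ∀ x, euclNorm ((s.Y t)ᵀ *ᵥ x) ^ 2 ≤ euclNorm ((s.Y t')ᵀ *ᵥ x) ^ 2
    + 3 / s.σ * euclNorm ((s.A 0)ᵀ *ᵥ x) ^ 2

variable {s} {z0 s0 : ℝ} {T t : ℕ}

lemma nh_mono (hz0 : 0 < z0) {a b : ℕ} (h : a ≤ b) : s.nh z0 a ≤ s.nh z0 b := by
  have := s.hμ; have := s.hσ
  unfold nh
  have : (a : ℝ) ≤ b := by exact_mod_cast h
  gcongr

lemma nh_pos (hz0 : 0 < z0) (a : ℕ) : 0 < s.nh z0 a := by unfold nh; positivity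

lemma nh_zero : s.nh z0 0 = z0 := by simp [nh]

lemma nh_succ (hz0 : 0 < z0) (t : ℕ) :
    s.nh z0 t * (1 + 1 / 10 ^ 7 * s.σ * s.μ) ≤ s.nh z0 (t + 1) := by
  have h := Real.add_one_le_exp (1 / 10 ^ 7 * s.σ * s.μ)
  have e : s.nh z0 (t + 1) = s.nh z0 t * Real.exp (1 / 10 ^ 7 * s.σ * s.μ) := by
    unfold nh; rw [mul_assoc z0, ← Real.exp_add]; congr 2; push_cast; ring
  rw [e]
  have := nh_pos (s := s) hz0 t
  gcongr; linarith

lemma xi_mono (hz0 : 0 < z0) {a b : ℕ} (h : a ≤ b) : s.xi z0 a ≤ s.xi z0 b := by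
  have h1 := s.hμ; have h2 := s.hσ
  have h3 := nh_mono (s := s) hz0 h
  have : (a : ℝ) ≤ b := by exact_mod_cast h
  unfold xi
  gcongr

lemma smul_pow : s.σ ^ 2 ≤ s.σ ∧ s.σ ^ 3 ≤ s.σ ^ 2 ∧ s.σ ^ 4 ≤ s.σ ^ 3 ∧ s.σ ^ 5 ≤ s.σ ^ 4 := by
  have h1 := s.hσ; have h2 := s.hσ1
  refine ⟨?_, ?_, ?_, ?_⟩
  · nlinarith
  · have : 0 ≤ s.σ ^ 2 := by positivity
    nlinarith
  · have : 0 ≤ s.σ ^ 3 := by positivity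
    nlinarith
  · have : 0 ≤ s.σ ^ 4 := by positivity
    nlinarith

lemma U_opn : ‖s.U‖ ≤ 1 := orth_opn_le _ s.hU
lemma Ut_opn : ‖s.Uᵀ‖ ≤ 1 := by rw [opn_transpose]; exact U_opn
lemma J_opn : ‖s.J‖ ≤ 1 := orth_opn_le _ (by rw [s.hJt, s.hJJ])
lemma Pc_opn : ‖s.Pc‖ ≤ 1 := by
  refine opn_le _ zero_le_one fun v => ?_
  have h : euclNorm (s.Pc *ᵥ v) ^ 2 + euclNorm (s.Uᵀ *ᵥ v) ^ 2 = euclNorm v ^ 2 := by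
    rw [nv_sq, nv_sq, nv_sq]
    have e : (s.U *ᵥ (s.Uᵀ *ᵥ v)) ⬝ᵥ (s.U *ᵥ (s.Uᵀ *ᵥ v)) = (s.Uᵀ *ᵥ v) ⬝ᵥ (s.Uᵀ *ᵥ v) := by
      rw [dot_mulVec_comm, Matrix.mulVec_mulVec, s.hU, Matrix.one_mulVec]
    have e2 : v ⬝ᵥ (s.U *ᵥ (s.Uᵀ *ᵥ v)) = (s.Uᵀ *ᵥ v) ⬝ᵥ (s.Uᵀ *ᵥ v) := by
      rw [dot_mulVec_comm]
    have e3 : (s.U *ᵥ (s.Uᵀ *ᵥ v)) ⬝ᵥ v = (s.Uᵀ *ᵥ v) ⬝ᵥ (s.Uᵀ *ᵥ v) := by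
      rw [dotProduct_comm, e2]
    rw [Pc, Matrix.sub_mulVec, Matrix.one_mulVec, ← Matrix.mulVec_mulVec, sub_dotProduct,
      dotProduct_sub, dotProduct_sub, e, e2, e3]
    ring
  have := sq_nonneg (euclNorm (s.Uᵀ *ᵥ v))
  rw [one_mul]
  exact le_of_sq2 (by linarith) (nv_nonneg _)

lemma Pct : s.Pcᵀ = s.Pc := by
  rw [Pc, Matrix.transpose_sub, Matrix.transpose_mul, Matrix.transpose_transpose,
    Matrix.transpose_one]

/-- `1 + μ Π H Π` is almost a contraction -/
lemma one_add_Q : ‖1 + s.μ • (s.Pc * (s.H * s.Pc))‖ ≤ 1 + s.μ * s.ρ + s.μ ^ 2 := by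
  have hμ := s.hμ; have hρ := s.hρ0
  refine opn_le _ (by positivity) fun v => ?_
  have hv := nv_nonneg v
  have hH : euclNorm ((s.Pc * (s.H * s.Pc)) *ᵥ v) ≤ 101 / 100 * euclNorm v := by
    refine (nv_mulVec _ _).trans ?_
    gcongr
    have h1 := opn_mul_le s.hHn (Pc_opn (s := s))
    have h2 := opn_mul_le (Pc_opn (s := s)) h1
    linarith
  have hq : v ⬝ᵥ ((s.Pc * (s.H * s.Pc)) *ᵥ v) ≤ s.ρ * euclNorm v ^ 2 := by
    rw [← Matrix.mulVec_mulVec, ← Matrix.mulVec_mulVec, dot_mulVec_comm, Pct]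
    refine (s.hQ _ ?_).trans ?_
    · rw [Matrix.mulVec_mulVec, UtPi, Matrix.zero_mulVec]
    · have := nv_mulVec s.Pc v
      have h2 := Pc_opn (s := s)
      have h3 : euclNorm (s.Pc *ᵥ v) ≤ euclNorm v := by
        refine this.trans ?_
        nlinarith
      have := nv_nonneg (s.Pc *ᵥ v)
      gcongr
  set w := (s.Pc * (s.H * s.Pc)) *ᵥ v
  have e : (1 + s.μ • (s.Pc * (s.H * s.Pc))) *ᵥ v = v + s.μ • w := by
    rw [Matrix.add_mulVec, Matrix.one_mulVec, Matrix.smul_mulVec]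
  rw [e]
  have e2 : euclNorm (v + s.μ • w) ^ 2 = euclNorm v ^ 2 + 2 * s.μ * (v ⬝ᵥ w)
      + s.μ ^ 2 * euclNorm w ^ 2 := by
    simp only [nv_sq, add_dotProduct, dotProduct_add, smul_dotProduct, dotProduct_smul, smul_eq_mul]
    rw [dotProduct_comm w v]; ring
  have hw : euclNorm w ^ 2 ≤ 2 * euclNorm v ^ 2 := by
    have := nv_nonneg w
    nlinarith
  refine le_of_sq2 ?_ (by positivity)
  rw [e2]
  have h1 : 2 * s.μ * (v ⬝ᵥ w) ≤ 2 * s.μ * (s.ρ * euclNorm v ^ 2) := by gcongr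
  have h2 : s.μ ^ 2 * euclNorm w ^ 2 ≤ s.μ ^ 2 * (2 * euclNorm v ^ 2) := by gcongr
  have h3 : 0 ≤ (s.μ * s.ρ + s.μ ^ 2) ^ 2 * euclNorm v ^ 2 := by positivity
  nlinarith

lemma one_sub_L : ‖1 - s.μ • s.L‖ ≤ 1 - s.μ * (s.σ - s.ρ) := by
  have hμ := s.hμ; have hσ := s.hσ1; have := s.hσ
  have hm : s.μ ≤ 1 / 10 ^ 20 := by
    have := s.hμσ
    have h5 : s.σ ^ 5 ≤ 1 := pow_le_one₀ s.hσ.le s.hσ1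
    nlinarith
  have hr := s.hρ0
  have e : 1 - s.μ • s.L = Matrix.diagonal (fun i => 1 - s.μ * s.l i) := by
    rw [L, ← Matrix.diagonal_one, ← Matrix.diagonal_smul, Matrix.diagonal_sub]
    congr 1
  rw [e]
  refine opn_diag_le _ ?_ fun i => ?_
  · nlinarith
  · have h1 := s.hl i; have h2 := s.hl1 i
    rw [abs_le]; constructor
    · nlinarith
    · nlinarith

lemma L_opn : ‖s.L‖ ≤ 101 / 100 := by
  refine opn_diag_le _ (by norm_num) fun i => ?_
  have h1 := s.hl i; have h2 := s.hl1 i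
  have h3 := s.hρ; have := s.hσ
  have : s.σ ^ 3 ≤ s.σ := by have := smul_pow (s := s); linarith [this.1, this.2.1]
  rw [abs_le]; constructor <;> linarith

end Dyn
end Invariants

section Invariants2
open scoped Matrix.Norms.L2Operator
namespace Dyn
variable {ι : Type} [Fintype ι] [DecidableEq ι] {k r : ℕ} {s : Dyn ι k r}
variable {z0 s0 : ℝ} {T t : ℕ}

lemma mu_small : s.μ ≤ 1 / 10 ^ 20 := by
  have := s.hμσ
  have h5 : s.σ ^ 5 ≤ 1 := pow_le_one₀ s.hσ.le s.hσ1
  nlinarith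

lemma rho_small : s.ρ ≤ 1 / 10 ^ 10 := by
  have := s.hρ
  have h5 : s.σ ^ 3 ≤ 1 := pow_le_one₀ s.hσ.le s.hσ1
  nlinarith

lemma Hyp.kn (h : s.Hyp z0 s0 T) (ht : t ≤ T) : k * s.nh z0 t ≤ 1 / 10 ^ 10 * s.σ ^ 3 := by
  have := nh_mono (s := s) h.hz0 ht
  exact (by gcongr : (k : ℝ) * s.nh z0 t ≤ k * s.nh z0 T).trans h.hn

lemma Hyp.n (h : s.Hyp z0 s0 T) (ht : t ≤ T) : s.nh z0 t ≤ 1 / 10 ^ 10 * s.σ ^ 3 := by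
  have h1 : (1 : ℝ) ≤ k := by exact_mod_cast h.hk
  have := nh_pos (s := s) h.hz0 t
  have := h.kn ht
  nlinarith

lemma Hyp.mut (h : s.Hyp z0 s0 T) (ht : t ≤ T) : s.μ ^ 2 * t ≤ 1 / 10 ^ 21 * s.σ ^ 4 := by
  have : (t : ℝ) ≤ T := by exact_mod_cast ht
  exact (by gcongr : s.μ ^ 2 * (t : ℝ) ≤ s.μ ^ 2 * T).trans h.hT

lemma Hyp.zs (h : s.Hyp z0 s0 T) : z0 ≤ 1 / 10 ^ 20 := by
  have := h.hz
  have h5 : s.σ ^ 4 ≤ 1 := pow_le_one₀ s.hσ.le s.hσ1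
  nlinarith

lemma A_opn (t : ℕ) : ‖s.A t‖ ≤ ‖s.Z t‖ := by
  have := opn_mul_le (Ut_opn (s := s)) (le_refl ‖s.Z t‖)
  rw [one_mul] at this; exact this

lemma Inv.Gam (i : s.Inv z0 s0 t) : ‖s.Γ t‖ ≤ 1001 / 1000 := by
  have h1 := norm_add_le s.U (s.K t)
  have h2 := i.hK
  have := U_opn (s := s)
  have h5 : s.σ ^ 2 ≤ 1 := pow_le_one₀ s.hσ.le s.hσ1
  rw [Γ]; linarith

lemma D_gen (i : s.Inv z0 s0 t) : ‖s.D t‖ ≤ s.ρ * (103 / 100 * ‖s.Z t‖ ^ 2)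
    + s.ρ * k * (21 / 10 * ‖s.Z t‖ * ‖s.N t‖) := by
  refine (s.hD t _ _ _ (s.Zsplit t)).trans ?_
  have h1 : ‖s.Γ t‖ * ‖s.A t‖ ≤ 1001 / 1000 * ‖s.Z t‖ := by
    have := A_opn (s := s) t; have := i.Gam
    gcongr
  have h2 := norm_nonneg (s.Γ t); have h3 := norm_nonneg (s.A t); have h4 := norm_nonneg (s.N t)
  have h5 := norm_nonneg (s.Z t)
  have hr := s.hρ0
  have h6 : (‖s.Γ t‖ * ‖s.A t‖) ^ 2 ≤ 103 / 100 * ‖s.Z t‖ ^ 2 := by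
    have : 0 ≤ ‖s.Γ t‖ * ‖s.A t‖ := by positivity
    calc _ ≤ (1001 / 1000 * ‖s.Z t‖) ^ 2 := by gcongr
      _ ≤ _ := by nlinarith [sq_nonneg ‖s.Z t‖]
  have h7 : ‖s.Γ t‖ * ‖s.A t‖ + ‖s.Z t‖ ≤ 21 / 10 * ‖s.Z t‖ := by linarith
  gcongr

lemma D_bd (h : s.Hyp z0 s0 T) (i : s.Inv z0 s0 t) (ht : t ≤ T) : ‖s.D t‖ ≤ 5 * s.ρ := by
  refine (D_gen i).trans ?_
  have h1 := h.kn ht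
  have h5 : s.σ ^ 3 ≤ 1 := pow_le_one₀ s.hσ.le s.hσ1
  have h2 := i.hZ2; have h3 := i.hN
  have h4 := norm_nonneg (s.N t); have h6 := norm_nonneg (s.Z t)
  have hr := s.hρ0
  have h7 : ‖s.Z t‖ ^ 2 ≤ 4 := by nlinarith
  have h8 : (k : ℝ) * ‖s.N t‖ ≤ 1 / 10 ^ 10 := by
    have : (k : ℝ) * ‖s.N t‖ ≤ k * s.nh z0 t := by gcongr
    linarith
  have h9 : (k : ℝ) * ‖s.N t‖ * ‖s.Z t‖ ≤ 1 / 10 ^ 10 * 2 := by gcongr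
  have e : s.ρ * k * (21 / 10 * ‖s.Z t‖ * ‖s.N t‖) = s.ρ * (21 / 10 * (k * ‖s.N t‖ * ‖s.Z t‖)) := by
    ring
  rw [e, ← mul_add, mul_comm 5]
  gcongr
  linarith

lemma JZ_opn (t : ℕ) : ‖s.J * s.Z t‖ ≤ ‖s.Z t‖ := by
  have := opn_mul_le (J_opn (s := s)) (le_refl ‖s.Z t‖)
  rwa [one_mul] at this

lemma norm_half {a b : Type*} [Fintype a] [Fintype b] [DecidableEq a] [DecidableEq b]
    (Q : Matrix a b ℝ) : ‖(1/2 : ℝ) • Q‖ = 1 / 2 * ‖Q‖ := by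
  rw [norm_smul]; norm_num

lemma M_bd (h : s.Hyp z0 s0 T) (i : s.Inv z0 s0 t) (ht : t ≤ T) : ‖s.M t‖ ≤ 6 := by
  rw [s.hM]
  have h1 := D_bd h i ht
  have h2 := i.hZ2
  have h3 : ‖s.Z t * (s.Z t)ᵀ‖ ≤ 2 * 2 := opn_mul_le h2 (by rwa [opn_transpose])
  have h4 : ‖s.J * s.Z t * (s.J * s.Z t)ᵀ‖ ≤ 2 * 2 :=
    opn_mul_le ((JZ_opn t).trans h2) (by rw [opn_transpose]; exact (JZ_opn t).trans h2)
  have h5 := rho_small (s := s)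
  have h6 := s.hHn
  refine (norm_add_le _ _).trans ?_
  have h7 := norm_sub_le (s.H + s.D t) ((1/2 : ℝ) • (s.Z t * (s.Z t)ᵀ))
  have h8 := norm_add_le s.H (s.D t)
  rw [norm_half] at h7 ⊢
  linarith

lemma P_bd (h : s.Hyp z0 s0 T) (i : s.Inv z0 s0 t) (ht : t ≤ T) : ‖s.P t‖ ≤ 61 / 10 := by
  have := opn_mul_le (Ut_opn (s := s)) (opn_mul_le (M_bd h i ht) i.Gam)
  rw [P]; linarith

lemma Th_inv (h : s.Hyp z0 s0 T) (i : s.Inv z0 s0 t) (ht : t ≤ T) :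
    s.Θ t * (s.Θ t)⁻¹ = 1 ∧ (s.Θ t)⁻¹ * s.Θ t = 1 ∧ ‖(s.Θ t)⁻¹‖ ≤ 2 ∧
      ‖(s.Θ t)⁻¹ - 1‖ ≤ 13 * s.μ := by
  have h1 := P_bd h i ht
  have h2 : ‖s.μ • s.P t‖ ≤ s.μ * (61 / 10) := by
    rw [norm_smul, Real.norm_of_nonneg s.hμ.le]
    have := s.hμ
    gcongr
  have h3 := mu_small (s := s)
  have h4 := s.hμ
  obtain ⟨a, b, c, d⟩ := inv_one_add (s.μ • s.P t) (by linarith)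
  exact ⟨a, b, c, by refine d.trans ?_; linarith⟩

lemma G_bd (i : s.Inv z0 s0 t) : ‖s.G t‖ ≤ 2002 / 1000 := by
  have hz : ‖(s.Z t)ᵀ‖ ≤ 2 := by rw [opn_transpose]; exact i.hZ2
  have := opn_mul_le hz i.Gam
  rw [G]; linarith

lemma JZF (i : s.Inv z0 s0 t) : ‖s.J * (s.Z t * s.F t)‖ ≤ 2 / 10 ^ 17 * s.σ ^ 3 := by
  have := opn_mul_le (J_opn (s := s)) (opn_mul_le i.hZ2 i.hF)
  linarith

lemma R2_bd (h : s.Hyp z0 s0 T) (i : s.Inv z0 s0 t) (ht : t ≤ T) :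
    ‖s.R2 t‖ ≤ 6 / 10 ^ 10 * s.σ ^ 3 := by
  have h1 := opn_mul_le (Ut_opn (s := s)) (opn_mul_le (D_bd h i ht) i.Gam)
  have h2 := opn_mul_le (Ut_opn (s := s)) (JZF i)
  have h3 := s.hρ
  have h0 := s.hσ
  have h4 : 0 ≤ s.σ ^ 3 := by positivity
  rw [R2]
  refine (norm_add_le _ _).trans ?_
  rw [norm_half]
  nlinarith

lemma R1_bd (h : s.Hyp z0 s0 T) (i : s.Inv z0 s0 t) (ht : t ≤ T) :
    ‖s.R1 t‖ ≤ 7 / 10 ^ 10 * s.σ ^ 3 := by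
  have h1 := opn_mul_le (Pc_opn (s := s)) (opn_mul_le (D_bd h i ht) i.Gam)
  have h2 := opn_mul_le (Pc_opn (s := s)) (JZF i)
  have h5 := opn_mul_le (i.hN.trans (h.n ht)) (G_bd i)
  have h3 := s.hρ
  have h0 := s.hσ
  have h4 : 0 ≤ s.σ ^ 3 := by positivity
  rw [R1]
  refine (norm_add_le _ _).trans ?_
  have h6 := norm_sub_le (s.Pc * (s.D t * s.Γ t)) ((1/2 : ℝ) • (s.N t * s.G t))
  rw [norm_half] at h6 ⊢
  nlinarith

lemma norm_mu {a b : Type*} [Fintype a] [Fintype b] [DecidableEq a] [DecidableEq b]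
    (Q : Matrix a b ℝ) {x : ℝ} (hx : ‖Q‖ ≤ x) : ‖s.μ • Q‖ ≤ s.μ * x := by
  rw [norm_smul, Real.norm_of_nonneg s.hμ.le]
  have := s.hμ
  gcongr

lemma norm_mu2 {a b : Type*} [Fintype a] [Fintype b] [DecidableEq a] [DecidableEq b]
    (Q : Matrix a b ℝ) {x : ℝ} (hx : ‖Q‖ ≤ x) : ‖s.μ ^ 2 • Q‖ ≤ s.μ ^ 2 * x := by
  rw [norm_smul, Real.norm_of_nonneg (sq_nonneg _)]
  gcongr

lemma QK_eq (t : ℕ) : s.Pc * (s.H * s.K t) = (s.Pc * (s.H * s.Pc)) * s.K t := by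
  conv_lhs => rw [← PiK]
  simp only [Matrix.mul_assoc]

lemma Q_opn : ‖s.Pc * (s.H * s.Pc)‖ ≤ 101 / 100 := by
  have h1 := opn_mul_le s.hHn (Pc_opn (s := s))
  have h2 := opn_mul_le (Pc_opn (s := s)) h1
  linarith

set_option maxHeartbeats 1000000 in
/-- the step for the graph matrices -/
lemma K_next (h : s.Hyp z0 s0 T) (i : s.Inv z0 s0 t) (ht : t ≤ T) :
    ‖s.K (t + 1)‖ ≤ 1 / 10 ^ 8 * s.σ ^ 2 ∧ ‖s.K (t + 1) - s.K t‖ ≤ 1 / 10 ^ 7 * s.μ := by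
  obtain ⟨h1, h2, h3, h4⟩ := Th_inv h i ht
  have hs := s.K_step t h2 h1
  set κ := 1 / 10 ^ 8 * s.σ ^ 2 with hκ
  have hKb : ‖s.K t‖ ≤ κ := i.hK
  have hμ := s.hμ
  have hσ := s.hσ
  have hκ0 : 0 ≤ κ := by positivity
  have hσ3 : 0 ≤ s.σ ^ 3 := by positivity
  obtain ⟨p1, p2, p3, p4⟩ := smul_pow (s := s)
  have hσ2 : s.σ ^ 2 ≤ 1 := pow_le_one₀ s.hσ.le s.hσ1
  have hR1 := R1_bd h i ht
  have hR2 := R2_bd h i ht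
  have hR : ‖s.R1 t - s.K t * s.R2 t‖ ≤ 8 / 10 ^ 10 * s.σ ^ 3 := by
    refine (norm_sub_le _ _).trans ?_
    have := opn_mul_le hKb hR2
    have e : κ * (6 / 10 ^ 10 * s.σ ^ 3) ≤ 1 / 10 ^ 8 * (6 / 10 ^ 10 * s.σ ^ 3) := by
      have : κ ≤ 1 / 10 ^ 8 := by linarith
      gcongr
    linarith
  have hQK := opn_mul_le (Q_opn (s := s)) hKb
  have hKL := opn_mul_le hKb (L_opn (s := s))
  have hE : ‖s.Pc * (s.H * s.K t) - s.K t * s.L‖ ≤ 203 / 100 * κ := by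
    rw [QK_eq]
    refine (norm_sub_le _ _).trans ?_
    linarith
  have hRT := norm_mu (s := s) _ (opn_mul_le hR h3)
  constructor
  · have e : s.K (t + 1) = (1 + s.μ • (s.Pc * (s.H * s.Pc))) * (s.K t * (1 - s.μ • s.L))
        + s.μ ^ 2 • ((s.Pc * (s.H * s.Pc)) * (s.K t * s.L))
        + s.μ • ((s.Pc * (s.H * s.K t) - s.K t * s.L) * ((s.Θ t)⁻¹ - 1))
        + s.μ • ((s.R1 t - s.K t * s.R2 t) * (s.Θ t)⁻¹) := by
      rw [hs, QK_eq]
      simp only [Matrix.mul_sub, Matrix.add_mul, Matrix.one_mul, Matrix.mul_one, Matrix.smul_mul,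
        Matrix.mul_smul]
      module
    rw [e]
    have b1 := opn_mul_le (one_add_Q (s := s)) (opn_mul_le hKb (one_sub_L (s := s)))
    have b2 := norm_mu2 (s := s) _ (opn_mul_le (Q_opn (s := s)) hKL)
    have b3 := norm_mu (s := s) _ (opn_mul_le hE h4)
    have b := (norm_add_le _ _).trans (add_le_add (norm_add₃_le (a := (1 + s.μ • (s.Pc * (s.H * s.Pc))) * (s.K t * (1 - s.μ • s.L))) (b := s.μ ^ 2 • ((s.Pc * (s.H * s.Pc)) * (s.K t * s.L))) (c := s.μ • ((s.Pc * (s.H * s.K t) - s.K t * s.L) * ((s.Θ t)⁻¹ - 1)))) hRT)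
    refine b.trans ?_
    have hm := s.hμσ
    have hr := s.hρ
    have hr0 := s.hρ0
    have hm1 := mu_small (s := s)
    -- main scalar estimate
    have c0 : (1 + s.μ * s.ρ + s.μ ^ 2) * (1 - s.μ * (s.σ - s.ρ)) ≤ 1 - s.μ * (9 / 10 * s.σ) := by
      have q1 : s.ρ ≤ 1 / 100 * s.σ := by nlinarith
      have q2 : s.μ ≤ 1 / 100 * s.σ := by nlinarith
      have q3 : s.μ * s.ρ ≤ s.μ * (1 / 100 * s.σ) := by gcongr
      have q4 : s.μ ^ 2 ≤ s.μ * (1 / 100 * s.σ) := by rw [pow_two]; gcongr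
      have q5 : 0 ≤ s.μ * s.ρ + s.μ ^ 2 := by positivity
      have q6 : 0 ≤ s.μ * (s.σ - s.ρ) := by
        apply mul_nonneg hμ.le; linarith
      nlinarith
    have c1 : (1 + s.μ * s.ρ + s.μ ^ 2) * (κ * (1 - s.μ * (s.σ - s.ρ))) ≤
        κ * (1 - s.μ * (9 / 10 * s.σ)) := by
      calc _ = κ * ((1 + s.μ * s.ρ + s.μ ^ 2) * (1 - s.μ * (s.σ - s.ρ))) := by ring
        _ ≤ _ := by gcongr
    have c2 : s.μ ^ 2 ≤ s.μ * (1 / 10 ^ 20 * s.σ) := by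
      rw [pow_two]; gcongr
      refine hm.trans ?_
      gcongr; linarith
    have c3 : s.μ ^ 2 * κ ≤ s.μ * (1 / 10 ^ 20 * s.σ) * κ := by gcongr
    have c4 : s.μ * s.σ * κ = 1 / 10 ^ 8 * (s.μ * s.σ ^ 3) := by rw [hκ]; ring
    have c5 : 0 ≤ s.μ * s.σ ^ 3 := by positivity
    have c6 : 0 ≤ s.μ * s.σ * κ := by positivity
    clear_value κ
    linarith
  · have e : s.K (t + 1) - s.K t = s.μ • ((s.Pc * (s.H * s.K t) - s.K t * s.L) * (s.Θ t)⁻¹)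
      + s.μ • ((s.R1 t - s.K t * s.R2 t) * (s.Θ t)⁻¹) := by rw [hs]; abel
    rw [e]
    refine (norm_add_le _ _).trans ?_
    have b3 := norm_mu (s := s) _ (opn_mul_le hE h3)
    have q1 : κ ≤ 1 / 10 ^ 8 := by linarith
    have q2 : s.σ ^ 3 ≤ 1 := by linarith
    have q3 : s.μ * κ ≤ s.μ * (1 / 10 ^ 8) := by gcongr
    have q4 : s.μ * s.σ ^ 3 ≤ s.μ * 1 := by gcongr
    linarith

end Dyn
end Invariants2

section Invariants3
open scoped Matrix.Norms.L2Operator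
namespace Dyn
variable {ι : Type} [Fintype ι] [DecidableEq ι] {k r : ℕ} {s : Dyn ι k r}
variable {z0 s0 : ℝ} {T t : ℕ}

lemma UtHN (t : ℕ) : s.Uᵀ * (s.H * s.N t) = 0 := by
  rw [← Matrix.mul_assoc, UtH, Matrix.mul_assoc, UtN, Matrix.mul_zero]

lemma QN_eq (t : ℕ) : s.H * s.N t = (s.Pc * (s.H * s.Pc)) * s.N t := by
  have : s.Pc * (s.H * s.N t) = s.H * s.N t := by
    conv_lhs => rw [Pc, Matrix.sub_mul, Matrix.one_mul, Matrix.mul_assoc, UtHN, Matrix.mul_zero,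
      sub_zero]
  rw [Matrix.mul_assoc, Matrix.mul_assoc, PiN, this]

lemma N_step (t : ℕ) (h : (s.Θ t)⁻¹ * s.Θ t = 1) :
    s.N (t + 1) = (1 + s.μ • (s.Pc * (s.H * s.Pc))) * s.N t
      + s.μ • ((1 - s.Γ (t+1) * s.Uᵀ) * (s.D t * s.N t))
      - s.μ • ((1/2 : ℝ) • (((s.K t - s.K (t+1)) * s.A t + s.N t) * ((s.Z t)ᵀ * s.N t)))
      + s.μ • ((1/2 : ℝ) • ((1 - s.Γ (t+1) * s.Uᵀ) * (s.J * (s.Z t * s.W t)))) := by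
  have e1 : ∀ Q : Matrix (Fin k) (Fin k) ℝ, ((s.K t - s.K (t+1)) * s.A t + s.N t) * Q
      = s.Z t * Q - s.Γ (t+1) * (s.Uᵀ * (s.Z t * Q)) := by
    intro Q
    have : (s.K t - s.K (t+1)) * s.A t + s.N t = s.Z t - s.Γ (t+1) * s.A t := by
      rw [N, Γ, Γ]; simp only [Matrix.sub_mul, Matrix.add_mul]; abel
    rw [this, Matrix.sub_mul, A]; simp only [Matrix.mul_assoc]
  rw [N_succ _ _ h, M_mul, e1, Matrix.add_mul, Matrix.one_mul, Matrix.smul_mul, ← QN_eq, W]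
  simp only [Matrix.mul_add, Matrix.mul_sub, Matrix.mul_smul, UtHN, Matrix.sub_mul, Matrix.one_mul,
    Matrix.mul_assoc, Matrix.mul_zero]
  module

lemma W_bd (h : s.Hyp z0 s0 T) (i : s.Inv z0 s0 t) :
    ‖s.W t‖ ≤ 1 / 10 ^ 8 * s.σ * s.nh z0 t := by
  have h1 := i.hW
  have h2 := h.hz
  have hz := h.hz0
  have hσ := s.hσ
  have hn := nh_mono (s := s) hz (Nat.zero_le t)
  rw [nh_zero] at hn
  obtain ⟨p1, p2, p3, p4⟩ := smul_pow (s := s)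
  have a1 : z0 ^ 2 ≤ 1 / 10 ^ 20 * s.σ * s.nh z0 t := by
    rw [pow_two]; gcongr; linarith
  have a2 : s.σ ^ 2 * (s.nh z0 t - z0) ≤ s.σ * s.nh z0 t := by
    have : 0 ≤ s.nh z0 t - z0 := by linarith
    calc _ ≤ s.σ * (s.nh z0 t - z0) := by gcongr
      _ ≤ _ := by gcongr; linarith
  have a3 : 0 ≤ s.σ * s.nh z0 t := by have := nh_pos (s := s) hz t; positivity
  linarith

set_option maxHeartbeats 1000000 in
lemma N_next (h : s.Hyp z0 s0 T) (i : s.Inv z0 s0 t) (ht : t ≤ T) :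
    ‖s.N (t + 1)‖ ≤ s.nh z0 (t + 1) := by
  obtain ⟨h1, h2, h3, h4⟩ := Th_inv h i ht
  obtain ⟨k1, k2⟩ := K_next h i ht
  have hμ := s.hμ
  have hσ := s.hσ
  have hσ1 := s.hσ1
  have hσ2 : s.σ ^ 2 ≤ 1 := pow_le_one₀ s.hσ.le s.hσ1
  obtain ⟨p1, p2, p3, p4⟩ := smul_pow (s := s)
  have hG : ‖s.Γ (t+1) * s.Uᵀ‖ ≤ 1001 / 1000 * 1 := by
    refine opn_mul_le ?_ Ut_opn
    have h1 := norm_add_le s.U (s.K (t+1))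
    have := U_opn (s := s)
    rw [Γ]; linarith
  have hPsi : ‖1 - s.Γ (t+1) * s.Uᵀ‖ ≤ 2001 / 1000 := by
    refine (norm_sub_le _ _).trans ?_
    have := opn_one_le (a := ι)
    linarith
  have hn0 := nh_pos (s := s) h.hz0 t
  have hn := i.hN
  set n := s.nh z0 t with hnd
  have hnT : n ≤ 1 / 10 ^ 10 * s.σ ^ 3 := h.n ht
  have hW := W_bd h i
  rw [← hnd] at hW
  have hZt : ‖(s.Z t)ᵀ‖ ≤ 2 := by rw [opn_transpose]; exact i.hZ2
  have b1 := opn_mul_le (one_add_Q (s := s)) hn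
  have b2 := norm_mu (s := s) _ (opn_mul_le hPsi (opn_mul_le (D_bd h i ht) hn))
  have b3' : ‖(s.K t - s.K (t+1)) * s.A t + s.N t‖ ≤ 1 / 10 ^ 7 * s.μ * 2 + n := by
    refine (norm_add_le _ _).trans (add_le_add (opn_mul_le ?_ ((A_opn t).trans i.hZ2)) hn)
    rw [norm_sub_rev]; exact k2
  have b3 : ‖s.μ • ((1/2 : ℝ) • (((s.K t - s.K (t+1)) * s.A t + s.N t) * ((s.Z t)ᵀ * s.N t)))‖
      ≤ s.μ * (1 / 2 * ((1 / 10 ^ 7 * s.μ * 2 + n) * (2 * n))) := by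
    refine norm_mu (s := s) _ ?_
    rw [norm_half]
    have := opn_mul_le b3' (opn_mul_le hZt hn)
    gcongr
  have b4 : ‖s.μ • ((1/2 : ℝ) • ((1 - s.Γ (t+1) * s.Uᵀ) * (s.J * (s.Z t * s.W t))))‖ ≤
      s.μ * (1 / 2 * (2001 / 1000 * (1 * (2 * (1 / 10 ^ 8 * s.σ * n))))) := by
    refine norm_mu (s := s) _ ?_
    rw [norm_half]
    have := opn_mul_le hPsi (opn_mul_le (J_opn (s := s)) (opn_mul_le i.hZ2 hW))
    gcongr
  rw [N_step _ h2]
  refine le_trans ?_ (nh_succ (s := s) h.hz0 t)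
  rw [← hnd]
  refine (norm_add_le _ _).trans ?_
  have c1 := norm_sub_le ((1 + s.μ • (s.Pc * (s.H * s.Pc))) * s.N t
      + s.μ • ((1 - s.Γ (t+1) * s.Uᵀ) * (s.D t * s.N t)))
      (s.μ • ((1/2 : ℝ) • (((s.K t - s.K (t+1)) * s.A t + s.N t) * ((s.Z t)ᵀ * s.N t))))
  have c2 := norm_add_le ((1 + s.μ • (s.Pc * (s.H * s.Pc))) * s.N t)
      (s.μ • ((1 - s.Γ (t+1) * s.Uᵀ) * (s.D t * s.N t)))
  have q1 : s.ρ ≤ 1 / 10 ^ 10 * s.σ := s.hρ.trans (by gcongr; linarith)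
  have q2 : s.μ ≤ 1 / 10 ^ 20 * s.σ := s.hμσ.trans (by gcongr; linarith)
  have q3 : n ≤ 1 / 10 ^ 10 * s.σ := hnT.trans (by gcongr; linarith)
  have d0 : 0 ≤ s.μ * n := by positivity
  have d1 : s.μ * n * s.ρ ≤ s.μ * n * (1 / 10 ^ 10 * s.σ) := by gcongr
  have d2 : s.μ * n * s.μ ≤ s.μ * n * (1 / 10 ^ 20 * s.σ) := by gcongr
  have d3 : s.μ * n * n ≤ s.μ * n * (1 / 10 ^ 10 * s.σ) := by gcongr
  have d4 : 0 ≤ s.μ * n * s.σ := by positivity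
  clear_value n
  have d5 : (1 + s.μ * s.ρ + s.μ ^ 2) * n = n + s.μ * n * s.ρ + s.μ * n * s.μ := by ring
  linarith

lemma W_next (h : s.Hyp z0 s0 T) (i : s.Inv z0 s0 t) (ht : t ≤ T)
    (hF : ‖s.F (t + 1)‖ ≤ 1 / 10 ^ 17 * s.σ ^ 3) :
    ‖s.W (t + 1)‖ ≤ z0 ^ 2 + 1 / 10 ^ 9 * s.σ ^ 2 * (s.nh z0 (t + 1) - z0) := by
  obtain ⟨h1, h2, h3, h4⟩ := Th_inv h i ht
  have hμ := s.hμ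
  have hσ := s.hσ
  have hM := M_bd h i ht
  have hZt : ‖(s.Z t)ᵀ‖ ≤ 2 := by rw [opn_transpose]; exact i.hZ2
  have hn := i.hN
  have hw := i.hW
  have hs := nh_succ (s := s) h.hz0 t
  have hn0 := nh_pos (s := s) h.hz0 t
  set n := s.nh z0 t with hnd
  have b1 := norm_mu2 (s := s) _ (opn_mul_le hZt (opn_mul_le (J_opn (s := s)) (opn_mul_le hM (opn_mul_le hM hn))))
  have b2 := norm_mu (s := s) _ (opn_mul_le hF (opn_mul_le (Ut_opn (s := s)) (opn_mul_le hM hn)))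
  rw [W_succ _ _ h2]
  have c1 := norm_sub_le (s.W t - s.μ ^ 2 • ((s.Z t)ᵀ * (s.J * (s.M t * (s.M t * s.N t)))))
     (s.μ • (s.F (t + 1) * (s.Uᵀ * (s.M t * s.N t))))
  have c2 := norm_sub_le (s.W t) (s.μ ^ 2 • ((s.Z t)ᵀ * (s.J * (s.M t * (s.M t * s.N t)))))
  have d1 : s.μ * n * s.μ ≤ s.μ * n * (1 / 10 ^ 20 * s.σ ^ 3) := by
    gcongr
    refine s.hμσ.trans ?_
    obtain ⟨p1, p2, p3, p4⟩ := smul_pow (s := s)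
    linarith
  have d2 : s.σ ^ 2 * (n * (1 + 1 / 10 ^ 7 * s.σ * s.μ)) ≤ s.σ ^ 2 * s.nh z0 (t + 1) := by gcongr
  have d3 : 0 ≤ s.μ * n * s.σ ^ 3 := by positivity
  clear_value n
  have e1 : s.σ ^ 2 * (n * (1 + 1 / 10 ^ 7 * s.σ * s.μ)) = s.σ ^ 2 * n + 1 / 10 ^ 7 * (s.μ * n * s.σ ^ 3) := by
    ring
  have e2 : s.μ ^ 2 * (2 * (1 * (6 * (6 * n)))) = 72 * (s.μ * n * s.μ) := by ring
  linarith

lemma B_next (h : s.Hyp z0 s0 T) (i : s.Inv z0 s0 t) (ht : t ≤ T) :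
    ‖s.B (t + 1)‖ ≤ z0 ^ 2 + 144 * s.μ ^ 2 * ((t + 1 : ℕ) : ℝ) := by
  have hM := M_bd h i ht
  have hZt : ‖(s.Z t)ᵀ‖ ≤ 2 := by rw [opn_transpose]; exact i.hZ2
  have b1 := norm_mu2 (s := s) _ (opn_mul_le hZt (opn_mul_le (J_opn (s := s)) (opn_mul_le hM (opn_mul_le hM i.hZ2))))
  rw [B_succ]
  have c2 := norm_sub_le (s.B t) (s.μ ^ 2 • ((s.Z t)ᵀ * (s.J * (s.M t * (s.M t * s.Z t)))))
  have := i.hB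
  push_cast
  linarith

set_option maxHeartbeats 1000000 in
lemma Z_next (h : s.Hyp z0 s0 T) (i : s.Inv z0 s0 t) (ht : t ≤ T) :
    ‖s.Z (t + 1)‖ ≤ 2 ∧ ‖s.Z (t + 1)‖ ≤ ‖s.Z t‖ * (1 + 13 / 10 * s.μ) := by
  have hμ := s.hμ
  have hm := mu_small (s := s)
  have hσ4 : s.σ ^ 4 ≤ 1 := pow_le_one₀ s.hσ.le s.hσ1
  have hB : ‖s.B t‖ ≤ 1 / 10 := by
    have h1 := i.hB; have h2 := h.mut ht; have h3 := h.zs; have h4 := h.hz0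
    nlinarith
  have hHD : ‖s.H + s.D t‖ ≤ 102 / 100 := by
    have := norm_add_le s.H (s.D t)
    have := s.hHn; have := D_bd h i ht; have := rho_small (s := s)
    linarith
  have hz := norm_nonneg (s.Z t)
  have hz2 := i.hZ2
  -- per-vector estimate
  have key : ∀ v, euclNorm (s.Z (t+1) *ᵥ v) ≤
      euclNorm (s.Z t *ᵥ v - (s.μ / 2) • (s.Z t *ᵥ ((s.Z t)ᵀ *ᵥ (s.Z t *ᵥ v))))
      + 102 / 100 * s.μ * euclNorm (s.Z t *ᵥ v) + s.μ / 20 * ‖s.Z t‖ * euclNorm v := by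
    intro v
    have e : s.Z (t+1) *ᵥ v = (s.Z t *ᵥ v - (s.μ / 2) • (s.Z t *ᵥ ((s.Z t)ᵀ *ᵥ (s.Z t *ᵥ v))))
        + s.μ • ((s.H + s.D t) *ᵥ (s.Z t *ᵥ v)) + (s.μ / 2) • ((s.J * s.Z t * s.B t) *ᵥ v) := by
      rw [s.hZ, M_mul, B]
      simp only [Matrix.add_mulVec, Matrix.sub_mulVec, Matrix.smul_mulVec, Matrix.mulVec_mulVec,
        Matrix.mul_assoc, smul_add, smul_sub, smul_smul, Matrix.add_mul]
      module
    rw [e]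
    refine (nv_add _ _).trans ((add_le_add (nv_add _ _) le_rfl).trans ?_)
    rw [nv_smul, nv_smul, abs_of_pos hμ, abs_of_pos (by positivity)]
    have a1 := nv_mulVec (s.H + s.D t) (s.Z t *ᵥ v)
    have a2 := nv_mulVec (s.J * s.Z t * s.B t) v
    have a3 : ‖s.J * s.Z t * s.B t‖ ≤ ‖s.Z t‖ * (1 / 10) := opn_mul_le (JZ_opn t) hB
    have hv := nv_nonneg v
    have hw := nv_nonneg (s.Z t *ᵥ v)
    have a4 : s.μ * euclNorm ((s.H + s.D t) *ᵥ (s.Z t *ᵥ v)) ≤ s.μ * (102 / 100 * euclNorm (s.Z t *ᵥ v)) := by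
      gcongr; exact a1.trans (by gcongr)
    have a5 : s.μ / 2 * euclNorm ((s.J * s.Z t * s.B t) *ᵥ v) ≤ s.μ / 2 * (‖s.Z t‖ * (1 / 10) * euclNorm v) := by
      gcongr; exact a2.trans (by gcongr)
    linarith
  have core : ∀ v, euclNorm (s.Z t *ᵥ v - (s.μ / 2) • (s.Z t *ᵥ ((s.Z t)ᵀ *ᵥ (s.Z t *ᵥ v)))) ^ 2
      ≤ euclNorm (s.Z t *ᵥ v) ^ 2 - 3 / 4 * s.μ * euclNorm ((s.Z t)ᵀ *ᵥ (s.Z t *ᵥ v)) ^ 2 := by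
    intro v
    set a := s.Z t *ᵥ v
    set w := (s.Z t)ᵀ *ᵥ a with hw
    have e : euclNorm (a - (s.μ / 2) • (s.Z t *ᵥ w)) ^ 2 = euclNorm a ^ 2 - s.μ * euclNorm w ^ 2
        + (s.μ / 2) ^ 2 * euclNorm (s.Z t *ᵥ w) ^ 2 := by
      have e1 : a ⬝ᵥ (s.Z t *ᵥ w) = w ⬝ᵥ w := by rw [dot_mulVec_comm, ← hw]
      simp only [nv_sq, sub_dotProduct, dotProduct_sub, smul_dotProduct, dotProduct_smul, smul_eq_mul]
      rw [dotProduct_comm (s.Z t *ᵥ w) a, e1]; ring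
    rw [e]
    have b1 := nv_mulVec (s.Z t) w
    have b2 := nv_nonneg (s.Z t *ᵥ w)
    have b3 : euclNorm (s.Z t *ᵥ w) ≤ 2 * euclNorm w := b1.trans (by have := nv_nonneg w; gcongr)
    have b4 : euclNorm (s.Z t *ᵥ w) ^ 2 ≤ (2 * euclNorm w) ^ 2 := by gcongr
    have b5 : (s.μ / 2) ^ 2 * euclNorm (s.Z t *ᵥ w) ^ 2 ≤ (s.μ / 2) ^ 2 * (2 * euclNorm w) ^ 2 := by gcongr
    have b6 : s.μ * s.μ * euclNorm w ^ 2 ≤ s.μ * (1 / 10 ^ 20) * euclNorm w ^ 2 := by gcongr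
    have b7 : 0 ≤ s.μ * euclNorm w ^ 2 := by positivity
    nlinarith
  constructor
  · refine opn_le _ (by norm_num) fun v => ?_
    by_cases hv : euclNorm v = 0
    · have : v = 0 := nv_eq_zero hv
      subst this
      rw [Matrix.mulVec_zero, hv, nv_zero]; norm_num
    have hv0 : 0 < euclNorm v := lt_of_le_of_ne (nv_nonneg v) (Ne.symm hv)
    have hk := key v
    have hc := core v
    set V := euclNorm v
    set a := euclNorm (s.Z t *ᵥ v) with ha
    set b := euclNorm (s.Z t *ᵥ v - (s.μ / 2) • (s.Z t *ᵥ ((s.Z t)ᵀ *ᵥ (s.Z t *ᵥ v))))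
    have ha0 : 0 ≤ a := nv_nonneg _
    have ha2 : a ≤ 2 * V := (nv_mulVec _ _).trans (by gcongr)
    have hw : a ^ 2 ≤ V * euclNorm ((s.Z t)ᵀ *ᵥ (s.Z t *ᵥ v)) := by
      rw [ha, nv_sq, dot_mulVec_comm, dotProduct_comm]
      exact dot_le _ _
    set w := euclNorm ((s.Z t)ᵀ *ᵥ (s.Z t *ᵥ v))
    have hw0 : 0 ≤ w := nv_nonneg _
    have hz3 : s.μ / 20 * ‖s.Z t‖ * V ≤ s.μ / 20 * 2 * V := by gcongr
    have hb0 : 0 ≤ b := nv_nonneg _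
    rcases le_or_gt a (19 / 10 * V) with h19 | h19
    · have hb : b ≤ a := by
        refine le_of_sq2 ?_ ha0
        have : 0 ≤ 3 / 4 * s.μ * w ^ 2 := by positivity
        linarith
      have : s.μ * a ≤ 1 / 10 ^ 20 * (2 * V) := by gcongr
      have : s.μ * V ≤ 1 / 10 ^ 20 * V := by gcongr
      linarith
    · -- w ≥ 1.9 a ≥ 3.61 V
      have hw1 : 19 / 10 * a ≤ w := by
        have : V * (19 / 10 * a) ≤ V * w := by nlinarith
        exact le_of_mul_le_mul_left this hv0
      have hw2 : (19 / 10 * a) ^ 2 ≤ w ^ 2 := by gcongr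
      have hb : b ≤ a - 27 / 20 * s.μ * a := by
        refine le_of_sq2 ?_ ?_
        · have : 3 / 4 * s.μ * (19 / 10 * a) ^ 2 ≤ 3 / 4 * s.μ * w ^ 2 := by gcongr
          have : 0 ≤ (s.μ * a) ^ 2 := by positivity
          have : 0 ≤ s.μ * a ^ 2 := by positivity
          nlinarith
        · have : s.μ * a ≤ 1 / 10 ^ 20 * a := by gcongr
          linarith
      have : s.μ * (19 / 10 * V) ≤ s.μ * a := by gcongr
      have : 0 ≤ s.μ * V := by positivity
      linarith
  · refine opn_le _ (by positivity) fun v => ?_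
    have hk := key v
    have hc := core v
    have hv := nv_nonneg v
    have h1 := nv_mulVec (s.Z t) v
    have hb : euclNorm (s.Z t *ᵥ v - (s.μ / 2) • (s.Z t *ᵥ ((s.Z t)ᵀ *ᵥ (s.Z t *ᵥ v)))) ≤ euclNorm (s.Z t *ᵥ v) := by
      refine le_of_sq2 ?_ (nv_nonneg _)
      have : 0 ≤ 3 / 4 * s.μ * euclNorm ((s.Z t)ᵀ *ᵥ (s.Z t *ᵥ v)) ^ 2 := by positivity
      linarith
    have : s.μ * euclNorm (s.Z t *ᵥ v) ≤ s.μ * (‖s.Z t‖ * euclNorm v) := by gcongr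
    have : 0 ≤ s.μ * (‖s.Z t‖ * euclNorm v) := by positivity
    linarith

end Dyn
end Invariants3

section Invariants4
open scoped Matrix.Norms.L2Operator
namespace Dyn
variable {ι : Type} [Fintype ι] [DecidableEq ι] {k r : ℕ} {s : Dyn ι k r}
variable {z0 s0 : ℝ} {T t : ℕ}

lemma Xi_bd (h : s.Hyp z0 s0 T) (i : s.Inv z0 s0 t) (ht : t ≤ T) : ‖s.Ξ t‖ ≤ s0 / 2 :=
  i.hΞ.trans ((xi_mono h.hz0 ht).trans h.hxi)

/-- `A_tᵀ Y_tᵀ x` is comparable to `A_0ᵀ x` -/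
lemma AY_bd (h : s.Hyp z0 s0 T) (i : s.Inv z0 s0 t) (ht : t ≤ T) (x : Fin r → ℝ) :
    euclNorm ((s.A t)ᵀ *ᵥ ((s.Y t)ᵀ *ᵥ x)) ≤ 3 / 2 * euclNorm ((s.A 0)ᵀ *ᵥ x) ∧
    euclNorm ((s.A 0)ᵀ *ᵥ x) ≤ 2 * euclNorm ((s.A t)ᵀ *ᵥ ((s.Y t)ᵀ *ᵥ x)) := by
  have e : (s.A t)ᵀ *ᵥ ((s.Y t)ᵀ *ᵥ x) = (s.A 0)ᵀ *ᵥ x + (s.Ξ t)ᵀ *ᵥ x := by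
    rw [Matrix.mulVec_mulVec, ← Matrix.transpose_mul, ← Matrix.add_mulVec, ← Matrix.transpose_add, Ξ]
    congr 2; abel
  have h1 := Xi_bd h i ht
  have h2 : euclNorm ((s.Ξ t)ᵀ *ᵥ x) ≤ 1 / 2 * euclNorm ((s.A 0)ᵀ *ᵥ x) := by
    refine (nv_mulVec _ _).trans ?_
    rw [opn_transpose]
    have := nv_nonneg x
    have h3 : ‖s.Ξ t‖ * euclNorm x ≤ s0 / 2 * euclNorm x := by gcongr
    have := h.hA0 x
    linarith
  constructor
  · rw [e]; refine (nv_add _ _).trans ?_; linarith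
  · have e2 : (s.A 0)ᵀ *ᵥ x = (s.A t)ᵀ *ᵥ ((s.Y t)ᵀ *ᵥ x) - (s.Ξ t)ᵀ *ᵥ x := by rw [e]; abel
    have := nv_sub ((s.A t)ᵀ *ᵥ ((s.Y t)ᵀ *ᵥ x)) ((s.Ξ t)ᵀ *ᵥ x)
    rw [← e2] at this
    linarith

lemma G_eq (t : ℕ) : s.G t = (s.A t)ᵀ + (s.A t)ᵀ * ((s.K t)ᵀ * s.K t) + (s.N t)ᵀ * s.K t := by
  have h1 : (s.Γ t)ᵀ * s.Γ t = 1 + (s.K t)ᵀ * s.K t := by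
    have h2 : (s.K t)ᵀ * s.U = 0 := by
      have := congrArg Matrix.transpose (s.UtK t)
      simpa using this
    rw [Γ, Matrix.transpose_add, Matrix.add_mul, Matrix.mul_add, Matrix.mul_add, s.hU, h2, UtK]
    simp
  have h3 : (s.N t)ᵀ * s.U = 0 := by
    have := congrArg Matrix.transpose (s.UtN t)
    simpa using this
  have h4 : (s.Z t)ᵀ = (s.A t)ᵀ * (s.Γ t)ᵀ + (s.N t)ᵀ := by
    conv_lhs => rw [s.Zsplit t, Matrix.transpose_add, Matrix.transpose_mul]
  rw [G, h4, Matrix.add_mul, Matrix.mul_assoc, h1, Γ, Matrix.mul_add, Matrix.mul_add, h3]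
  simp

set_option maxHeartbeats 1000000 in
lemma g_step (h : s.Hyp z0 s0 T) (i : s.Inv z0 s0 t) (ht : t ≤ T) (x : Fin r → ℝ) :
    (1 + 19 / 10 * s.μ * s.σ) * euclNorm ((s.Y (t+1))ᵀ *ᵥ x) ^ 2 ≤
      euclNorm ((s.Y t)ᵀ *ᵥ x) ^ 2 + 5 * s.μ * euclNorm ((s.A 0)ᵀ *ᵥ x) ^ 2 := by
  obtain ⟨h1, h2, h3, h4⟩ := Th_inv h i ht
  have hμ := s.hμ
  have hσ := s.hσ
  obtain ⟨p1, p2, p3, p4⟩ := smul_pow (s := s)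
  have hσ2 : s.σ ^ 2 ≤ 1 := pow_le_one₀ s.hσ.le s.hσ1
  have hσ3 : s.σ ^ 3 ≤ 1 := pow_le_one₀ s.hσ.le s.hσ1
  set y := (s.Y (t+1))ᵀ *ᵥ x with hy
  have e1 : (s.Y t)ᵀ *ᵥ x = y + s.μ • ((s.P t)ᵀ *ᵥ y) := by
    have : s.Y t = s.Y (t+1) * s.Θ t := by rw [Y, Matrix.mul_assoc, h2, Matrix.mul_one]
    rw [this, Matrix.transpose_mul, ← Matrix.mulVec_mulVec, ← hy, Θ, Matrix.transpose_add,
      Matrix.add_mulVec, Matrix.transpose_one, Matrix.one_mulVec, Matrix.transpose_smul,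
      Matrix.smul_mulVec]
  set a := euclNorm y with ha
  have ha0 : 0 ≤ a := nv_nonneg _
  set ψ := euclNorm ((s.A 0)ᵀ *ᵥ x) with hψ
  have hψ0 : 0 ≤ ψ := nv_nonneg _
  set q := euclNorm ((s.A t)ᵀ *ᵥ y) with hq
  have hq0 : 0 ≤ q := nv_nonneg _
  have hqb : q ≤ 3 / 2 * ψ + 13 * s.μ * a := by
    have e2 : (s.A t)ᵀ *ᵥ y = (s.A t)ᵀ *ᵥ ((s.Y t)ᵀ *ᵥ x) - s.μ • ((s.A t)ᵀ *ᵥ ((s.P t)ᵀ *ᵥ y)) := by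
      rw [e1, Matrix.mulVec_add, Matrix.mulVec_smul]; abel
    rw [hq, e2]
    refine (nv_sub _ _).trans ?_
    rw [nv_smul, abs_of_pos hμ]
    have b1 := (AY_bd h i ht x).1
    have b2 : euclNorm ((s.A t)ᵀ *ᵥ ((s.P t)ᵀ *ᵥ y)) ≤ 2 * (61 / 10 * a) := by
      refine (nv_mulVec _ _).trans ?_
      have c1 := nv_mulVec ((s.P t)ᵀ) y
      rw [opn_transpose] at c1 ⊢
      have c2 := P_bd h i ht
      have c3 := (A_opn (s := s) t).trans i.hZ2
      have := nv_nonneg ((s.P t)ᵀ *ᵥ y)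
      have c4 : ‖s.P t‖ * euclNorm y ≤ 61 / 10 * a := by gcongr
      exact mul_le_mul c3 (c1.trans c4) this (by norm_num)
    have b3 : s.μ * euclNorm ((s.A t)ᵀ *ᵥ ((s.P t)ᵀ *ᵥ y)) ≤ s.μ * (2 * (61 / 10 * a)) := by gcongr
    have : 0 ≤ s.μ * a := by positivity
    rw [← hψ] at b1
    linarith
  have hq2 : q ^ 2 ≤ 9 / 2 * ψ ^ 2 + 338 * s.μ ^ 2 * a ^ 2 := by
    have : q ^ 2 ≤ (3 / 2 * ψ + 13 * s.μ * a) ^ 2 := by gcongr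
    nlinarith [sq_nonneg (3 / 2 * ψ - 13 * s.μ * a)]
  -- lower bound for the quadratic form
  have hP : (s.σ - 1 / 100 * s.σ) * a ^ 2 - 101 / 200 * q ^ 2 ≤ y ⬝ᵥ ((s.P t)ᵀ *ᵥ y) := by
    have e3 : y ⬝ᵥ ((s.P t)ᵀ *ᵥ y) = y ⬝ᵥ (s.P t *ᵥ y) := by
      rw [dot_mulVec_comm, Matrix.transpose_transpose, dotProduct_comm]
    rw [e3, P_eq, Matrix.sub_mulVec, Matrix.add_mulVec, dotProduct_sub, dotProduct_add,
      Matrix.smul_mulVec, dotProduct_smul, smul_eq_mul]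
    have f1 : (s.σ - s.ρ) * a ^ 2 ≤ y ⬝ᵥ (s.L *ᵥ y) := by
      rw [ha, nv_sq, L, dotProduct, dotProduct, Finset.mul_sum]
      refine Finset.sum_le_sum fun j _ => ?_
      rw [Matrix.mulVec_diagonal]
      nlinarith [s.hl j, mul_self_nonneg (y j)]
    have f2 : -(6 / 10 ^ 10 * s.σ ^ 3 * a ^ 2) ≤ y ⬝ᵥ (s.R2 t *ᵥ y) := by
      have g1 := neg_le_dot y (s.R2 t *ᵥ y)
      have g2 := nv_mulVec (s.R2 t) y
      have g3 := R2_bd h i ht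
      have g4 : euclNorm y * euclNorm (s.R2 t *ᵥ y) ≤ a * (6 / 10 ^ 10 * s.σ ^ 3 * a) := by
        gcongr
        exact g2.trans (by gcongr)
      have : a * (6 / 10 ^ 10 * s.σ ^ 3 * a) = 6 / 10 ^ 10 * s.σ ^ 3 * a ^ 2 := by ring
      linarith
    have f3 : y ⬝ᵥ ((s.A t * s.G t) *ᵥ y) ≤ 101 / 100 * q ^ 2 + 1 / 10 ^ 3 * s.σ * a ^ 2 := by
      rw [← Matrix.mulVec_mulVec, dot_mulVec_comm]
      refine (dot_le _ _).trans ?_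
      rw [← hq]
      have hK := i.hK
      have hK1 : ‖s.K t‖ ≤ 1 / 10 ^ 8 := by linarith
      have hn : ‖s.N t‖ ≤ 1 / 10 ^ 10 * s.σ ^ 3 := i.hN.trans (h.n ht)
      have hKt : ‖(s.K t)ᵀ‖ ≤ 1 / 10 ^ 8 := by rw [opn_transpose]; exact hK1
      have hNt : ‖(s.N t)ᵀ‖ ≤ 1 / 10 ^ 10 * s.σ ^ 3 := by rw [opn_transpose]; exact hn
      have hA2 : ‖(s.A t)ᵀ‖ ≤ 2 := by rw [opn_transpose]; exact (A_opn (s := s) t).trans i.hZ2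
      have g1 : euclNorm (s.G t *ᵥ y) ≤ q + 3 / 10 ^ 8 * s.σ * a := by
        rw [G_eq, Matrix.add_mulVec, Matrix.add_mulVec]
        refine (nv_add _ _).trans ?_
        have j1 := nv_add ((s.A t)ᵀ *ᵥ y) (((s.A t)ᵀ * ((s.K t)ᵀ * s.K t)) *ᵥ y)
        have j2 := nv_mulVec ((s.A t)ᵀ * ((s.K t)ᵀ * s.K t)) y
        have j3 := opn_mul_le hA2 (opn_mul_le hKt hK)
        have j4 := nv_mulVec ((s.N t)ᵀ * s.K t) y
        have j5 := opn_mul_le hNt hK1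
        have j6 : ‖(s.A t)ᵀ * ((s.K t)ᵀ * s.K t)‖ * euclNorm y ≤ 1 / 10 ^ 8 * s.σ * a := by
          gcongr; linarith
        have j7 : ‖(s.N t)ᵀ * s.K t‖ * euclNorm y ≤ 1 / 10 ^ 8 * s.σ * a := by
          gcongr; linarith
        have : 0 ≤ s.σ * a := by positivity
        linarith
      have g2 : q * euclNorm (s.G t *ᵥ y) ≤ q * (q + 3 / 10 ^ 8 * s.σ * a) := by gcongr
      have g3 : q * (s.σ * a) ≤ 1 / 2 * (q ^ 2 + s.σ * a ^ 2) := by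
        have : (s.σ * a) ^ 2 ≤ s.σ * a ^ 2 := by
          rw [mul_pow]; gcongr
        nlinarith [sq_nonneg (q - s.σ * a)]
      have : 0 ≤ s.σ * a ^ 2 := by positivity
      nlinarith [sq_nonneg q]
    have f4 : s.ρ * a ^ 2 ≤ 1 / 10 ^ 10 * s.σ * a ^ 2 := by
      gcongr; exact s.hρ.trans (by linarith)
    have f5 : s.σ ^ 3 * a ^ 2 ≤ s.σ * a ^ 2 := by
      gcongr; linarith
    have : 0 ≤ s.σ * a ^ 2 := by positivity
    linarith
  have e4 : a ^ 2 + 2 * s.μ * (y ⬝ᵥ ((s.P t)ᵀ *ᵥ y)) ≤ euclNorm ((s.Y t)ᵀ *ᵥ x) ^ 2 := by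
    rw [e1]
    have : euclNorm (y + s.μ • ((s.P t)ᵀ *ᵥ y)) ^ 2 = a ^ 2 + 2 * s.μ * (y ⬝ᵥ ((s.P t)ᵀ *ᵥ y))
        + s.μ ^ 2 * euclNorm ((s.P t)ᵀ *ᵥ y) ^ 2 := by
      simp only [ha, nv_sq, add_dotProduct, dotProduct_add, smul_dotProduct, dotProduct_smul,
        smul_eq_mul]
      rw [dotProduct_comm ((s.P t)ᵀ *ᵥ y) y]; ring
    rw [this]
    have : 0 ≤ s.μ ^ 2 * euclNorm ((s.P t)ᵀ *ᵥ y) ^ 2 := by positivity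
    linarith
  have e5 : s.μ * ((s.σ - 1 / 100 * s.σ) * a ^ 2 - 101 / 200 * q ^ 2) ≤ s.μ * (y ⬝ᵥ ((s.P t)ᵀ *ᵥ y)) := by
    gcongr
  have e6 : s.μ * q ^ 2 ≤ s.μ * (9 / 2 * ψ ^ 2 + 338 * s.μ ^ 2 * a ^ 2) := by gcongr
  have e7 : s.μ ^ 2 * (s.μ * a ^ 2) ≤ (1 / 10 ^ 10 * s.σ) * (s.μ * a ^ 2) := by
    gcongr
    have q2 : s.μ ≤ 1 / 10 ^ 20 * s.σ := s.hμσ.trans (by gcongr; linarith)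
    have := mu_small (s := s)
    nlinarith
  have e8 : 0 ≤ s.μ * s.σ * a ^ 2 := by positivity
  have e9 : 0 ≤ s.μ * ψ ^ 2 := by positivity
  linarith

lemma g_next (h : s.Hyp z0 s0 T) (i : s.Inv z0 s0 t) (ht : t ≤ T) (x : Fin r → ℝ) :
    euclNorm ((s.Y (t+1))ᵀ *ᵥ x) ^ 2 ≤
        ((1 + 19 / 10 * s.μ * s.σ) ^ (t+1))⁻¹ * euclNorm x ^ 2
          + 3 / s.σ * euclNorm ((s.A 0)ᵀ *ᵥ x) ^ 2 ∧
    ∀ t' ≤ t + 1, euclNorm ((s.Y (t+1))ᵀ *ᵥ x) ^ 2 ≤ euclNorm ((s.Y t')ᵀ *ᵥ x) ^ 2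
      + 3 / s.σ * euclNorm ((s.A 0)ᵀ *ᵥ x) ^ 2 := by
  have hg := g_step h i ht x
  have hμ := s.hμ
  have hσ := s.hσ
  have h1 := i.hg1 x
  have h2 := i.hg2
  set q := 1 + 19 / 10 * s.μ * s.σ with hq
  have hq0 : 0 < q := by positivity
  have hq1 : 1 ≤ q := by have : 0 ≤ 19 / 10 * s.μ * s.σ := by positivity
                         linarith
  set ψ := euclNorm ((s.A 0)ᵀ *ᵥ x) ^ 2
  have hψ0 : 0 ≤ ψ := by positivity
  have hc : 3 / s.σ * ψ + 5 * s.μ * ψ ≤ q * (3 / s.σ * ψ) := by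
    have : q * (3 / s.σ * ψ) = 3 / s.σ * ψ + 57 / 10 * s.μ * ψ := by
      rw [hq]; field_simp; ring
    have : 0 ≤ s.μ * ψ := by positivity
    linarith
  constructor
  · refine le_of_mul_le_mul_left ?_ hq0
    have : q * ((q ^ (t+1))⁻¹ * euclNorm x ^ 2 + 3 / s.σ * ψ) = (q ^ t)⁻¹ * euclNorm x ^ 2 + q * (3 / s.σ * ψ) := by
      rw [pow_succ]; field_simp
    rw [this]
    linarith
  · intro t' ht'
    have hp : 0 ≤ 3 / s.σ * ψ := by positivity
    rcases Nat.lt_or_ge t t' with hlt | hge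
    · have : t' = t + 1 := by omega
      subst this; linarith
    · refine le_of_mul_le_mul_left ?_ hq0
      have := h2 t' hge x
      have : euclNorm ((s.Y t')ᵀ *ᵥ x) ^ 2 ≤ q * euclNorm ((s.Y t')ᵀ *ᵥ x) ^ 2 := by
        have : 0 ≤ euclNorm ((s.Y t')ᵀ *ᵥ x) ^ 2 := by positivity
        nlinarith
      rw [mul_add]
      linarith

lemma PhiY_bd (h : s.Hyp z0 s0 T) {t' u : ℕ} (i : s.Inv z0 s0 t') (ht : t' ≤ T)
    (hg : ∀ x, euclNorm ((s.Y u)ᵀ *ᵥ x) ^ 2 ≤ euclNorm ((s.Y t')ᵀ *ᵥ x) ^ 2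
      + 3 / s.σ * euclNorm ((s.A 0)ᵀ *ᵥ x) ^ 2) : ‖s.Φ t' * s.Y u‖ ≤ 7 / s.σ := by
  have hσ := s.hσ
  rw [← opn_transpose]
  refine opn_le _ (by positivity) fun w => ?_
  have hinv : s.Φ t' * s.Y t' = 1 := mul_eq_one_comm.mp i.hYΦ
  have e1 : (s.Y t')ᵀ *ᵥ ((s.Φ t')ᵀ *ᵥ w) = w := by
    rw [Matrix.mulVec_mulVec, ← Matrix.transpose_mul, hinv, Matrix.transpose_one, Matrix.one_mulVec]
  have h1 := hg ((s.Φ t')ᵀ *ᵥ w)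
  have h2 := (AY_bd h i ht ((s.Φ t')ᵀ *ᵥ w)).2
  rw [e1] at h1 h2
  have h3 : euclNorm ((s.A t')ᵀ *ᵥ w) ≤ 2 * euclNorm w := by
    refine (nv_mulVec _ _).trans ?_
    rw [opn_transpose]
    have := (A_opn (s := s) t').trans i.hZ2
    have := nv_nonneg w
    gcongr
  rw [Matrix.transpose_mul, ← Matrix.mulVec_mulVec]
  have hw := nv_nonneg w
  have h0 := nv_nonneg ((s.A 0)ᵀ *ᵥ (s.Φ t')ᵀ *ᵥ w)
  refine le_of_sq2 ?_ (by positivity)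
  refine h1.trans ?_
  have h4 : euclNorm ((s.A 0)ᵀ *ᵥ (s.Φ t')ᵀ *ᵥ w) ^ 2 ≤ 16 * euclNorm w ^ 2 := by
    have : euclNorm ((s.A 0)ᵀ *ᵥ (s.Φ t')ᵀ *ᵥ w) ≤ 4 * euclNorm w := by linarith
    nlinarith
  have h5 : 3 / s.σ * euclNorm ((s.A 0)ᵀ *ᵥ (s.Φ t')ᵀ *ᵥ w) ^ 2 ≤ 3 / s.σ * (16 * euclNorm w ^ 2) := by gcongr
  have h6 : 1 + 48 / s.σ ≤ (7 / s.σ) ^ 2 := by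
    rw [div_pow]
    rw [le_div_iff₀ (by positivity)]
    have := s.hσ1
    have : (1 + 48 / s.σ) * s.σ ^ 2 = s.σ ^ 2 + 48 * s.σ := by field_simp
    rw [this]; nlinarith
  calc _ ≤ (1 + 48 / s.σ) * euclNorm w ^ 2 := by
        rw [add_mul, one_mul]
        have : 48 / s.σ * euclNorm w ^ 2 = 3 / s.σ * (16 * euclNorm w ^ 2) := by ring
        linarith
    _ ≤ (7 / s.σ) ^ 2 * euclNorm w ^ 2 := by gcongr
    _ = _ := by ring

lemma F_next (h : s.Hyp z0 s0 T) (i : ∀ t' ≤ t, s.Inv z0 s0 t') (ht : t ≤ T) :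
    ‖s.F (t + 1)‖ ≤ 1 / 10 ^ 17 * s.σ ^ 3 := by
  have hμ := s.hμ
  have hσ := s.hσ
  have hg : ∀ t' ≤ t, ‖s.Φ t' * s.Y (t+1)‖ ≤ 7 / s.σ := fun t' ht' =>
    PhiY_bd h (i t' ht') (ht'.trans ht)
      fun x => (g_next h (i t le_rfl) ht x).2 t' (by omega)
  have key : ∀ t' ≤ t + 1, ‖s.F t' * (s.Φ t' * s.Y (t+1))‖ ≤
      7 / s.σ * (101 / 100 * z0 + 73 * s.μ ^ 2 * t') := by
    intro t' ht'
    induction t' with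
    | zero =>
      have h1 : ‖s.F 0‖ ≤ z0 * (1 * (1001 / 1000)) := by
        refine opn_mul_le (by rw [opn_transpose]; exact h.hZ0)
          (opn_mul_le (J_opn (s := s)) (i 0 (Nat.zero_le _)).Gam)
      have h2 := opn_mul_le h1 (hg 0 (Nat.zero_le _))
      refine h2.trans ?_
      have h3 : 0 ≤ 7 / s.σ := by positivity
      have := h.hz0
      have h4 : 0 ≤ 7 / s.σ * z0 := by positivity
      push_cast
      linarith
    | succ u ih =>
      have hu : u ≤ t := by omega
      have hi := i u hu
      have huT := hu.trans ht
      obtain ⟨h1, h2, h3, h4⟩ := Th_inv h hi huT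
      have e : s.F (u+1) * (s.Φ (u+1) * s.Y (t+1)) = s.F u * (s.Φ u * s.Y (t+1))
          - s.μ ^ 2 • (((s.Z u)ᵀ * (s.J * (s.M u * (s.M u * s.Γ u)))) * (s.Φ u * s.Y (t+1))) := by
        rw [Φ, Matrix.mul_assoc (s.Θ u), ← Matrix.mul_assoc (s.F (u+1)), F_succ _ _ h2, Matrix.sub_mul,
          Matrix.smul_mul]
      rw [e]
      refine (norm_sub_le _ _).trans ?_
      have hZt : ‖(s.Z u)ᵀ‖ ≤ 2 := by rw [opn_transpose]; exact hi.hZ2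
      have hM := M_bd h hi huT
      have b1 := norm_mu2 (s := s) _ (opn_mul_le (opn_mul_le hZt (opn_mul_le (J_opn (s := s)) (opn_mul_le hM
        (opn_mul_le hM hi.Gam)))) (hg u hu))
      have b2 := ih (by omega)
      have h3 : 0 ≤ 7 / s.σ * s.μ ^ 2 := by positivity
      push_cast
      linarith
  have h1 := key (t+1) le_rfl
  have hYΦ : s.Y (t+1) * s.Φ (t+1) = 1 :=
    YPhi_succ s t (Th_inv h (i t le_rfl) ht).2.1 (i t le_rfl).hYΦ
  rw [mul_eq_one_comm.mp hYΦ, Matrix.mul_one] at h1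
  refine h1.trans ?_
  have h2 := h.mut ht
  have h3 := h.hz
  have h5 : s.μ ^ 2 ≤ 1 / 10 ^ 21 * s.σ ^ 4 := by
    have h6 := s.hμσ
    have h7 := mu_small (s := s)
    obtain ⟨p1, p2, p3, p4⟩ := smul_pow (s := s)
    have : s.μ * s.μ ≤ 1 / 10 ^ 20 * (1 / 10 ^ 20 * s.σ ^ 5) := by gcongr
    have : 0 ≤ s.σ ^ 4 := by positivity
    nlinarith
  have h4 : 101 / 100 * z0 + 73 * s.μ ^ 2 * ((t+1 : ℕ) : ℝ) ≤ 1 / 10 ^ 18 * s.σ ^ 4 := by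
    push_cast
    nlinarith
  calc _ ≤ 7 / s.σ * (1 / 10 ^ 18 * s.σ ^ 4) := by gcongr
    _ = 7 / 10 ^ 18 * s.σ ^ 3 := by field_simp
    _ ≤ _ := by
      have : 0 ≤ s.σ ^ 3 := by positivity
      linarith

end Dyn
end Invariants4

section Invariants5
open scoped Matrix.Norms.L2Operator
namespace Dyn
variable {ι : Type} [Fintype ι] [DecidableEq ι] {k r : ℕ} {s : Dyn ι k r}
variable {z0 s0 : ℝ} {T t : ℕ}

lemma UtMN_bd (i : s.Inv z0 s0 t) (hn0 : 0 ≤ s.nh z0 t) :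
    ‖s.Uᵀ * (s.M t * s.N t)‖ ≤
      (11 / 10 * ‖s.Z t‖ ^ 2 + k * ‖s.Z t‖ * s.nh z0 t) * s.nh z0 t := by
  have hn := i.hN
  have hρ := rho_small (s := s)
  have hρ0 := s.hρ0
  set n := s.nh z0 t
  set z := ‖s.Z t‖ with hz
  have hz0 : 0 ≤ z := norm_nonneg _
  have hD : ‖s.D t‖ ≤ s.ρ * (103 / 100 * z ^ 2) + s.ρ * k * (21 / 10 * z * n) := by
    refine (D_gen i).trans ?_
    gcongr
  have b1 := opn_mul_le (Ut_opn (s := s)) (opn_mul_le hD hn)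
  have hZt : ‖(s.Z t)ᵀ‖ ≤ z := by rw [opn_transpose]
  have b2 : ‖s.Uᵀ * (s.Z t * ((s.Z t)ᵀ * s.N t))‖ ≤ _ :=
    opn_mul_le (Ut_opn (s := s)) (opn_mul_le hz.ge (opn_mul_le hZt hn))
  have b3 : ‖s.Uᵀ * (s.J * (s.Z t * ((s.Z t)ᵀ * (s.J * s.N t))))‖ ≤ _ :=
    opn_mul_le (Ut_opn (s := s)) (opn_mul_le (J_opn (s := s)) (opn_mul_le hz.ge (opn_mul_le hZt
      (opn_mul_le (J_opn (s := s)) hn))))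
  rw [M_mul, Matrix.mul_add, Matrix.mul_sub, Matrix.mul_add, UtHN, zero_add, Matrix.mul_smul,
    Matrix.mul_smul]
  refine (norm_add_le _ _).trans ?_
  have c := norm_sub_le (s.Uᵀ * (s.D t * s.N t)) ((1/2 : ℝ) • (s.Uᵀ * (s.Z t * ((s.Z t)ᵀ * s.N t))))
  rw [norm_half] at c ⊢
  have d1 : s.ρ * (z ^ 2 * n) ≤ 1 / 10 ^ 10 * (z ^ 2 * n) := by gcongr
  have d2 : s.ρ * (k * z * n * n) ≤ 1 / 10 ^ 10 * (k * z * n * n) := by gcongr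
  have d3 : 0 ≤ z ^ 2 * n := by positivity
  have d4 : 0 ≤ k * z * n * n := by positivity
  clear_value z n
  linarith

lemma exp_le_q {x : ℝ} (hx0 : 0 ≤ x) (hx : x ≤ 1 / 100) : Real.exp (18 / 10 * x) ≤ 1 + 19 / 10 * x := by
  have h1 := Real.one_sub_le_exp_neg (18 / 10 * x)
  have h2 : Real.exp (18 / 10 * x) * Real.exp (-(18 / 10 * x)) = 1 := by
    rw [← Real.exp_add]; simp
  have h3 := Real.exp_pos (18 / 10 * x)
  have h4 : Real.exp (18 / 10 * x) * (1 - 18 / 10 * x) ≤ 1 :=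
    (mul_le_mul_of_nonneg_left h1 h3.le).trans h2.le
  have h5 : 1 ≤ (1 + 19 / 10 * x) * (1 - 18 / 10 * x) := by nlinarith
  have h6 : 0 < 1 - 18 / 10 * x := by linarith
  exact le_of_mul_le_mul_right (h4.trans h5) h6

lemma x_small : s.μ * s.σ ≤ 1 / 10 ^ 20 := by
  have := mu_small (s := s); have := s.hσ1; have := s.hσ; have := s.hμ
  nlinarith

lemma Y_opn {u : ℕ} (h : s.Hyp z0 s0 T)
    (hg1 : ∀ x, euclNorm ((s.Y u)ᵀ *ᵥ x) ^ 2 ≤ ((1 + 19 / 10 * s.μ * s.σ) ^ u)⁻¹ * euclNorm x ^ 2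
    + 3 / s.σ * euclNorm ((s.A 0)ᵀ *ᵥ x) ^ 2) :
    ‖s.Y u‖ ≤ Real.exp (-(9 / 10 * (s.μ * s.σ) * u)) + 2 / s.σ * z0 := by
  have hσ := s.hσ
  have hμ := s.hμ
  have hz0 := h.hz0
  rw [← opn_transpose]
  refine opn_le _ (by positivity) fun x => ?_
  have hx := nv_nonneg x
  refine le_of_sq2 ?_ (by positivity)
  refine (hg1 x).trans ?_
  have h1 : ((1 + 19 / 10 * s.μ * s.σ) ^ u)⁻¹ ≤ Real.exp (-(9 / 10 * (s.μ * s.σ) * u)) ^ 2 := by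
    have e : Real.exp (-(9 / 10 * (s.μ * s.σ) * u)) ^ 2 = (Real.exp (18 / 10 * (s.μ * s.σ)) ^ u)⁻¹ := by
      rw [← Real.exp_nat_mul, ← Real.exp_nat_mul, ← Real.exp_neg]
      congr 1; push_cast; ring
    rw [e]
    have := exp_le_q (x := s.μ * s.σ) (by positivity) (x_small.trans (by norm_num))
    have h2 : 1 + 19 / 10 * s.μ * s.σ = 1 + 19 / 10 * (s.μ * s.σ) := by ring
    rw [h2]
    gcongr
  have h2 : euclNorm ((s.A 0)ᵀ *ᵥ x) ^ 2 ≤ (z0 * euclNorm x) ^ 2 := by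
    have := nv_nonneg ((s.A 0)ᵀ *ᵥ x)
    gcongr
    refine (nv_mulVec _ _).trans ?_
    rw [opn_transpose]
    have := (A_opn (s := s) 0).trans h.hZ0
    gcongr
  have h3 : 3 / s.σ ≤ (2 / s.σ) ^ 2 := by
    rw [div_pow, div_le_div_iff₀ hσ (by positivity)]
    have := s.hσ1
    nlinarith
  set E := Real.exp (-(9 / 10 * (s.μ * s.σ) * u))
  have hE : 0 ≤ E := (Real.exp_pos _).le
  calc _ ≤ E ^ 2 * euclNorm x ^ 2 + (2 / s.σ) ^ 2 * (z0 * euclNorm x) ^ 2 := by gcongr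
    _ ≤ _ := by
      have : 0 ≤ E * (2 / s.σ * z0) * euclNorm x ^ 2 := by positivity
      nlinarith

lemma z_interp {z z0 σ y : ℝ} (hz : 0 ≤ z) (hz2 : z ≤ 2) (h0 : 0 < z0)
    (hze : z ≤ z0 * Real.exp (13 / 10 * y)) (hσ : 0 < σ) (hσ1 : σ ≤ 1) :
    z ^ 2 ≤ 4 * (z0 ^ (σ / 5) * Real.exp (26 / 100 * σ * y)) := by
  rcases hz.eq_or_lt with h | h
  · have : 0 ≤ 4 * (z0 ^ (σ / 5) * Real.exp (26 / 100 * σ * y)) := by positivity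
    rw [← h]; simpa using this
  have e : z ^ 2 = z ^ (2 - σ / 5) * z ^ (σ / 5) := by
    rw [← Real.rpow_add h, ← Real.rpow_natCast]; congr 1; push_cast; ring
  rw [e]
  have h1 : z ^ (2 - σ / 5) ≤ 4 := by
    calc z ^ (2 - σ / 5) ≤ 2 ^ (2 - σ / 5) := Real.rpow_le_rpow hz hz2 (by linarith)
      _ ≤ (2:ℝ) ^ (2 : ℝ) := Real.rpow_le_rpow_of_exponent_le (by norm_num) (by linarith)
      _ = 4 := by norm_num
  have h2 : z ^ (σ / 5) ≤ z0 ^ (σ / 5) * Real.exp (26 / 100 * σ * y) := by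
    calc z ^ (σ / 5) ≤ (z0 * Real.exp (13 / 10 * y)) ^ (σ / 5) := Real.rpow_le_rpow hz hze (by positivity)
      _ = _ := by
        rw [Real.mul_rpow h0.le (Real.exp_pos _).le, ← Real.exp_mul]
        congr 2; ring
  have : 0 ≤ z ^ (σ / 5) := by positivity
  exact mul_le_mul h1 h2 this (by norm_num)

set_option maxHeartbeats 1000000 in
lemma Xi_next (h : s.Hyp z0 s0 T) (i : s.Inv z0 s0 t) (ht : t ≤ T) :
    ‖s.Ξ (t + 1)‖ ≤ s.xi z0 (t + 1) := by
  have hσ := s.hσ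
  have hσ1 := s.hσ1
  have hμ := s.hμ
  have hz0 := h.hz0
  have hn0 := nh_pos (s := s) hz0 t
  have hU := UtMN_bd i hn0.le
  have hY := Y_opn (s := s) (u := t + 1) h (fun x => (g_next h i ht x).1)
  have hzi := z_interp (norm_nonneg _) i.hZ2 hz0 (y := s.μ * t) (by rw [← mul_assoc]; exact i.hZe) hσ hσ1
  have hkn := h.kn ht
  have hσ3 : s.σ ^ 3 ≤ 1 := pow_le_one₀ s.hσ.le s.hσ1
  rw [Xi_succ _ _ (Th_inv h i ht).2.1]
  refine (norm_add_le _ _).trans ?_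
  have hΞ := i.hΞ
  have b := norm_mu (s := s) _ (opn_mul_le hY hU)
  have hz2 := i.hZ2
  set z := ‖s.Z t‖
  have hzn : 0 ≤ z := norm_nonneg _
  -- name the scalars
  set x := s.μ * s.σ * t with hx
  have hx0 : 0 ≤ x := by positivity
  have hn : s.nh z0 t = z0 * Real.exp (1 / 10 ^ 7 * x) := by
    rw [nh, hx]; congr 2; ring
  set n := s.nh z0 t with hnd
  set E := Real.exp (-(1 / 2 * x)) with hE
  have hE0 : 0 < E := Real.exp_pos _
  -- bound of the first exponential piece
  have hEY : Real.exp (-(9 / 10 * (s.μ * s.σ) * ((t + 1 : ℕ) : ℝ))) ≤ Real.exp (-(9 / 10 * x)) := by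
    apply Real.exp_le_exp.mpr
    rw [hx]; push_cast
    have : 0 ≤ s.μ * s.σ := by positivity
    linarith
  set p := z0 ^ (1 + s.σ / 5) with hp
  have hp0 : 0 ≤ p := by positivity
  have hpz : p = z0 * z0 ^ (s.σ / 5) := by rw [hp, Real.rpow_add hz0, Real.rpow_one]
  have f1 : Real.exp (-(9 / 10 * x)) * (z ^ 2 * n) ≤ 4 * p * E := by
    calc _ ≤ Real.exp (-(9 / 10 * x)) * (4 * (z0 ^ (s.σ / 5) * Real.exp (26 / 100 * s.σ * (s.μ * t))) * n) := by
          gcongr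
      _ = 4 * p * (Real.exp (-(9 / 10 * x)) * (Real.exp (26 / 100 * s.σ * (s.μ * t)) * Real.exp (1 / 10 ^ 7 * x))) := by
          rw [hn, hpz]; ring
      _ ≤ 4 * p * E := by
          rw [← Real.exp_add, ← Real.exp_add]
          have : 26 / 100 * s.σ * (s.μ * t) = 26 / 100 * x := by rw [hx]; ring
          rw [this]
          have : Real.exp (-(9 / 10 * x) + (26 / 100 * x + 1 / 10 ^ 7 * x)) ≤ E := by
            rw [hE]
            apply Real.exp_le_exp.mpr; linarith
          gcongr
  have f2 : Real.exp (-(9 / 10 * x)) * (k * z * n * n) ≤ 2 * k * z0 ^ 2 * E := by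
    calc _ ≤ Real.exp (-(9 / 10 * x)) * (k * 2 * n * n) := by gcongr
      _ = 2 * k * z0 ^ 2 * (Real.exp (-(9 / 10 * x)) * (Real.exp (1 / 10 ^ 7 * x) * Real.exp (1 / 10 ^ 7 * x))) := by
          rw [hn]; ring
      _ ≤ 2 * k * z0 ^ 2 * E := by
          rw [← Real.exp_add, ← Real.exp_add]
          have : Real.exp (-(9 / 10 * x) + (1 / 10 ^ 7 * x + 1 / 10 ^ 7 * x)) ≤ E := by
            rw [hE]
            apply Real.exp_le_exp.mpr; linarith
          gcongr
  have f3 : (11 / 10 * z ^ 2 + k * z * n) * n ≤ 5 * n := by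
    have g1 : z ^ 2 ≤ 4 := by nlinarith
    have g2 : k * z * n ≤ 1 / 10 := by
      have : z * (k * n) ≤ 2 * (1 / 10 ^ 10 * s.σ ^ 3) := by gcongr
      have e : k * z * n = z * (k * n) := by ring
      rw [e]; linarith
    gcongr; linarith
  have f4 : s.μ * ((Real.exp (-(9 / 10 * (s.μ * s.σ) * ((t + 1 : ℕ) : ℝ))) + 2 / s.σ * z0) *
      ((11 / 10 * z ^ 2 + k * z * n) * n)) ≤
      s.μ * ((5 * p + 6 * k * z0 ^ 2) * E + 10 / s.σ * z0 * n) := by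
    have g0 : 0 ≤ (11 / 10 * z ^ 2 + k * z * n) * n := by positivity
    have g1 : Real.exp (-(9 / 10 * (s.μ * s.σ) * ((t + 1 : ℕ) : ℝ))) * ((11 / 10 * z ^ 2 + k * z * n) * n)
        ≤ Real.exp (-(9 / 10 * x)) * ((11 / 10 * z ^ 2 + k * z * n) * n) := by gcongr
    have g2 : 2 / s.σ * z0 * ((11 / 10 * z ^ 2 + k * z * n) * n) ≤ 2 / s.σ * z0 * (5 * n) := by gcongr
    have g3 : 0 ≤ p * E := by positivity
    have g4 : 0 ≤ (k : ℝ) * z0 ^ 2 * E := by positivity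
    have g5 : 2 / s.σ * z0 * (5 * n) = 10 / s.σ * z0 * n := by ring
    gcongr
    rw [add_mul]
    have g6 : Real.exp (-(9 / 10 * x)) * ((11 / 10 * z ^ 2 + k * z * n) * n) =
       11 / 10 * (Real.exp (-(9 / 10 * x)) * (z ^ 2 * n)) + Real.exp (-(9 / 10 * x)) * (k * z * n * n) := by ring
    have g7 : (5 * p + 6 * k * z0 ^ 2) * E = 5 * (p * E) + 6 * (k * z0 ^ 2 * E) := by ring
    rw [g7]
    linarith
  -- the increment of the envelope
  have f5 : s.xi z0 t + s.μ * ((5 * p + 6 * k * z0 ^ 2) * E + 10 / s.σ * z0 * n) ≤ s.xi z0 (t + 1) := by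
    have hs := nh_succ (s := s) hz0 t
    rw [← hnd] at hs
    have e1 : Real.exp (-(1 / 2 * s.σ * s.μ * t)) = E := by rw [hE, hx]; congr 1; ring
    have e2 : Real.exp (-(1 / 2 * s.σ * s.μ * ((t + 1 : ℕ) : ℝ))) = E * Real.exp (-(1 / 2 * (s.μ * s.σ))) := by
      rw [hE, ← Real.exp_add, hx]; congr 1; push_cast; ring
    have e3 : Real.exp (-(1 / 2 * (s.μ * s.σ))) ≤ 1 - 4 / 10 * (s.μ * s.σ) := by
      set u := s.μ * s.σ with hu
      have hu0 : 0 < u := by positivity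
      have hu1 : u ≤ 1 / 10 ^ 20 := x_small
      have h1 := Real.add_one_le_exp (1 / 2 * u)
      have h2 : Real.exp (1 / 2 * u) * Real.exp (-(1 / 2 * u)) = 1 := by rw [← Real.exp_add]; simp
      have h3 := Real.exp_pos (-(1 / 2 * u))
      have h4 : (1 / 2 * u + 1) * Real.exp (-(1 / 2 * u)) ≤ 1 :=
        (mul_le_mul_of_nonneg_right h1 h3.le).trans h2.le
      have h5 : 1 ≤ (1 / 2 * u + 1) * (1 - 4 / 10 * u) := by nlinarith
      exact le_of_mul_le_mul_left (h4.trans h5) (by positivity)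
    unfold xi
    rw [e1, e2, ← hp, ← hnd]
    set c1 := 5 * p + 6 * k * z0 ^ 2
    have hc1 : 0 ≤ c1 := by positivity
    have j1 : c1 / (4 / 10 * s.σ) * (E * Real.exp (-(1 / 2 * (s.μ * s.σ)))) ≤
        c1 / (4 / 10 * s.σ) * (E * (1 - 4 / 10 * (s.μ * s.σ))) := by gcongr
    have j2 : c1 / (4 / 10 * s.σ) * (E * (1 - 4 / 10 * (s.μ * s.σ))) =
       c1 / (4 / 10 * s.σ) * E - s.μ * (c1 * E) := by field_simp
    have j3 : 10 / s.σ * z0 / (1 / 10 ^ 7 * s.σ) * (n * (1 + 1 / 10 ^ 7 * s.σ * s.μ)) ≤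
       10 / s.σ * z0 / (1 / 10 ^ 7 * s.σ) * s.nh z0 (t + 1) := by gcongr
    have j4 : 10 / s.σ * z0 / (1 / 10 ^ 7 * s.σ) * (n * (1 + 1 / 10 ^ 7 * s.σ * s.μ)) =
      10 / s.σ * z0 / (1 / 10 ^ 7 * s.σ) * n + s.μ * (10 / s.σ * z0 * n) := by field_simp
    rw [mul_sub, mul_sub, mul_sub, mul_sub, mul_add]
    linarith
  linarith

lemma inv_zero (h : s.Hyp z0 s0 T) : s.Inv z0 s0 0 := by
  have hz0 := h.hz0
  have hσ := s.hσ
  have hzs := h.zs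
  have hK : s.K 0 = 0 := rfl
  have hG : s.Γ 0 = s.U := by rw [Γ, hK, add_zero]
  have hN0 : s.N 0 = s.Pc * s.Z 0 := by
    rw [N, hG, A, Pc, Matrix.sub_mul, Matrix.one_mul, Matrix.mul_assoc]
  have hZt : ‖(s.Z 0)ᵀ‖ ≤ z0 := by rw [opn_transpose]; exact h.hZ0
  have hN : ‖s.N 0‖ ≤ z0 := by
    rw [hN0]
    have := opn_mul_le (Pc_opn (s := s)) h.hZ0
    linarith
  refine ⟨?_, ?_, ?_, ?_, ?_, ?_, ?_, ?_, ?_, ?_, ?_⟩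
  · have := h.hZ0; linarith
  · simpa using h.hZ0
  · have := opn_mul_le hZt (opn_mul_le (J_opn (s := s)) h.hZ0)
    rw [B]; push_cast; linarith
  · rw [hK, norm_zero]; positivity
  · rw [nh_zero]; exact hN
  · have := opn_mul_le hZt (opn_mul_le (J_opn (s := s)) hN)
    rw [W, nh_zero]; linarith
  · have := opn_mul_le hZt (opn_mul_le (J_opn (s := s)) (U_opn (s := s)))
    rw [F, hG]
    obtain ⟨p1, p2, p3, p4⟩ := smul_pow (s := s)
    have := h.hz
    have : 0 ≤ s.σ ^ 3 := by positivity
    linarith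
  · have : s.Ξ 0 = 0 := by rw [Ξ, Y, Matrix.one_mul, sub_self]
    rw [this, norm_zero, xi, nh_zero]; simp
  · simp [Y, Φ]
  · intro x
    have : 0 ≤ 3 / s.σ * euclNorm ((s.A 0)ᵀ *ᵥ x) ^ 2 := by positivity
    simpa [Y] using this
  · intro t' ht' x
    have : t' = 0 := by omega
    subst this
    have : 0 ≤ 3 / s.σ * euclNorm ((s.A 0)ᵀ *ᵥ x) ^ 2 := by positivity
    linarith

lemma inv_all (h : s.Hyp z0 s0 T) : ∀ t, t ≤ T → ∀ t' ≤ t, s.Inv z0 s0 t' := by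
  intro t
  induction t with
  | zero =>
    intro _ t' ht'
    have : t' = 0 := by omega
    subst this; exact inv_zero h
  | succ t ih =>
    intro hT t' ht'
    have ih' := ih (by omega)
    rcases Nat.lt_or_ge t t' with hlt | hge
    swap
    · exact ih' t' hge
    have : t' = t + 1 := by omega
    subst this
    have ht : t ≤ T := by omega
    have i := ih' t le_rfl
    have hF := F_next h ih' ht
    refine ⟨(Z_next h i ht).1, ?_, B_next h i ht, (K_next h i ht).1, N_next h i ht, W_next h i ht hF, hF,
      Xi_next h i ht, YPhi_succ s t (Th_inv h i ht).2.1 i.hYΦ, fun x => (g_next h i ht x).1,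
      fun t' ht' x => (g_next h i ht x).2 t' ht'⟩
    refine (Z_next h i ht).2.trans ?_
    have h1 := i.hZe
    have hμ := s.hμ
    have hz0 := h.hz0
    have h2 := Real.add_one_le_exp (13 / 10 * s.μ)
    calc _ ≤ z0 * Real.exp (13 / 10 * s.μ * t) * Real.exp (13 / 10 * s.μ) := by
          gcongr; linarith
      _ = _ := by rw [mul_assoc, ← Real.exp_add]; congr 2; push_cast; ring

/-- lower bound for the signal at late times -/
lemma late (h : s.Hyp z0 s0 T) (ht : t ≤ T)
    (hl : ((1 + 19 / 10 * s.μ * s.σ) ^ t)⁻¹ ≤ s0 ^ 2 / s.σ) (w : Fin r → ℝ) :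
    s.σ * euclNorm w ^ 2 ≤ 16 * euclNorm ((s.A t)ᵀ *ᵥ w) ^ 2 := by
  have i := inv_all h T le_rfl t ht
  have hσ := s.hσ
  have hinv : s.Φ t * s.Y t = 1 := mul_eq_one_comm.mp i.hYΦ
  set x := (s.Φ t)ᵀ *ᵥ w with hx
  have e1 : (s.Y t)ᵀ *ᵥ x = w := by
    rw [hx, Matrix.mulVec_mulVec, ← Matrix.transpose_mul, hinv, Matrix.transpose_one, Matrix.one_mulVec]
  have h1 := i.hg1 x
  have h2 := (AY_bd h i ht x).2
  rw [e1] at h1 h2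
  have h3 := h.hA0 x
  have h4 := nv_nonneg x
  have h5 := h.hs0
  have h6 : (s0 * euclNorm x) ^ 2 ≤ euclNorm ((s.A 0)ᵀ *ᵥ x) ^ 2 := by gcongr
  have h7 : ((1 + 19 / 10 * s.μ * s.σ) ^ t)⁻¹ * euclNorm x ^ 2 ≤ s0 ^ 2 / s.σ * euclNorm x ^ 2 := by gcongr
  have h8 : s0 ^ 2 / s.σ * euclNorm x ^ 2 = 1 / s.σ * (s0 * euclNorm x) ^ 2 := by ring
  have h9 : 1 / s.σ * (s0 * euclNorm x) ^ 2 ≤ 1 / s.σ * euclNorm ((s.A 0)ᵀ *ᵥ x) ^ 2 := by gcongr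
  have h10 : euclNorm w ^ 2 ≤ 4 / s.σ * euclNorm ((s.A 0)ᵀ *ᵥ x) ^ 2 := by
    have : 4 / s.σ * euclNorm ((s.A 0)ᵀ *ᵥ x) ^ 2 = 1 / s.σ * euclNorm ((s.A 0)ᵀ *ᵥ x) ^ 2 + 3 / s.σ * euclNorm ((s.A 0)ᵀ *ᵥ x) ^ 2 := by ring
    linarith
  have h11 : euclNorm ((s.A 0)ᵀ *ᵥ x) ^ 2 ≤ (2 * euclNorm ((s.A t)ᵀ *ᵥ w)) ^ 2 := by
    have := nv_nonneg ((s.A 0)ᵀ *ᵥ x)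
    gcongr
  calc s.σ * euclNorm w ^ 2 ≤ s.σ * (4 / s.σ * euclNorm ((s.A 0)ᵀ *ᵥ x) ^ 2) := by gcongr
    _ = 4 * euclNorm ((s.A 0)ᵀ *ᵥ x) ^ 2 := by field_simp
    _ ≤ _ := by linarith

end Dyn
end Invariants5

section Final
open scoped Matrix.Norms.L2Operator
variable {n₁ n₂ m k r : ℕ}

lemma opn_le_symMat (X : Matrix (Fin n₁) (Fin n₂) ℝ) : ‖X‖ ≤ ‖symMat X‖ := by
  refine opn_le _ (norm_nonneg _) fun v => ?_
  have h := nv_mulVec (symMat X) (Sum.elim 0 v)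
  have e1 : (symMat X *ᵥ (Sum.elim 0 v)) ∘ Sum.inl = X *ᵥ v := by
    rw [symMat, Matrix.fromBlocks_mulVec]; simp
  have e2 : euclNorm (Sum.elim (0 : Fin n₁ → ℝ) v) = euclNorm v := by
    simp [euclNorm, Fintype.sum_sum_type]
  rw [e2] at h
  refine le_trans (le_of_sq2 ?_ (nv_nonneg _)) h
  rw [nv_sum_sq (symMat X *ᵥ _), e1]
  nlinarith [sq_nonneg (euclNorm ((symMat X *ᵥ (Sum.elim 0 v)) ∘ Sum.inr))]

set_option maxHeartbeats 1000000 in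
/-- one step of gradient descent on the factorized loss -/
lemma descent (E Q G : Matrix (Fin n₁) (Fin n₂) ℝ) (V : Matrix (Fin n₁) (Fin k) ℝ)
    (W : Matrix (Fin n₂) (Fin k) ℝ) (X : Matrix (Fin n₁) (Fin n₂) ℝ) (hE : E = V * Wᵀ - X)
    (hG : G = E + Q) (hV : ‖V‖ ≤ 2) (hW : ‖W‖ ≤ 2) (hGn : ‖G‖ ≤ 6) {μ : ℝ} (hμ : 0 ≤ μ)
    (hμ1 : μ ≤ 1 / 10 ^ 20) :
    frobNorm ((V - μ • (G * W)) * (W - μ • (Gᵀ * V))ᵀ - X) ^ 2 ≤ frobNorm E ^ 2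
      - μ * (frobNorm (E * W) ^ 2 + frobNorm (Vᵀ * E) ^ 2)
      + 2 * μ * (frobNorm (Q * W) ^ 2 + frobNorm (Vᵀ * Q) ^ 2) + 310 * μ ^ 2 * frobNorm E ^ 2 := by
  set S := G * W * Wᵀ + V * (Vᵀ * G) with hS
  set R := G * W * (Vᵀ * G) with hR
  have e0 : (V - μ • (G * W)) * (W - μ • (Gᵀ * V))ᵀ - X = E - (μ • S - (μ ^ 2) • R) := by
    rw [hE, hS, hR]
    simp only [Matrix.transpose_sub, Matrix.transpose_smul, Matrix.transpose_mul,
      Matrix.transpose_transpose, Matrix.sub_mul, Matrix.mul_sub, Matrix.smul_mul, Matrix.mul_smul,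
      Matrix.mul_assoc, smul_add, smul_sub, smul_smul, sq]
    abel
  have key : frobNorm (E - (μ • S - (μ ^ 2) • R)) ^ 2 = frobNorm E ^ 2 - 2 * μ * minner E S
      + 2 * μ ^ 2 * minner E R + frobNorm (μ • S - (μ ^ 2) • R) ^ 2 := by
    rw [fro_sq, fro_sq, minner_sub_left, minner_sub_right, minner_comm (μ • S - μ ^ 2 • R) (E - _),
      minner_sub_left, minner_sub_right E, minner_smul_right, minner_smul_right, fro_sq]
    ring
  have eS : minner E S = minner (E * W) (G * W) + minner (Vᵀ * E) (Vᵀ * G) := by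
    have x1 : minner (E * W) (G * W) = minner E (G * W * Wᵀ) := minner_mul_right _ _ _
    have x2 : minner (Vᵀ * E) (Vᵀ * G) = minner E (V * (Vᵀ * G)) := by
      rw [minner_mul_left, Matrix.transpose_transpose]
    rw [hS, minner_add_right, x1, x2]
  have p1 : G * W = E * W + Q * W := by rw [hG, Matrix.add_mul]
  have p2 : Vᵀ * G = Vᵀ * E + Vᵀ * Q := by rw [hG, Matrix.mul_add]
  have q1 := minner_abs_le (E * W) (Q * W)
  have q2 := minner_abs_le (Vᵀ * E) (Vᵀ * Q)
  rw [p1, p2, minner_add_right (E * W), minner_add_right (Vᵀ * E), ← fro_sq, ← fro_sq] at eS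
  have r1 : frobNorm (G * W) ≤ frobNorm (E * W) + frobNorm (Q * W) := by rw [p1]; exact fro_add _ _
  have r2 : frobNorm (Vᵀ * G) ≤ frobNorm (Vᵀ * E) + frobNorm (Vᵀ * Q) := by rw [p2]; exact fro_add _ _
  set e := frobNorm E
  set a := frobNorm (E * W)
  set b := frobNorm (Vᵀ * E)
  set p := frobNorm (Q * W)
  set p' := frobNorm (Vᵀ * Q)
  have he : 0 ≤ e := fro_nonneg _
  have ha : 0 ≤ a := fro_nonneg _
  have hb : 0 ≤ b := fro_nonneg _
  have hp : 0 ≤ p := fro_nonneg _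
  have hp' : 0 ≤ p' := fro_nonneg _
  have ha2 : a ≤ e * 2 := (fro_mul_right E W).trans (by gcongr)
  have hb2 : b ≤ 2 * e := (fro_mul_left Vᵀ E).trans (by rw [opn_transpose]; gcongr)
  have s1 : frobNorm S ≤ (a + p) * 2 + 2 * (b + p') := by
    rw [hS]
    refine (fro_add _ _).trans (add_le_add ?_ ?_)
    · refine (fro_mul_right _ _).trans ?_
      rw [opn_transpose]; gcongr
    · refine (fro_mul_left _ _).trans ?_
      have := fro_nonneg (Vᵀ * G)
      gcongr
  have s2 : frobNorm R ≤ (a + p) * (2 * 6) := by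
    refine (fro_mul_right _ _).trans ?_
    refine mul_le_mul r1 (opn_mul_le (by rwa [opn_transpose]) hGn) (norm_nonneg _) (by positivity)
  have s3 : minner E R ≤ e * ((a + p) * (2 * 6)) :=
    (le_abs_self _).trans ((minner_abs_le _ _).trans (by gcongr))
  have s4 : frobNorm (μ • S - (μ ^ 2) • R) ≤ μ * ((a + p) * 2 + 2 * (b + p') + 1 / 100 * (a + p)) := by
    refine (fro_sub _ _).trans ?_
    rw [fro_smul, fro_smul, abs_of_nonneg hμ, abs_of_nonneg (by positivity : 0 ≤ μ ^ 2)]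
    have : μ ^ 2 * frobNorm R ≤ μ ^ 2 * ((a + p) * (2 * 6)) := by gcongr
    have h2 : μ * frobNorm S ≤ μ * ((a + p) * 2 + 2 * (b + p')) := by gcongr
    have h3 : μ ^ 2 * ((a + p) * (2 * 6)) ≤ μ * (1 / 100 * (a + p)) := by
      have : μ * (μ * ((a + p) * (2 * 6))) ≤ μ * (1 / 10 ^ 20 * ((a + p) * (2 * 6))) := by gcongr
      have h5 : 0 ≤ μ * (a + p) := by positivity
      have e1 : μ * (μ * ((a + p) * (2 * 6))) = μ ^ 2 * ((a + p) * (2 * 6)) := by ring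
      have e2 : μ * (1 / 10 ^ 20 * ((a + p) * (2 * 6))) = 12 / 10 ^ 20 * (μ * (a + p)) := by ring
      have e3 : μ * (1 / 100 * (a + p)) = 1 / 100 * (μ * (a + p)) := by ring
      rw [e3, ← e1]
      linarith
    rw [mul_add μ _ (1 / 100 * (a + p))]
    linarith
  have s5 : frobNorm (μ • S - (μ ^ 2) • R) ^ 2 ≤ (μ * (9 * e + 3 * p + 3 * p')) ^ 2 := by
    have := fro_nonneg (μ • S - (μ ^ 2) • R)
    have h1 : μ * ((a + p) * 2 + 2 * (b + p') + 1 / 100 * (a + p)) ≤ μ * (9 * e + 3 * p + 3 * p') := by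
      apply mul_le_mul_of_nonneg_left _ hμ
      linarith
    have := s4.trans h1
    gcongr
  have s6 : 2 * μ ^ 2 * minner E R ≤ μ ^ 2 * (60 * e ^ 2 + 12 * p ^ 2) := by
    have h1 : 2 * minner E R ≤ 60 * e ^ 2 + 12 * p ^ 2 := by
      have x1 := mul_le_mul_of_nonneg_left ha2 he
      have x2 : 24 * (e * p) ≤ 12 * e ^ 2 + 12 * p ^ 2 := by linarith [sq_nonneg (e - p), sub_sq e p]
      have x3 : e * ((a + p) * (2 * 6)) = 12 * (e * a) + 12 * (e * p) := by ring
      have x4 : e * (e * 2) = 2 * e ^ 2 := by ring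
      linarith
    have : 0 ≤ μ ^ 2 := by positivity
    calc _ = μ ^ 2 * (2 * minner E R) := by ring
      _ ≤ _ := by gcongr
  have s7 : (9 * e + 3 * p + 3 * p') ^ 2 ≤ 243 * e ^ 2 + 27 * p ^ 2 + 27 * p' ^ 2 := by
    nlinarith [sq_nonneg (9 * e - 3 * p), sq_nonneg (9 * e - 3 * p'), sq_nonneg (3 * p - 3 * p')]
  have s8 : (μ * (9 * e + 3 * p + 3 * p')) ^ 2 ≤ μ ^ 2 * (243 * e ^ 2 + 27 * p ^ 2 + 27 * p' ^ 2) := by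
    rw [mul_pow]; gcongr
  have s9 : - (2 * μ * minner E S) ≤ μ * (- a ^ 2 - b ^ 2 + p ^ 2 + p' ^ 2) := by
    have h1 := (abs_le.1 q1).1
    have h2 := (abs_le.1 q2).1
    have : -(2 * minner E S) ≤ - a ^ 2 - b ^ 2 + p ^ 2 + p' ^ 2 := by
      rw [eS]; linarith [sq_nonneg (a - p), sq_nonneg (b - p'), sub_sq a p, sub_sq b p']
    calc _ = μ * (-(2 * minner E S)) := by ring
      _ ≤ _ := by gcongr
  have s10 : μ ^ 2 * (50 * (p ^ 2 + p' ^ 2)) ≤ μ * (p ^ 2 + p' ^ 2) := by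
    have : μ * (μ * (50 * (p ^ 2 + p' ^ 2))) ≤ μ * (1 / 10 ^ 20 * (50 * (p ^ 2 + p' ^ 2))) := by gcongr
    have h5 : 0 ≤ μ * (p ^ 2 + p' ^ 2) := by positivity
    calc _ = μ * (μ * (50 * (p ^ 2 + p' ^ 2))) := by ring
      _ ≤ 50 / 10 ^ 20 * (μ * (p ^ 2 + p' ^ 2)) := by linarith
      _ ≤ _ := by linarith
  rw [e0, key]
  have : 0 ≤ μ ^ 2 * e ^ 2 := by positivity
  have : 0 ≤ μ ^ 2 * p' ^ 2 := by positivity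
  have : 0 ≤ μ ^ 2 * p ^ 2 := by positivity
  nlinarith

/-- transposed measurements -/
lemma Qop_transpose (A : Fin m → Matrix (Fin n₁) (Fin n₂) ℝ) (Z : Matrix (Fin n₁) (Fin n₂) ℝ) :
    Qop (fun i => (A i)ᵀ) Zᵀ = (Qop A Z)ᵀ := by
  have h : ∀ i, minner (A i)ᵀ Zᵀ = minner (A i) Z := fun i => by
    rw [minner, minner, Finset.sum_comm]; rfl
  simp only [Qop, AstarA, h, Matrix.transpose_sub, Matrix.transpose_sum, Matrix.transpose_smul]

lemma rip_transpose (A : Fin m → Matrix (Fin n₁) (Fin n₂) ℝ) {s : ℕ} {δ : ℝ} (hA : HasRIP A s δ) :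
    HasRIP (fun i => (A i)ᵀ) s δ := by
  intro M hM
  have h := hA Mᵀ (by rwa [Matrix.rank_transpose])
  have e : ∀ i, calA (fun i => (A i)ᵀ) M i = calA A Mᵀ i := fun i => by
    rw [calA, calA, minner, minner, Finset.sum_comm]; rfl
  simp only [e]
  rwa [fro_transpose] at h

/-- action of the RIP error on the factor -/
lemma QW_bd (A : Fin m → Matrix (Fin n₁) (Fin n₂) ℝ) {δ : ℝ} (hδ : 0 ≤ δ) (hr : 1 ≤ r)
    (hA : HasRIP A (2 * r + 1) δ) (X : Matrix (Fin n₁) (Fin n₂) ℝ) (hX : X.rank = r)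
    (V N₁ : Matrix (Fin n₁) (Fin k) ℝ) (W N₂ : Matrix (Fin n₂) (Fin k) ℝ)
    (Γ₁ : Matrix (Fin n₁) (Fin r) ℝ) (Γ₂ : Matrix (Fin n₂) (Fin r) ℝ) (S : Matrix (Fin r) (Fin k) ℝ)
    (hV : V = Γ₁ * S + N₁) (hW : W = Γ₂ * S + N₂) (hVn : ‖V‖ ≤ 2) (hWn : ‖W‖ ≤ 2) {n : ℝ}
    (h1 : ‖N₁‖ ≤ n) (h2 : ‖N₂‖ ≤ n) (hk : 1 ≤ k) (hkn : k * n ≤ 1 / 10 ^ 10) :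
    frobNorm (Qop A (V * Wᵀ - X) * W) ≤ 3 * δ * frobNorm (V * Wᵀ - X) + 30 * δ * (k * Real.sqrt k * n) ∧
    frobNorm (V * Wᵀ - X - (Γ₁ * S * (Γ₂ * S)ᵀ - X)) ≤ 5 * (Real.sqrt k * n) := by
  have hn0 : 0 ≤ n := (norm_nonneg _).trans h1
  have hk1 : (1 : ℝ) ≤ k := by exact_mod_cast hk
  have hsk : Real.sqrt k ≤ k := by
    rw [Real.sqrt_le_left (by positivity)]; nlinarith
  have hsk0 := Real.sqrt_nonneg (k : ℝ)
  have hsn : Real.sqrt k * n ≤ 1 / 10 ^ 10 := le_trans (by gcongr) hkn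
  have hn : n ≤ 1 / 10 ^ 10 := le_trans (by nlinarith) hkn
  set Vs := Γ₁ * S with hVs
  set Ws := Γ₂ * S with hWs
  have hVs' : Vs = V - N₁ := by rw [hV]; abel
  have hWs' : Ws = W - N₂ := by rw [hW]; abel
  have hVsn : ‖Vs‖ ≤ 21 / 10 := by rw [hVs']; have := norm_sub_le V N₁; linarith
  have hWsn : ‖Ws‖ ≤ 21 / 10 := by rw [hWs']; have := norm_sub_le W N₂; linarith
  set Es := Vs * Wsᵀ - X with hEs
  have hE : V * Wᵀ - X = Es + (V * N₂ᵀ + N₁ * Wsᵀ) := by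
    have : Wᵀ = Wsᵀ + N₂ᵀ := by rw [← Matrix.transpose_add, hW]
    rw [hEs, this, Matrix.mul_add]
    nth_rw 1 [hV]
    rw [Matrix.add_mul]
    abel
  have hd : frobNorm (V * N₂ᵀ + N₁ * Wsᵀ) ≤ 5 * (Real.sqrt k * n) := by
    refine (fro_add _ _).trans ?_
    have a1 := fro_mul_inner V N₂ᵀ
    have a2 := fro_mul_inner N₁ Wsᵀ
    rw [opn_transpose, Fintype.card_fin] at a1 a2
    have b1 : Real.sqrt k * ‖V‖ * ‖N₂‖ ≤ Real.sqrt k * 2 * n := by gcongr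
    have b2 : Real.sqrt k * ‖N₁‖ * ‖Ws‖ ≤ Real.sqrt k * n * (21 / 10) := by gcongr
    have : 0 ≤ Real.sqrt k * n := by positivity
    linarith
  refine ⟨?_, by rw [hE, add_sub_cancel_left]; exact hd⟩
  set En := V * N₂ᵀ + N₁ * Wsᵀ with hEn
  have hes : frobNorm Es ≤ frobNorm (V * Wᵀ - X) + 5 * (Real.sqrt k * n) := by
    have : Es = (V * Wᵀ - X) - En := by rw [hE]; abel
    rw [this]
    exact (fro_sub _ _).trans (by linarith)
  have hrk : Es.rank ≤ 2 * r := by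
    rw [hEs]
    refine (rank_sub_le' _ _).trans ?_
    have : (Vs * Wsᵀ).rank ≤ r := by
      rw [hVs, Matrix.mul_assoc]
      exact (Matrix.rank_mul_le_left _ _).trans ((Matrix.rank_le_card_width _).trans (by simp))
    omega
  have e1 : Qop A (V * Wᵀ - X) * W = Qop A Es * Ws + Qop A Es * N₂ + Qop A En * W := by
    rw [hE, Qop_add, Matrix.add_mul, ← Matrix.mul_add, ← hW]
  -- the main term
  have m1 : frobNorm (Qop A Es * Ws) ≤ δ * frobNorm Es * (21 / 10) := by
    set Y := Qop A Es * Ws with hY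
    have h3 := rip_polar A (s := 2 * r + 1) hA Es (Y * Wsᵀ) fun t => by
      have e : Es + t • (Y * Wsᵀ) = (Vs + t • Y) * Wsᵀ - X := by
        rw [hEs, Matrix.add_mul, Matrix.smul_mul]; abel
      rw [e]
      refine (rank_sub_le' _ _).trans ?_
      have : ((Vs + t • Y) * Wsᵀ).rank ≤ r := by
        rw [hWs, Matrix.transpose_mul, ← Matrix.mul_assoc]
        exact (Matrix.rank_mul_le_right _ _).trans ((Matrix.rank_le_card_height _).trans (by simp))
      omega
    have h4 : minner (Qop A Es) (Y * Wsᵀ) = frobNorm Y ^ 2 := by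
      rw [fro_sq, ← minner_mul_right]
    rw [h4, abs_of_nonneg (sq_nonneg _)] at h3
    have h5 : frobNorm (Y * Wsᵀ) ≤ frobNorm Y * (21 / 10) := by
      refine (fro_mul_right _ _).trans ?_
      rw [opn_transpose]
      have := fro_nonneg Y
      gcongr
    have h6 := fro_nonneg Es
    have h7 := fro_nonneg Y
    have h8 : frobNorm Y ^ 2 ≤ δ * frobNorm Es * (frobNorm Y * (21 / 10)) := h3.trans (by gcongr)
    rcases h7.eq_or_lt with h9 | h9
    · rw [← h9]; positivity
    · refine le_of_mul_le_mul_right ?_ h9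
      nlinarith
  have m2 : frobNorm (Qop A Es * N₂) ≤ δ * frobNorm Es * (1 / 10 ^ 10) := by
    have a1 := fro_le_cols (Qop A Es * N₂)
    rw [Fintype.card_fin] at a1
    have a2 := opn_mul_le (Qop_opn A hδ hA Es hrk) h2
    have h6 := fro_nonneg Es
    calc _ ≤ _ := a1
      _ ≤ Real.sqrt k * (δ * frobNorm Es * n) := by gcongr
      _ = δ * frobNorm Es * (Real.sqrt k * n) := by ring
      _ ≤ _ := by gcongr
  have m3 : frobNorm (Qop A En * W) ≤ 10 * δ * (k * Real.sqrt k * n) := by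
    have a1 := fro_le_cols (Qop A En * W)
    rw [Fintype.card_fin] at a1
    have b1 := Qop_opn_prod A hδ (by omega : 1 ≤ 2 * r) hA V N₂
    have b2 := Qop_opn_prod A hδ (by omega : 1 ≤ 2 * r) hA N₁ Ws
    have a2 : ‖Qop A En‖ ≤ δ * (k * (5 * n)) := by
      rw [hEn, Qop_add]
      refine (norm_add_le _ _).trans ?_
      have c1 : δ * (k * (‖V‖ * ‖N₂‖)) ≤ δ * (k * (2 * n)) := by gcongr
      have c2 : δ * (k * (‖N₁‖ * ‖Ws‖)) ≤ δ * (k * (n * (21/10))) := by gcongr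
      have : 0 ≤ δ * (k * n) := by positivity
      nlinarith
    have a3 := opn_mul_le a2 hWn
    calc _ ≤ _ := a1
      _ ≤ Real.sqrt k * (δ * (k * (5 * n)) * 2) := by gcongr
      _ = _ := by ring
  rw [e1]
  refine (fro_add _ _).trans ?_
  have := fro_add (Qop A Es * Ws) (Qop A Es * N₂)
  have h6 := fro_nonneg Es
  have c1 : δ * frobNorm Es ≤ δ * (frobNorm (V * Wᵀ - X) + 5 * (Real.sqrt k * n)) := by gcongr
  have c2 : δ * (Real.sqrt k * n) ≤ δ * (k * Real.sqrt k * n) := by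
    gcongr; nlinarith
  have c3 : 0 ≤ δ * frobNorm (V * Wᵀ - X) := mul_nonneg hδ (fro_nonneg _)
  have c4 : 0 ≤ δ * (Real.sqrt k * n) := by positivity
  nlinarith

end Final

section Final2
open scoped Matrix.Norms.L2Operator
variable {n₁ n₂ m k r : ℕ}

/-- if `B = D X` has rank at least that of `X` then `B` and `X` have the same kernel -/
lemma ker_factor (X : Matrix (Fin n₁) (Fin n₂) ℝ) (hX : X.rank = r) (D : Matrix (Fin r) (Fin n₁) ℝ)
    (Γ : Matrix (Fin n₂) (Fin r) ℝ) (C : Matrix (Fin r) (Fin r) ℝ) (h : D * X * Γ * C = 1)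
    (Y : Matrix (Fin n₂) (Fin n₂) ℝ) (hY : D * X * Y = 0) : X * Y = 0 := by
  have h1 : (D * X).rank = r := by
    refine le_antisymm ((Matrix.rank_le_card_height _).trans (by simp)) ?_
    have : (D * X * Γ * C).rank ≤ (D * X).rank :=
      (Matrix.rank_mul_le_left _ _).trans (Matrix.rank_mul_le_left _ _)
    rw [h, Matrix.rank_one, Fintype.card_fin] at this
    exact this
  have hle : LinearMap.ker X.mulVecLin ≤ LinearMap.ker (D * X).mulVecLin := by
    intro v hv
    rw [LinearMap.mem_ker, Matrix.mulVecLin_apply] at hv ⊢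
    rw [← Matrix.mulVec_mulVec, hv, Matrix.mulVec_zero]
  have e1 := LinearMap.finrank_range_add_finrank_ker X.mulVecLin
  have e2 := LinearMap.finrank_range_add_finrank_ker (D * X).mulVecLin
  have heq : LinearMap.ker X.mulVecLin = LinearMap.ker (D * X).mulVecLin := by
    refine Submodule.eq_of_le_of_finrank_eq hle ?_
    rw [Matrix.rank] at h1 hX
    omega
  ext i j
  have h3 : (fun a => Y a j) ∈ LinearMap.ker (D * X).mulVecLin := by
    rw [LinearMap.mem_ker, Matrix.mulVecLin_apply]
    ext a
    exact congrFun (congrFun hY a) j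
  rw [← heq, LinearMap.mem_ker, Matrix.mulVecLin_apply] at h3
  exact congrFun h3 i

/-- an almost isometric matrix -/
lemma half_inv (G : Matrix (Fin r) (Fin r) ℝ) (h : ‖G - (1/2 : ℝ) • 1‖ ≤ 1 / 4) :
    ∃ G' : Matrix (Fin r) (Fin r) ℝ, G * G' = 1 ∧ G' * G = 1 ∧ ‖G'‖ ≤ 4 := by
  have e : G = (1/2 : ℝ) • (1 + (2:ℝ) • (G - (1/2 : ℝ) • 1)) := by
    rw [smul_add, smul_smul]; norm_num
  set Q := (2:ℝ) • (G - (1/2 : ℝ) • (1 : Matrix (Fin r) (Fin r) ℝ)) with hQ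
  have hQn : ‖Q‖ ≤ 1 / 2 := by
    rw [hQ, norm_smul, Real.norm_eq_abs]; norm_num; linarith
  obtain ⟨i1, i2, i3, -⟩ := inv_one_add Q hQn
  refine ⟨(2 : ℝ) • (1 + Q)⁻¹, ?_, ?_, ?_⟩
  · rw [e, Matrix.smul_mul, Matrix.mul_smul, smul_smul, i1]; norm_num
  · rw [e, Matrix.smul_mul, Matrix.mul_smul, smul_smul, i2]; norm_num
  · rw [norm_smul, Real.norm_eq_abs]; norm_num; linarith

lemma coer (X M0 : Matrix (Fin n₁) (Fin n₂) ℝ) (hX : X.rank = r) (hXn : ‖X‖ ≤ 1)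
    (U K : Matrix (Fin n₁ ⊕ Fin n₂) (Fin r) ℝ) (l : Fin r → ℝ) {σ ρ : ℝ} (hσ : 0 < σ) (hσ1 : σ ≤ 1)
    (hρ0 : 0 ≤ ρ) (hρ : ρ ≤ 1 / 10 ^ 10 * σ ^ 3) (hM : ‖M0 - X‖ ≤ ρ) (hU : Uᵀ * U = 1)
    (hJ : Uᵀ * (flipSign n₁ n₂ * U) = 0) (hl : ∀ i, σ - ρ ≤ l i) (hl1 : ∀ i, l i ≤ 101 / 100)
    (hHU : symMat M0 * U = U * diagonal l) (hK : ‖K‖ ≤ 1 / 10 ^ 8 * σ ^ 2)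
    (S : Matrix (Fin r) (Fin k) ℝ) :
    let Γ₁ := (U + K).toRows₁
    let Γ₂ := (U + K).toRows₂
    let E := Γ₁ * S * (Γ₂ * S)ᵀ - X
    frobNorm E ≤ 5 * frobNorm (E * Γ₂) + 40 * frobNorm (Γ₁ᵀ * E) := by
  intro Γ₁ Γ₂ E
  have hU' : U.toRows₁ᵀ * U.toRows₁ + U.toRows₂ᵀ * U.toRows₂ = 1 := by
    rw [← hU]
    conv_rhs => rw [← Matrix.fromRows_toRows U, Matrix.transpose_fromRows, Matrix.fromCols_mul_fromRows]
  have hJ' : U.toRows₁ᵀ * U.toRows₁ - U.toRows₂ᵀ * U.toRows₂ = 0 := by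
    rw [← hJ, flip_mul_Z]
    conv_rhs => lhs; rw [← Matrix.fromRows_toRows U, Matrix.transpose_fromRows]
    rw [Matrix.fromCols_mul_fromRows, Matrix.mul_neg, sub_eq_add_neg]
  have u1 : U.toRows₁ᵀ * U.toRows₁ = (1/2 : ℝ) • 1 := by
    rw [← hU', sub_eq_zero.1 hJ', smul_add, ← add_smul]; norm_num
  have u2 : U.toRows₂ᵀ * U.toRows₂ = (1/2 : ℝ) • 1 := by
    rw [← hU', sub_eq_zero.1 hJ', smul_add, ← add_smul]; norm_num
  have hUn : ‖U‖ ≤ 1 := orth_opn_le U hU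
  have s1 : σ ^ 2 ≤ σ := by nlinarith
  have s2 : σ ^ 3 ≤ σ ^ 2 := by nlinarith [sq_nonneg σ]
  set U₁ := U.toRows₁
  set U₂ := U.toRows₂
  set K₁ := K.toRows₁
  set K₂ := K.toRows₂
  have hU₁ : ‖U₁‖ ≤ 1 := (rows1_le U).trans hUn
  have hU₂ : ‖U₂‖ ≤ 1 := (rows2_le U).trans hUn
  have hK₁ : ‖K₁‖ ≤ 1 / 10 ^ 8 * σ ^ 2 := (rows1_le K).trans hK
  have hK₂ : ‖K₂‖ ≤ 1 / 10 ^ 8 * σ ^ 2 := (rows2_le K).trans hK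
  have hΓ₁ : Γ₁ = U₁ + K₁ := rfl
  have hΓ₂ : Γ₂ = U₂ + K₂ := rfl
  have g1 : ‖Γ₁‖ ≤ 101 / 100 := by
    rw [hΓ₁]; have := norm_add_le U₁ K₁; linarith
  have g2 : ‖Γ₂‖ ≤ 101 / 100 := by
    rw [hΓ₂]; have := norm_add_le U₂ K₂; linarith
  -- Gram matrices
  have near : ∀ {a : Type} [Fintype a] [DecidableEq a] (P P' Q : Matrix a (Fin r) ℝ), Qᵀ * Q = (1/2 : ℝ) • 1 →
      ‖P - Q‖ ≤ 1 / 10 → ‖P' - Q‖ ≤ 1 / 100 → ‖Q‖ ≤ 1 → ‖Pᵀ * P' - (1/2 : ℝ) • 1‖ ≤ 1 / 4 := by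
    intro a _ _ P P' Q hQ h1 h2 h3
    have e : Pᵀ * P' - (1/2 : ℝ) • 1 = Qᵀ * (P' - Q) + (P - Q)ᵀ * (P' - Q) + (P - Q)ᵀ * Q := by
      rw [← hQ, Matrix.transpose_sub]
      simp only [Matrix.mul_sub, Matrix.sub_mul]; abel
    rw [e]
    have a1 : ‖Qᵀ * (P' - Q)‖ ≤ 1 * (1 / 100) := opn_mul_le (by rwa [opn_transpose]) h2
    have a2 : ‖(P - Q)ᵀ * (P' - Q)‖ ≤ 1 / 10 * (1 / 100) := opn_mul_le (by rwa [opn_transpose]) h2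
    have a3 : ‖(P - Q)ᵀ * Q‖ ≤ 1 / 10 * 1 := opn_mul_le (by rwa [opn_transpose]) h3
    have := norm_add_le (Qᵀ * (P' - Q) + (P - Q)ᵀ * (P' - Q)) ((P - Q)ᵀ * Q)
    have := norm_add_le (Qᵀ * (P' - Q)) ((P - Q)ᵀ * (P' - Q))
    linarith
  have n1 : ‖Γ₁ - U₁‖ ≤ 1 / 100 := by rw [hΓ₁, add_sub_cancel_left]; linarith
  have n2 : ‖Γ₂ - U₂‖ ≤ 1 / 100 := by rw [hΓ₂, add_sub_cancel_left]; linarith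
  obtain ⟨G1, -, G1b, G1n⟩ := half_inv _ (near Γ₁ Γ₁ U₁ u1 (by linarith) n1 hU₁)
  -- eigen relation
  have hl0 : ∀ i, 0 < l i := fun i => by have := hl i; nlinarith
  set Λi : Matrix (Fin r) (Fin r) ℝ := diagonal fun i => (l i)⁻¹ with hΛi
  have LL : diagonal l * Λi = 1 := by
    rw [hΛi, Matrix.diagonal_mul_diagonal, ← Matrix.diagonal_one]
    congr 1; ext i; exact mul_inv_cancel₀ (hl0 i).ne'
  have hΛn : ‖Λi‖ ≤ 2 / σ := by
    refine opn_diag_le _ (by positivity) fun i => ?_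
    rw [abs_of_pos (inv_pos.2 (hl0 i)), inv_le_comm₀ (hl0 i) (by positivity), inv_div]
    have := hl i
    linarith
  have hLn : ‖diagonal l‖ ≤ 101 / 100 :=
    opn_diag_le _ (by norm_num) fun i => by rw [abs_of_pos (hl0 i)]; exact hl1 i
  have er : M0ᵀ * U₁ = U₂ * diagonal l := by
    have h1 : symMat M0 * U = fromRows (M0 * U₂) (M0ᵀ * U₁) := by
      conv_lhs => rw [← Matrix.fromRows_toRows U, symMat, Matrix.fromBlocks_mul_fromRows]
      simp [U₁, U₂]
    have h2 : U * diagonal l = fromRows (U₁ * diagonal l) (U₂ * diagonal l) := by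
      conv_lhs => rw [← Matrix.fromRows_toRows U, Matrix.fromRows_mul]
    rw [h1, h2] at hHU
    exact (Matrix.fromRows_inj.eq_iff.1 hHU).2
  set B := Xᵀ * Γ₁ * Λi with hB
  have hR : Xᵀ * Γ₁ - Γ₂ * diagonal l = -((M0 - X)ᵀ * U₁) + Xᵀ * K₁ - K₂ * diagonal l := by
    rw [hΓ₁, hΓ₂, Matrix.mul_add, Matrix.add_mul, ← er, Matrix.transpose_sub, Matrix.sub_mul]; abel
  have hRn : ‖Xᵀ * Γ₁ - Γ₂ * diagonal l‖ ≤ 3 / 10 ^ 8 * σ ^ 2 := by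
    rw [hR]
    have a1 : ‖(M0 - X)ᵀ * U₁‖ ≤ ρ * 1 := opn_mul_le (by rwa [opn_transpose]) hU₁
    have a2 : ‖Xᵀ * K₁‖ ≤ 1 * (1 / 10 ^ 8 * σ ^ 2) := opn_mul_le (by rwa [opn_transpose]) hK₁
    have a3 : ‖K₂ * diagonal l‖ ≤ (1 / 10 ^ 8 * σ ^ 2) * (101 / 100) := opn_mul_le hK₂ hLn
    have b1 := norm_sub_le (-((M0 - X)ᵀ * U₁) + Xᵀ * K₁) (K₂ * diagonal l)
    have b2 := norm_add_le (-((M0 - X)ᵀ * U₁)) (Xᵀ * K₁)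
    rw [norm_neg] at b2
    have : 0 ≤ σ ^ 2 := sq_nonneg _
    linarith
  have hBΓ : B - Γ₂ = (Xᵀ * Γ₁ - Γ₂ * diagonal l) * Λi := by
    rw [Matrix.sub_mul, Matrix.mul_assoc Γ₂, LL, Matrix.mul_one]
  have hBn : ‖B - Γ₂‖ ≤ 1 / 100 := by
    rw [hBΓ]
    refine (opn_mul_le hRn hΛn).trans ?_
    have : 3 / 10 ^ 8 * σ ^ 2 * (2 / σ) = 6 / 10 ^ 8 * σ := by field_simp; ring
    rw [this]; linarith
  have hBU : ‖B - U₂‖ ≤ 1 / 10 := by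
    have : B - U₂ = (B - Γ₂) + (Γ₂ - U₂) := by abel
    rw [this]
    exact (norm_add_le _ _).trans (by linarith)
  have hB1 : ‖B‖ ≤ 11 / 10 := by
    have : B = (B - U₂) + U₂ := by abel
    rw [this]
    exact (norm_add_le _ _).trans (by linarith)
  obtain ⟨G2, G2a, G2b, G2n⟩ := half_inv _ (near B Γ₂ U₂ u2 hBU n2 hU₂)
  set C := G2 * Bᵀ with hC
  have hBt1 : ‖Bᵀ‖ ≤ 11 / 10 := by rw [opn_transpose]; exact hB1
  have hCn : ‖C‖ ≤ 5 := (opn_mul_le G2n hBt1).trans (by norm_num)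
  have hBt : Bᵀ = Λi * Γ₁ᵀ * X := by
    rw [hB, Matrix.transpose_mul, Matrix.transpose_mul, Matrix.transpose_transpose, hΛi,
      Matrix.diagonal_transpose, Matrix.mul_assoc]
  have hXC : X * (1 - Γ₂ * C) = 0 := by
    refine ker_factor X hX (Λi * Γ₁ᵀ) Γ₂ G2 ?_ _ ?_
    · rw [← hBt, G2a]
    · have h3 : Bᵀ * (Γ₂ * C) = Bᵀ := by
        rw [hC, ← Matrix.mul_assoc Γ₂, ← Matrix.mul_assoc, ← Matrix.mul_assoc, G2a, Matrix.one_mul]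
      rw [← hBt, Matrix.mul_sub, Matrix.mul_one, h3, sub_self]
  have e1 : E * (1 - Γ₂ * C) = Γ₁ * (G1 * (Γ₁ᵀ * E * (1 - Γ₂ * C))) := by
    have h1 : E * (1 - Γ₂ * C) = Γ₁ * (S * (Γ₂ * S)ᵀ * (1 - Γ₂ * C)) := by
      simp only [E]
      rw [Matrix.sub_mul, hXC, sub_zero, Matrix.mul_assoc, Matrix.mul_assoc, Matrix.mul_assoc]
    rw [Matrix.mul_assoc Γ₁ᵀ, h1, ← Matrix.mul_assoc Γ₁ᵀ, ← Matrix.mul_assoc G1, G1b, Matrix.one_mul]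
  have e2 : E = E * Γ₂ * C + Γ₁ * (G1 * (Γ₁ᵀ * E * (1 - Γ₂ * C))) := by
    rw [← e1, Matrix.mul_sub, Matrix.mul_one, Matrix.mul_assoc]; abel
  have f1 : frobNorm (E * Γ₂ * C) ≤ frobNorm (E * Γ₂) * 5 := by
    refine (fro_mul_right _ _).trans ?_
    have := fro_nonneg (E * Γ₂); gcongr
  have f2 : ‖(1 : Matrix (Fin n₂) (Fin n₂) ℝ) - Γ₂ * C‖ ≤ 7 := by
    have := norm_sub_le (1 : Matrix (Fin n₂) (Fin n₂) ℝ) (Γ₂ * C)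
    have h2 := opn_mul_le g2 hCn
    have h3 := opn_one_le (a := Fin n₂)
    linarith
  have f3 : frobNorm (Γ₁ * (G1 * (Γ₁ᵀ * E * (1 - Γ₂ * C)))) ≤ 101 / 100 * (4 * (frobNorm (Γ₁ᵀ * E) * 7)) := by
    have := fro_nonneg (Γ₁ᵀ * E)
    refine (fro_mul_left _ _).trans (mul_le_mul g1 ?_ (fro_nonneg _) (by norm_num))
    refine (fro_mul_left _ _).trans (mul_le_mul G1n ?_ (fro_nonneg _) (by norm_num))
    refine (fro_mul_right _ _).trans ?_
    gcongr
  have f4 := fro_add (E * Γ₂ * C) (Γ₁ * (G1 * (Γ₁ᵀ * E * (1 - Γ₂ * C))))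
  rw [← e2] at f4
  have := fro_nonneg (Γ₁ᵀ * E)
  linarith

end Final2

section Final3
open scoped Matrix.Norms.L2Operator
variable {n₁ n₂ m k r : ℕ}

lemma fro_late {a : Type*} [Fintype a] {σ : ℝ} (S : Matrix (Fin r) (Fin k) ℝ)
    (hS : ∀ w, σ * euclNorm w ^ 2 ≤ 16 * euclNorm (Sᵀ *ᵥ w) ^ 2) (P : Matrix a (Fin r) ℝ) :
    σ * frobNorm P ^ 2 ≤ 16 * frobNorm (P * S) ^ 2 := by
  rw [← fro_transpose P, ← fro_transpose (P * S), Matrix.transpose_mul, fro_sq_cols, fro_sq_cols,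
    Finset.mul_sum, Finset.mul_sum]
  refine Finset.sum_le_sum fun j _ => ?_
  exact hS (fun i => Pᵀ i j)

lemma EW_low (X E Es : Matrix (Fin n₁) (Fin n₂) ℝ)
    (W N₂ Ws : Matrix (Fin n₂) (Fin k) ℝ) (hW : W = Ws + N₂) (hWn : ‖W‖ ≤ 2) {n q : ℝ}
    (h2 : ‖N₂‖ ≤ n) (hq : frobNorm (E - Es) ≤ 5 * q) :
    frobNorm (Es * Ws) ^ 2 ≤ 2 * frobNorm (E * W) ^ 2 + 4 * (frobNorm Es * n) ^ 2 + 400 * q ^ 2 := by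
  have e : Es * Ws = E * W - (Es * N₂ + (E - Es) * W) := by
    rw [Matrix.sub_mul, hW]; simp only [Matrix.mul_add]; abel
  have h := fro_sub (E * W) (Es * N₂ + (E - Es) * W)
  rw [← e] at h
  have h3 := fro_add (Es * N₂) ((E - Es) * W)
  have h4 : frobNorm (Es * N₂) ≤ frobNorm Es * n := by
    refine (fro_mul_right _ _).trans ?_
    have := fro_nonneg Es; gcongr
  have h5 : frobNorm ((E - Es) * W) ≤ 5 * q * 2 :=
    (fro_mul_right _ _).trans (mul_le_mul hq hWn (norm_nonneg _) ((fro_nonneg _).trans hq))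
  have h6 : frobNorm (Es * Ws) ≤ frobNorm (E * W) + (frobNorm Es * n + 10 * q) := by linarith
  have h7 : frobNorm (Es * Ws) ^ 2 ≤ (frobNorm (E * W) + (frobNorm Es * n + 10 * q)) ^ 2 := by
    have := fro_nonneg (Es * Ws); gcongr
  set x := frobNorm (E * W)
  set y := frobNorm Es * n
  have a1 : (x + (y + 10 * q)) ^ 2 ≤ 2 * x ^ 2 + 2 * (y + 10 * q) ^ 2 := by
    linarith [sq_nonneg (x - (y + 10 * q)), sub_sq x (y + 10 * q), add_sq x (y + 10 * q)]
  have a2 : (y + 10 * q) ^ 2 ≤ 2 * y ^ 2 + 200 * q ^ 2 := by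
    nlinarith [sq_nonneg (y - 10 * q)]
  linarith

lemma sq_two {a b c : ℝ} (ha : 0 ≤ a) (h : a ≤ b + c) : a ^ 2 ≤ 2 * b ^ 2 + 2 * c ^ 2 := by
  have : a ^ 2 ≤ (b + c) ^ 2 := by gcongr
  nlinarith [sq_nonneg (b - c)]

lemma sq_540 {e a b : ℝ} (ha : 0 ≤ e) (h : e ≤ 5 * a + 40 * b) : e ^ 2 ≤ 1700 * (a ^ 2 + b ^ 2) := by
  have : e ^ 2 ≤ (5 * a + 40 * b) ^ 2 := by gcongr
  nlinarith [sq_nonneg (40 * a - 5 * b), sq_nonneg a, sq_nonneg b]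

set_option maxHeartbeats 1000000 in
lemma step_E (A : Fin m → Matrix (Fin n₁) (Fin n₂) ℝ) {δ : ℝ} (hδ : 0 ≤ δ) (hr : 1 ≤ r)
    (hA : HasRIP A (2 * r + 1) δ)
    (X M0 : Matrix (Fin n₁) (Fin n₂) ℝ) (hX : X.rank = r) (hXn : ‖X‖ ≤ 1)
    (U K : Matrix (Fin n₁ ⊕ Fin n₂) (Fin r) ℝ) (l : Fin r → ℝ) {σ ρ : ℝ} (hσ : 0 < σ) (hσ1 : σ ≤ 1)
    (hρ0 : 0 ≤ ρ) (hρ : ρ ≤ 1 / 10 ^ 10 * σ ^ 3) (hδρ : δ ≤ ρ) (hM : ‖M0 - X‖ ≤ ρ) (hU : Uᵀ * U = 1)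
    (hJ : Uᵀ * (flipSign n₁ n₂ * U) = 0) (hl : ∀ i, σ - ρ ≤ l i) (hl1 : ∀ i, l i ≤ 101 / 100)
    (hHU : symMat M0 * U = U * diagonal l) (hK : ‖K‖ ≤ 1 / 10 ^ 8 * σ ^ 2)
    (S : Matrix (Fin r) (Fin k) ℝ) (hS : ∀ w, σ * euclNorm w ^ 2 ≤ 16 * euclNorm (Sᵀ *ᵥ w) ^ 2)
    (Z N : Matrix (Fin n₁ ⊕ Fin n₂) (Fin k) ℝ) (hZ : Z = (U + K) * S + N) (hZn : ‖Z‖ ≤ 2)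
    {n : ℝ} (hN : ‖N‖ ≤ n) (hk : 1 ≤ k) (hkn : k * n ≤ 1 / 10 ^ 10 * σ ^ 3) {μ : ℝ} (hμ : 0 ≤ μ)
    (hμσ : μ ≤ 1 / 10 ^ 20 * σ ^ 5) (hG : ‖AstarA A (Z.toRows₁ * Z.toRows₂ᵀ - X)‖ ≤ 6) :
    let V := Z.toRows₁
    let W := Z.toRows₂
    let G := AstarA A (V * Wᵀ - X)
    frobNorm ((V - μ • (G * W)) * (W - μ • (Gᵀ * V))ᵀ - X) ^ 2 ≤
      (1 - μ * σ / 120000) * frobNorm (V * Wᵀ - X) ^ 2 + μ * (600 * (k ^ 3 * n ^ 2)) := by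
  intro V W G
  set Γ₁ := (U + K).toRows₁ with hΓ₁
  set Γ₂ := (U + K).toRows₂ with hΓ₂
  set N₁ := N.toRows₁ with hN₁
  set N₂ := N.toRows₂ with hN₂
  have hV : V = Γ₁ * S + N₁ := by simp only [V]; rw [hZ]; rfl
  have hW : W = Γ₂ * S + N₂ := by simp only [W]; rw [hZ]; rfl
  have hVn : ‖V‖ ≤ 2 := (rows1_le Z).trans hZn
  have hWn : ‖W‖ ≤ 2 := (rows2_le Z).trans hZn
  have h1 : ‖N₁‖ ≤ n := (rows1_le N).trans hN
  have h2 : ‖N₂‖ ≤ n := (rows2_le N).trans hN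
  have hn0 : 0 ≤ n := (norm_nonneg _).trans h1
  have hk1 : (1 : ℝ) ≤ k := by exact_mod_cast hk
  have s3 : σ ^ 3 ≤ 1 := pow_le_one₀ hσ.le hσ1
  have s5 : σ ^ 5 ≤ 1 := pow_le_one₀ hσ.le hσ1
  have s31 : σ ^ 3 ≤ σ := by simpa using pow_le_pow_of_le_one hσ.le hσ1 (show 1 ≤ 3 by norm_num)
  have s51 : σ ^ 5 ≤ σ := by simpa using pow_le_pow_of_le_one hσ.le hσ1 (show 1 ≤ 5 by norm_num)
  have hkn' : k * n ≤ 1 / 10 ^ 10 := hkn.trans (by linarith)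
  have hnσ : n ≤ 1 / 10 ^ 10 * σ := le_trans (le_mul_of_one_le_left hn0 hk1) (hkn.trans (by linarith : _ ≤ 1 / 10 ^ 10 * σ))
  have hδσ : δ ≤ 1 / 10 ^ 10 * σ := hδρ.trans (hρ.trans (by linarith))
  set E := V * Wᵀ - X with hE
  set Q := Qop A E with hQ
  have hGQ : G = E + Q := by rw [hQ, Qop]; simp only [G]; abel
  have D := descent E Q G V W X rfl hGQ hVn hWn hG hμ (hμσ.trans (by linarith))
  obtain ⟨b1, b2⟩ := QW_bd A hδ hr hA X hX V N₁ W N₂ Γ₁ Γ₂ S hV hW hVn hWn h1 h2 hk hkn'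
  obtain ⟨b3, -⟩ := QW_bd (fun i => (A i)ᵀ) hδ hr (rip_transpose A hA) Xᵀ (by rwa [Matrix.rank_transpose])
    W N₂ V N₁ Γ₂ Γ₁ S hW hV hWn hVn h2 h1 hk hkn'
  have eT : W * Vᵀ - Xᵀ = Eᵀ := by
    rw [hE, Matrix.transpose_sub, Matrix.transpose_mul, Matrix.transpose_transpose]
  have eQ : frobNorm (Qᵀ * V) = frobNorm (Vᵀ * Q) := by
    rw [← fro_transpose (Vᵀ * Q), Matrix.transpose_mul, Matrix.transpose_transpose]
  rw [eT, Qop_transpose, fro_transpose, ← hQ, eQ] at b3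
  rw [← hE, ← hQ] at b1
  rw [← hE] at b2
  set Es := Γ₁ * S * (Γ₂ * S)ᵀ - X with hEs
  have c := coer X M0 hX hXn U K l hσ hσ1 hρ0 hρ hM hU hJ hl hl1 hHU hK S
  simp only at c
  rw [← hΓ₁, ← hΓ₂, ← hEs] at c
  have l1 := fro_late S hS (Es * Γ₂)
  have l2 := fro_late S hS (Esᵀ * Γ₁)
  have t1 : frobNorm (Esᵀ * Γ₁) = frobNorm (Γ₁ᵀ * Es) := by
    rw [← fro_transpose (Γ₁ᵀ * Es), Matrix.transpose_mul, Matrix.transpose_transpose]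
  rw [t1] at l2
  rw [Matrix.mul_assoc] at l1 l2
  have w1 := EW_low X E Es W N₂ (Γ₂ * S) hW hWn h2 b2
  have w2 := EW_low Xᵀ Eᵀ Esᵀ V N₁ (Γ₁ * S) hV hVn h1 (by rw [← Matrix.transpose_sub, fro_transpose]; exact b2)
  have t2 : frobNorm (Eᵀ * V) = frobNorm (Vᵀ * E) := by
    rw [← fro_transpose (Vᵀ * E), Matrix.transpose_mul, Matrix.transpose_transpose]
  rw [t2, fro_transpose] at w2
  have hes : frobNorm E ≤ frobNorm Es + 5 * (Real.sqrt k * n) := by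
    have : E = Es + (E - Es) := by abel
    calc frobNorm E = frobNorm (Es + (E - Es)) := by rw [← this]
      _ ≤ _ := (fro_add _ _).trans (by linarith)
  have hes2 : frobNorm Es ≤ frobNorm E + 5 * (Real.sqrt k * n) := by
    have : Es = E - (E - Es) := by abel
    calc frobNorm Es = frobNorm (E - (E - Es)) := by rw [← this]
      _ ≤ _ := (fro_sub _ _).trans (by linarith)
  have f0 := fro_nonneg E
  have f1 := fro_nonneg Es
  have f2 := fro_nonneg (Es * Γ₂)
  have f3 := fro_nonneg (Γ₁ᵀ * Es)
  have f4 := fro_nonneg (Q * W)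
  have f5 := fro_nonneg (Vᵀ * Q)
  refine D.trans ?_
  have hq2 : (Real.sqrt k * n) ^ 2 = k * n ^ 2 := by rw [mul_pow, Real.sq_sqrt (by positivity)]
  have hq3 : (k * Real.sqrt k * n) ^ 2 = k ^ 3 * n ^ 2 := by
    rw [mul_pow, mul_pow, Real.sq_sqrt (by positivity)]; ring
  set q := Real.sqrt k * n
  set q' := k * Real.sqrt k * n
  set e := frobNorm E
  set es := frobNorm Es
  set a := frobNorm (Es * Γ₂)
  set b := frobNorm (Γ₁ᵀ * Es)
  set x := frobNorm (E * W)
  set y := frobNorm (Vᵀ * E)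
  set p := frobNorm (Q * W)
  set p' := frobNorm (Vᵀ * Q)
  set K3 : ℝ := k ^ 3 * n ^ 2 with hK3
  have hq0 : 0 ≤ q := by positivity
  have hq0' : 0 ≤ q' := by positivity
  have hkk : k * n ^ 2 ≤ K3 := by
    rw [hK3]; gcongr
    exact le_self_pow₀ hk1 (by norm_num)
  have hK30 : 0 ≤ K3 := by positivity
  clear_value q q' e es a b x y p p' K3
  -- upper bounds for the RIP error
  have P1 : ∀ z, 0 ≤ z → z ≤ 3 * δ * e + 30 * δ * q' → z ^ 2 ≤ 1 / 10 ^ 7 * σ * e ^ 2 + K3 := by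
    intro z hz hz2
    have i1 : z ≤ σ / 10 ^ 10 * (3 * e + 30 * q') := by
      refine hz2.trans ?_
      have : δ * (3 * e + 30 * q') ≤ 1 / 10 ^ 10 * σ * (3 * e + 30 * q') := by gcongr
      linarith
    have i2 : z ^ 2 ≤ (σ / 10 ^ 10 * (3 * e + 30 * q')) ^ 2 := by gcongr
    have i3 : (3 * e + 30 * q') ^ 2 ≤ 18 * e ^ 2 + 1800 * K3 := by
      rw [← hq3]
      have i0 := sq_two (a := 3 * e + 30 * q') (b := 3 * e) (c := 30 * q') (by positivity) le_rfl
      rw [mul_pow 3 e, mul_pow 30 q'] at i0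
      linarith only [i0]
    have i4 : (σ / 10 ^ 10 * (3 * e + 30 * q')) ^ 2 ≤ (1 / 10 ^ 20 * σ) * (18 * e ^ 2 + 1800 * K3) := by
      have : (σ / 10 ^ 10) ^ 2 ≤ 1 / 10 ^ 20 * σ := by
        have : (σ / 10 ^ 10) ^ 2 = 1 / 10 ^ 20 * (σ * σ) := by ring
        rw [this]; have := mul_le_of_le_one_right hσ.le hσ1; linarith
      rw [mul_pow]; gcongr
    have i5 : (1 / 10 ^ 20 * σ) * (18 * e ^ 2 + 1800 * K3) = 18 / 10 ^ 20 * (σ * e ^ 2) + 1800 / 10 ^ 20 * (σ * K3) := by ring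
    have i6 : σ * K3 ≤ K3 := mul_le_of_le_one_left hK30 hσ1
    have i7 : 0 ≤ σ * e ^ 2 := by positivity
    rw [i5] at i4
    linarith
  have hp1 := P1 p f4 b1
  have hp2 := P1 p' f5 b3
  -- lower bound for the decrease
  have c2 : es ^ 2 ≤ 1700 * (a ^ 2 + b ^ 2) := sq_540 f1 c
  have c3 : e ^ 2 ≤ 2 * es ^ 2 + 50 * q ^ 2 := by
    have i0 := sq_two f0 hes
    rw [mul_pow] at i0
    linarith only [i0]
  have c4 : es ^ 2 ≤ 2 * e ^ 2 + 50 * q ^ 2 := by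
    have i0 := sq_two f1 hes2
    rw [mul_pow] at i0
    linarith only [i0]
  have c5 : (es * n) ^ 2 ≤ 1 / 10 ^ 20 * (σ * (2 * e ^ 2 + 50 * q ^ 2)) := by
    have : n ^ 2 ≤ 1 / 10 ^ 20 * σ := by
      calc n ^ 2 ≤ (1 / 10 ^ 10 * σ) ^ 2 := by gcongr
        _ = 1 / 10 ^ 20 * (σ * σ) := by ring
        _ ≤ _ := by have := mul_le_of_le_one_right hσ.le hσ1; linarith
    calc (es * n) ^ 2 = es ^ 2 * n ^ 2 := by ring
      _ ≤ (2 * e ^ 2 + 50 * q ^ 2) * (1 / 10 ^ 20 * σ) := by gcongr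
      _ = _ := by ring
  have c6 : σ * es ^ 2 ≤ 1700 * (σ * a ^ 2 + σ * b ^ 2) := by
    calc σ * es ^ 2 ≤ σ * (1700 * (a ^ 2 + b ^ 2)) := by gcongr
      _ = _ := by ring
  have c7 : σ * e ^ 2 ≤ 2 * (σ * es ^ 2) + 50 * (σ * q ^ 2) := by
    calc σ * e ^ 2 ≤ σ * (2 * es ^ 2 + 50 * q ^ 2) := by gcongr
      _ = _ := by ring
  have c8 : σ * q ^ 2 ≤ K3 := by
    rw [hq2]; exact (mul_le_of_le_one_left (by positivity) hσ1).trans hkk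
  have c9 : q ^ 2 ≤ K3 := by rw [hq2]; exact hkk
  have c10 : σ * (2 * e ^ 2 + 50 * q ^ 2) = 2 * (σ * e ^ 2) + 50 * (σ * q ^ 2) := by ring
  rw [c10] at c5
  have hσe : 0 ≤ σ * e ^ 2 := by positivity
  have low : σ * e ^ 2 / 110000 - 500 * K3 ≤ x ^ 2 + y ^ 2 := by linarith
  have hmu : μ * e ^ 2 ≤ 1 / 10 ^ 20 * (σ * e ^ 2) := by
    calc μ * e ^ 2 ≤ (1 / 10 ^ 20 * σ) * e ^ 2 := by gcongr; exact hμσ.trans (by linarith)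
      _ = _ := by ring
  have fin : -(x ^ 2 + y ^ 2) + 2 * (p ^ 2 + p' ^ 2) + 310 * (μ * e ^ 2) ≤ - (σ * e ^ 2) / 120000 + 600 * K3 := by
    linarith
  have := mul_le_mul_of_nonneg_left fin hμ
  calc _ = e ^ 2 + μ * (-(x ^ 2 + y ^ 2) + 2 * (p ^ 2 + p' ^ 2) + 310 * (μ * e ^ 2)) := by ring
    _ ≤ e ^ 2 + μ * (- (σ * e ^ 2) / 120000 + 600 * K3) := by linarith
    _ = _ := by ring

end Final3

section Final4
open scoped Matrix.Norms.L2Operator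
variable {n₁ n₂ m k r : ℕ}

/-- the (deterministic) reference eigenspace of the normalized problem -/
structure Ref (A : Fin m → Matrix (Fin n₁) (Fin n₂) ℝ) (X : Matrix (Fin n₁) (Fin n₂) ℝ) (δ σ : ℝ)
    (U : Matrix (Fin n₁ ⊕ Fin n₂) (Fin r) ℝ) (l : Fin r → ℝ) : Prop where
  hδ : 0 ≤ δ
  hr : 1 ≤ r
  hA : HasRIP A (2 * r + 1) δ
  hX : X.rank = r
  hXn : ‖X‖ ≤ 1
  hσ : 0 < σ
  hσ1 : σ ≤ 1
  hρ : δ * Real.sqrt r ≤ 1 / 10 ^ 10 * σ ^ 3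
  hM : ‖AstarA A X - X‖ ≤ δ * Real.sqrt r
  hU : Uᵀ * U = 1
  hl : ∀ i, σ - δ * Real.sqrt r ≤ l i
  hl1 : ∀ i, l i ≤ 101 / 100
  hHU : symMat (AstarA A X) * U = U * Matrix.diagonal l
  hQ : ∀ v, Uᵀ *ᵥ v = 0 → v ⬝ᵥ (symMat (AstarA A X) *ᵥ v) ≤ δ * Real.sqrt r * euclNorm v ^ 2
  hJ : Uᵀ * (flipSign n₁ n₂ * U) = 0

lemma Ref.M0 {A : Fin m → Matrix (Fin n₁) (Fin n₂) ℝ} {X : Matrix (Fin n₁) (Fin n₂) ℝ} {δ σ : ℝ}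
    (hXn : ‖X‖ ≤ 1) (hσ : 0 < σ) (hσ1 : σ ≤ 1) (hρ : δ * Real.sqrt r ≤ 1 / 10 ^ 10 * σ ^ 3)
    (hM : ‖AstarA A X - X‖ ≤ δ * Real.sqrt r) : ‖AstarA A X‖ ≤ 101 / 100 := by
  have h : AstarA A X = X + (AstarA A X - X) := by abel
  have s3 : σ ^ 3 ≤ 1 := pow_le_one₀ hσ.le hσ1
  rw [h]
  refine (norm_add_le _ _).trans ?_
  linarith

lemma ref_exists (A : Fin m → Matrix (Fin n₁) (Fin n₂) ℝ) (X : Matrix (Fin n₁) (Fin n₂) ℝ) {δ σ : ℝ}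
    (hδ : 0 ≤ δ) (hr : 1 ≤ r) (hA : HasRIP A (2 * r + 1) δ) (hX : X.rank = r) (hXn : ‖X‖ ≤ 1)
    (hσ : 0 < σ) (hσ1 : σ ≤ 1) (hρ : δ * Real.sqrt r ≤ 1 / 10 ^ 10 * σ ^ 3)
    (hs : ∀ x : Fin n₂ → ℝ, (∀ y, X *ᵥ y = 0 → x ⬝ᵥ y = 0) → σ * euclNorm x ≤ euclNorm (X *ᵥ x)) :
    ∃ (U : Matrix (Fin n₁ ⊕ Fin n₂) (Fin r) ℝ) (l : Fin r → ℝ), Ref A X δ σ U l := by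
  have hM : ‖AstarA A X - X‖ ≤ δ * Real.sqrt r := by
    refine (Qop_opn A (s := 2 * r) hδ hA X (by omega)).trans ?_
    gcongr
    refine (fro_le_rank X hX).trans ?_
    exact mul_le_of_le_one_right (Real.sqrt_nonneg _) hXn
  have s31 : σ ^ 3 ≤ σ := by simpa using pow_le_pow_of_le_one hσ.le hσ1 (show 1 ≤ 3 by norm_num)
  obtain ⟨U, l, h1, h2, h3, h4, h5, h6⟩ := eig_U X (AstarA A X) hX σ _ hs hM (by linarith)
  exact ⟨U, l, hδ, hr, hA, hX, hXn, hσ, hσ1, hρ, hM, h1, h2,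
    fun i => (h3 i).trans (Ref.M0 hXn hσ hσ1 hρ hM), h4, h5, h6⟩

/-- the stacked iterate -/
def Zs (A : Fin m → Matrix (Fin n₁) (Fin n₂) ℝ) (X : Matrix (Fin n₁) (Fin n₂) ℝ) (μ : ℝ)
    (V₀ : Matrix (Fin n₁) (Fin k) ℝ) (W₀ : Matrix (Fin n₂) (Fin k) ℝ) (t : ℕ) :
    Matrix (Fin n₁ ⊕ Fin n₂) (Fin k) ℝ :=
  fromRows (iter A X μ V₀ W₀ t).1 (iter A X μ V₀ W₀ t).2

/-- the abstract dynamics attached to the iteration -/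
def mkDyn {A : Fin m → Matrix (Fin n₁) (Fin n₂) ℝ} {X : Matrix (Fin n₁) (Fin n₂) ℝ} {δ σ μ : ℝ}
    {U : Matrix (Fin n₁ ⊕ Fin n₂) (Fin r) ℝ} {l : Fin r → ℝ} (h : Ref A X δ σ U l) (hμ : 0 < μ)
    (hμσ : μ ≤ 1 / 10 ^ 20 * σ ^ 5)
    (V₀ : Matrix (Fin n₁) (Fin k) ℝ) (W₀ : Matrix (Fin n₂) (Fin k) ℝ) :
    Dyn (Fin n₁ ⊕ Fin n₂) k r where
  μ := μ
  σ := σ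
  ρ := δ * Real.sqrt r
  J := flipSign n₁ n₂
  H := symMat (AstarA A X)
  U := U
  l := l
  Z := Zs A X μ V₀ W₀
  M t := - symMat (AstarA A ((iter A X μ V₀ W₀ t).1 * (iter A X μ V₀ W₀ t).2ᵀ - X))
  D t := - symMat (Qop A ((iter A X μ V₀ W₀ t).1 * (iter A X μ V₀ W₀ t).2ᵀ))
  hμ := hμ
  hσ := h.hσ
  hσ1 := h.hσ1
  hμσ := hμσ
  hρ0 := mul_nonneg h.hδ (Real.sqrt_nonneg _)
  hρ := h.hρ
  hJJ := flip_mul_self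
  hJt := flip_transpose
  hM t := by
    have e := sym_prod (Zs A X μ V₀ W₀ t)
    have e2 : (Zs A X μ V₀ W₀ t).toRows₁ * (Zs A X μ V₀ W₀ t).toRows₂ᵀ =
      (iter A X μ V₀ W₀ t).1 * (iter A X μ V₀ W₀ t).2ᵀ := rfl
    rw [e2] at e
    rw [AstarA_sub, symMat_sub, Qop, symMat_sub, e]
    abel
  hMt t := by rw [transpose_neg, symMat_transpose]
  hJM t := by rw [Matrix.mul_neg, flip_symMat, Matrix.neg_mul]
  hZ t := by
    rw [Zs, Zs, iter, symMat]
    simp only [Matrix.neg_mul, Matrix.fromBlocks_mul_fromRows, Matrix.zero_mul, zero_add, add_zero]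
    ext i j
    rcases i with i | i <;> simp [sub_eq_add_neg]
  hHt := symMat_transpose _
  hHn := (symMat_opn _).trans (Ref.M0 h.hXn h.hσ h.hσ1 h.hρ h.hM)
  hU := h.hU
  hHU := h.hHU
  hl := h.hl
  hl1 := h.hl1
  hQ := h.hQ
  hD t Γ S N hZ := by
    rw [norm_neg]
    refine (symMat_opn _).trans ((D_bound A h.hδ h.hr h.hA _ N Γ S hZ).trans ?_)
    have h1 : (1 : ℝ) ≤ Real.sqrt r := by
      rw [Real.one_le_sqrt]; exact_mod_cast h.hr
    have h2 := h.hδ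
    gcongr
    exact le_mul_of_one_le_right h2 h1

lemma fro_init (h : r ≤ k) (X : Matrix (Fin n₁) (Fin n₂) ℝ) (hX : X.rank = r) (hXn : ‖X‖ ≤ 1)
    (V : Matrix (Fin n₁) (Fin k) ℝ) (W : Matrix (Fin n₂) (Fin k) ℝ) (hV : ‖V‖ ≤ 2) (hW : ‖W‖ ≤ 2) :
    frobNorm (V * Wᵀ - X) ^ 2 ≤ 25 * k := by
  have h1 : frobNorm (V * Wᵀ) ≤ Real.sqrt k * 2 * 2 := by
    refine (fro_mul_right _ _).trans ?_
    rw [opn_transpose]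
    have : frobNorm V ≤ Real.sqrt k * 2 := by
      have := fro_le_cols V
      simp only [Fintype.card_fin] at this
      exact this.trans (by gcongr)
    exact mul_le_mul this hW (norm_nonneg _) (by positivity)
  have h2 : frobNorm X ≤ Real.sqrt k := by
    refine (fro_le_rank X hX).trans ((mul_le_of_le_one_right (Real.sqrt_nonneg _) hXn).trans ?_)
    exact Real.sqrt_le_sqrt (by exact_mod_cast h)
  have h3 := fro_sub (V * Wᵀ) X
  have h4 : frobNorm (V * Wᵀ - X) ≤ 5 * Real.sqrt k := by linarith
  calc frobNorm (V * Wᵀ - X) ^ 2 ≤ (5 * Real.sqrt k) ^ 2 := by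
        have := fro_nonneg (V * Wᵀ - X); gcongr
    _ = _ := by rw [mul_pow, Real.sq_sqrt (by positivity)]; norm_num

/-- deterministic convergence statement -/
lemma det_final {A : Fin m → Matrix (Fin n₁) (Fin n₂) ℝ} {X : Matrix (Fin n₁) (Fin n₂) ℝ} {δ σ μ : ℝ}
    {U : Matrix (Fin n₁ ⊕ Fin n₂) (Fin r) ℝ} {l : Fin r → ℝ} (h : Ref A X δ σ U l) (hμ : 0 < μ)
    (hμσ : μ ≤ 1 / 10 ^ 20 * σ ^ 5) (hrk : r ≤ k)
    (V₀ : Matrix (Fin n₁) (Fin k) ℝ) (W₀ : Matrix (Fin n₂) (Fin k) ℝ) {z0 s0 : ℝ} {T t1 : ℕ}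
    (hy : (mkDyn h hμ hμσ V₀ W₀).Hyp z0 s0 T) (ht1 : t1 ≤ T)
    (hl : ((1 + 19 / 10 * μ * σ) ^ t1)⁻¹ ≤ s0 ^ 2 / σ) :
    frobNorm ((iter A X μ V₀ W₀ T).1 * (iter A X μ V₀ W₀ T).2ᵀ - X) ^ 2 ≤
      Real.exp (-(μ * σ / 120000 * (T - t1 : ℕ))) * (25 * k)
        + 72000000 * (k ^ 3 * (z0 * Real.exp (1 / 10 ^ 7 * σ * μ * T)) ^ 2) / σ := by
  set s := mkDyn h hμ hμσ V₀ W₀ with hs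
  have hσ := h.hσ
  have hσ1 := h.hσ1
  have hn : s.nh z0 T = z0 * Real.exp (1 / 10 ^ 7 * σ * μ * T) := rfl
  rw [← hn]
  set n := s.nh z0 T
  set c := μ * σ / 120000 with hc
  have s5 : σ ^ 5 ≤ 1 := pow_le_one₀ hσ.le hσ1
  have hc1 : c ≤ 1 := by
    have : μ * σ ≤ 1 * 1 := by gcongr; linarith
    rw [hc]; linarith
  have hZb : ∀ t ≤ T, ‖s.Z t‖ ≤ 2 := fun t ht => (s.inv_all hy T le_rfl t ht).hZ2
  have key : ∀ j, t1 + j ≤ T → frobNorm ((iter A X μ V₀ W₀ (t1 + j)).1 * (iter A X μ V₀ W₀ (t1 + j)).2ᵀ - X) ^ 2 ≤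
      Real.exp (-(c * j)) * (25 * k) + 72000000 * (k ^ 3 * n ^ 2) / σ := by
    intro j
    induction j with
    | zero =>
      intro _
      have h1 := hZb t1 ht1
      have := fro_init hrk X h.hX h.hXn _ _ ((rows1_le (s.Z t1)).trans h1) ((rows2_le (s.Z t1)).trans h1)
      have e : (0 : ℝ) ≤ 72000000 * (k ^ 3 * n ^ 2) / σ := by positivity
      simp only [Nat.cast_zero, mul_zero, neg_zero, Real.exp_zero, one_mul, add_zero]
      exact this.trans (by linarith)
    | succ j ih =>
      intro hj
      set t := t1 + j with ht
      have htT : t ≤ T := by omega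
      have i := s.inv_all hy T le_rfl t htT
      have hG : ‖AstarA A ((s.Z t).toRows₁ * (s.Z t).toRows₂ᵀ - X)‖ ≤ 6 := by
        refine (opn_le_symMat _).trans ?_
        have := s.M_bd hy i htT
        have e : s.M t = - symMat (AstarA A ((s.Z t).toRows₁ * (s.Z t).toRows₂ᵀ - X)) := rfl
        rwa [e, norm_neg] at this
      have hl' : ((1 + 19 / 10 * s.μ * s.σ) ^ t)⁻¹ ≤ s0 ^ 2 / s.σ := by
        refine le_trans ?_ hl
        have : 0 ≤ 19 / 10 * μ * σ := by positivity
        change ((1 + 19 / 10 * μ * σ) ^ t)⁻¹ ≤ _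
        gcongr
        · linarith
        · omega
      have st := step_E A h.hδ h.hr h.hA X (AstarA A X) h.hX h.hXn U (s.K t) l hσ hσ1
        (mul_nonneg h.hδ (Real.sqrt_nonneg _)) h.hρ (le_mul_of_one_le_right h.hδ (by
          rw [Real.one_le_sqrt]; exact_mod_cast h.hr)) h.hM h.hU h.hJ h.hl h.hl1 h.hHU i.hK (s.A t)
        (s.late hy htT hl') (s.Z t) (s.N t) (s.Zsplit t) i.hZ2 (i.hN.trans (Dyn.nh_mono hy.hz0 htT))
        hy.hk hy.hn hμ.le hμσ hG
      have st' : frobNorm ((iter A X μ V₀ W₀ (t + 1)).1 * (iter A X μ V₀ W₀ (t + 1)).2ᵀ - X) ^ 2 ≤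
          (1 - c) * frobNorm ((iter A X μ V₀ W₀ t).1 * (iter A X μ V₀ W₀ t).2ᵀ - X) ^ 2
            + μ * (600 * (k ^ 3 * n ^ 2)) := st
      refine st'.trans ?_
      have ih' := ih htT
      have e1 : μ * (600 * (k ^ 3 * n ^ 2)) = c * (72000000 * (k ^ 3 * n ^ 2) / σ) := by
        rw [hc]; generalize (k:ℝ) ^ 3 * n ^ 2 = q; field_simp; ring
      have e2 : 1 - c ≤ Real.exp (-c) := by linarith [Real.add_one_le_exp (-c)]
      have e3 : Real.exp (-(c * (j + 1 : ℕ))) = Real.exp (-c) * Real.exp (-(c * j)) := by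
        rw [← Real.exp_add]; congr 1; push_cast; ring
      have e4 := mul_le_mul_of_nonneg_left ih' (sub_nonneg.mpr hc1)
      have e5 : (1 - c) * (Real.exp (-(c * j)) * (25 * k)) ≤ Real.exp (-c) * (Real.exp (-(c * j)) * (25 * k)) := by
        gcongr
      rw [e1, e3]
      linarith
  have := key (T - t1) (by omega)
  rwa [show t1 + (T - t1) = T by omega] at this

end Final4

section Gauss

/-- standard Gaussian vector -/
def gamVec (a : Type*) [Fintype a] : Measure (a → ℝ) := Measure.pi fun _ => gaussianReal 0 1
/-- standard Gaussian matrix -/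
def gamMat (a b : Type*) [Fintype a] [Fintype b] : Measure (a → b → ℝ) :=
  Measure.pi fun _ => Measure.pi fun _ => gaussianReal 0 1

variable {a a' b : Type*} [Fintype a] [Fintype b] [Fintype a']

instance : IsProbabilityMeasure (gamVec a) := by unfold gamVec; infer_instance
instance : IsProbabilityMeasure (gamMat a b) := by unfold gamMat; infer_instance

lemma gamVec_char (c : a → ℝ) :
    ∫ z, Complex.exp ((c ⬝ᵥ z : ℝ) * Complex.I) ∂(gamVec a) = Complex.exp (-(c ⬝ᵥ c : ℝ) / 2) := by
  have h := integral_fintype_prod_eq_prod (μ := fun _ : a => gaussianReal 0 1)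
    (fun i (x : ℝ) => Complex.exp (c i * x * Complex.I))
  have h2 : ∀ i, ∫ x, Complex.exp (c i * x * Complex.I) ∂(gaussianReal 0 1) = Complex.exp (-(c i * c i) / 2) := by
    intro i
    have := charFun_gaussianReal (μ := 0) (v := 1) (c i)
    rw [charFun_apply_real] at this
    rw [this]; congr 1; push_cast; ring
  simp only [h2, ← Complex.exp_sum] at h
  unfold gamVec
  refine Eq.trans (integral_congr_ae (Filter.Eventually.of_forall fun z => ?_)) (h.trans ?_)
  · simp only; congr 1; simp [dotProduct, Finset.sum_mul]
  · congr 1; simp only [dotProduct]; push_cast; rw [← Finset.sum_neg_distrib, Finset.sum_div]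

lemma gamMat_char (c : a → b → ℝ) :
    ∫ z, Complex.exp ((∑ i, c i ⬝ᵥ z i : ℝ) * Complex.I) ∂(gamMat a b) =
      Complex.exp (-(∑ i, c i ⬝ᵥ c i : ℝ) / 2) := by
  have h := integral_fintype_prod_eq_prod (μ := fun _ : a => gamVec b)
    (fun i (x : b → ℝ) => Complex.exp ((c i ⬝ᵥ x : ℝ) * Complex.I))
  simp only [gamVec_char, ← Complex.exp_sum] at h
  change ∫ z, Complex.exp ((∑ i, c i ⬝ᵥ z i : ℝ) * Complex.I) ∂(Measure.pi fun _ : a => gamVec b) = _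
  refine Eq.trans (integral_congr_ae (Filter.Eventually.of_forall fun z => ?_)) (h.trans ?_)
  · simp only; congr 1; push_cast; rw [Finset.sum_mul]
  · congr 1; push_cast; rw [← Finset.sum_neg_distrib, Finset.sum_div]

lemma gamVec_ext (ν : Measure (a → ℝ)) [IsFiniteMeasure ν]
    (h : ∀ c : a → ℝ, ∫ z, Complex.exp ((c ⬝ᵥ z : ℝ) * Complex.I) ∂ν = Complex.exp (-(c ⬝ᵥ c : ℝ) / 2)) :
    ν = gamVec a := by
  classical
  refine Measure.ext_of_charFunDual (funext fun L => ?_)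
  have e : ∀ z, L z = (fun i => L (Pi.single i 1)) ⬝ᵥ z := by
    intro z
    conv_lhs => rw [pi_eq_sum_univ' z]
    simp only [map_sum, map_smul, smul_eq_mul, dotProduct]
    refine Finset.sum_congr rfl fun i _ => ?_
    rw [mul_comm]
  rw [charFunDual_apply, charFunDual_apply]
  simp_rw [fun z => congrArg (fun x : ℝ => Complex.exp ((x : ℂ) * Complex.I)) (e z)]
  rw [h, gamVec_char]

lemma gamMat_ext (ν : Measure (a → b → ℝ)) [IsFiniteMeasure ν]
    (h : ∀ c : a → b → ℝ, ∫ z, Complex.exp ((∑ i, c i ⬝ᵥ z i : ℝ) * Complex.I) ∂ν =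
      Complex.exp (-(∑ i, c i ⬝ᵥ c i : ℝ) / 2)) :
    ν = gamMat a b := by
  classical
  refine Measure.ext_of_charFunDual (funext fun L => ?_)
  have e : ∀ z, L z = ∑ i, (fun j => L (Pi.single i (Pi.single j 1))) ⬝ᵥ z i := by
    intro z
    have : z = ∑ i, ∑ j, z i j • (Pi.single i (Pi.single j (1 : ℝ)) : a → b → ℝ) := by
      ext i j
      simp [Finset.sum_apply, Pi.single_apply, apply_ite, ite_apply]
    conv_lhs => rw [this]
    simp only [map_sum, map_smul, smul_eq_mul, dotProduct]
    simp only [mul_comm]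
  rw [charFunDual_apply, charFunDual_apply]
  simp_rw [fun z => congrArg (fun x : ℝ => Complex.exp ((x : ℂ) * Complex.I)) (e z)]
  rw [h, gamMat_char]

lemma gamVec_map [DecidableEq a'] (W : Matrix a' a ℝ) (hW : W * Wᵀ = 1) :
    (gamVec a).map (fun z => W *ᵥ z) = gamVec a' := by
  have hm : Measurable (fun z : a → ℝ => W *ᵥ z) := (by fun_prop : Continuous _).measurable
  have := Measure.isProbabilityMeasure_map (μ := gamVec a) hm.aemeasurable
  refine gamVec_ext _ fun c => ?_
  rw [integral_map hm.aemeasurable (by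
    refine Continuous.aestronglyMeasurable ?_
    unfold dotProduct; fun_prop)]
  have e : ∀ z, c ⬝ᵥ (W *ᵥ z) = (Wᵀ *ᵥ c) ⬝ᵥ z := fun z => by
    rw [Matrix.dotProduct_mulVec, Matrix.mulVec_transpose]
  simp only [e]
  rw [gamVec_char, ← e, Matrix.mulVec_mulVec, hW, Matrix.one_mulVec]

/-- matrix product on plain functions -/
def pm (P : Matrix a' a ℝ) (Z : a → b → ℝ) : a' → b → ℝ := P * (Matrix.of Z : Matrix a b ℝ)

lemma pm_cont (P : Matrix a' a ℝ) : Continuous (pm (b := b) P) := by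
  refine continuous_pi fun i => continuous_pi fun j => ?_
  simp only [pm, Matrix.mul_apply, Matrix.of_apply]; fun_prop

lemma gamMat_map [DecidableEq a'] (P : Matrix a' a ℝ) (hP : P * Pᵀ = 1) :
    (gamMat a b).map (pm P) = gamMat a' b := by
  have hm := (pm_cont (b := b) P).measurable
  have := Measure.isProbabilityMeasure_map (μ := gamMat a b) hm.aemeasurable
  refine gamMat_ext _ fun c => ?_
  have hc2 : Continuous fun z : a' → b → ℝ => Complex.exp ((∑ i, c i ⬝ᵥ z i : ℝ) * Complex.I) := by
    unfold dotProduct; fun_prop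
  rw [integral_map hm.aemeasurable hc2.aestronglyMeasurable]
  have e : ∀ Z : a → b → ℝ, ∑ i, c i ⬝ᵥ (pm P Z i) = ∑ i, (pm Pᵀ c i) ⬝ᵥ Z i := fun Z => by
    have := minner_mul_left P (Matrix.of Z) (Matrix.of c)
    rw [minner_comm, minner_comm (Matrix.of Z)] at this
    exact this
  simp only [e]
  rw [gamMat_char, ← e]
  have e3 : pm P (pm Pᵀ c) = c := by
    change P * (Pᵀ * Matrix.of c) = Matrix.of c
    rw [← Matrix.mul_assoc, hP, Matrix.one_mul]
  rw [e3]

/-- stacking on plain functions -/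
def stk {n₁ n₂ k : ℕ} (ω : (Fin n₁ → Fin k → ℝ) × (Fin n₂ → Fin k → ℝ)) : Fin n₁ ⊕ Fin n₂ → Fin k → ℝ :=
  Sum.elim ω.1 ω.2

lemma gaussPair_map (n₁ n₂ k : ℕ) : (gaussPair n₁ n₂ k).map stk = gamMat (Fin n₁ ⊕ Fin n₂) (Fin k) := by
  have h := (measurePreserving_sumPiEquivProdPi_symm (X := fun _ : Fin n₁ ⊕ Fin n₂ => Fin k → ℝ)
    (fun _ => gamVec (Fin k))).map_eq
  change Measure.map _ (gaussPair n₁ n₂ k) = gamMat _ _ at h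
  rw [← h]
  congr 1

lemma stk_cont {n₁ n₂ k : ℕ} : Continuous (stk : (Fin n₁ → Fin k → ℝ) × (Fin n₂ → Fin k → ℝ) → _) := by
  refine continuous_pi fun i => ?_
  rcases i with i | i <;> simp only [stk, Sum.elim_inl, Sum.elim_inr] <;> fun_prop

lemma gpdf (c x : ℝ) : gaussianPDFReal 0 1 x * Real.exp (c * x ^ 2) =
    (Real.sqrt (2 * Real.pi))⁻¹ * Real.exp (-(1 / 2 - c) * x ^ 2) := by
  rw [gaussianPDFReal, mul_assoc, ← Real.exp_add]
  simp only [NNReal.coe_one, mul_one, sub_zero]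
  congr 2; ring

lemma gsq_int {c : ℝ} (hc : c < 1 / 2) : Integrable (fun x => Real.exp (c * x ^ 2)) (gaussianReal 0 1) := by
  rw [gaussianReal_of_var_ne_zero _ one_ne_zero, integrable_withDensity_iff_integrable_smul' (measurable_gaussianPDF _ _)
    (Filter.Eventually.of_forall fun x => by simp [gaussianPDF])]
  have : ∀ x, (gaussianPDF 0 1 x).toReal • Real.exp (c * x ^ 2) =
      (Real.sqrt (2 * Real.pi))⁻¹ * Real.exp (-(1 / 2 - c) * x ^ 2) := by
    intro x
    rw [gaussianPDF, ENNReal.toReal_ofReal (gaussianPDFReal_nonneg _ _ _), smul_eq_mul, gpdf]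
  simp only [this]
  exact (integrable_exp_neg_mul_sq (by linarith)).const_mul _

lemma gsq {c : ℝ} (hc : c < 1 / 2) : ∫ x, Real.exp (c * x ^ 2) ∂(gaussianReal 0 1) = (Real.sqrt (1 - 2 * c))⁻¹ := by
  rw [integral_gaussianReal_eq_integral_smul one_ne_zero]
  simp only [smul_eq_mul, gpdf]
  rw [integral_const_mul, integral_gaussian, ← Real.sqrt_inv, ← Real.sqrt_inv, ← Real.sqrt_mul (by positivity)]
  congr 1
  have := Real.pi_pos
  have h : 1 - 2 * c ≠ 0 := by intro h; linarith
  have h' : 1 / 2 - c ≠ 0 := by intro h; linarith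
  field_simp

lemma g1sq_int {c : ℝ} (hc : c < 1 / 2) :
    Integrable (fun z : a → ℝ => Real.exp (c * euclNorm z ^ 2)) (gamVec a) := by
  have : ∀ z : a → ℝ, Real.exp (c * euclNorm z ^ 2) = ∏ i, Real.exp (c * z i ^ 2) := fun z => by
    rw [← Real.exp_sum, euclNorm, Real.sq_sqrt (Finset.sum_nonneg fun i _ => sq_nonneg _), Finset.mul_sum]
  simp only [this]
  exact Integrable.fintype_prod fun i => gsq_int hc

lemma g1sq {c : ℝ} (hc : c < 1 / 2) :
    ∫ z, Real.exp (c * euclNorm z ^ 2) ∂(gamVec a) = (Real.sqrt (1 - 2 * c))⁻¹ ^ Fintype.card a := by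
  have : ∀ z : a → ℝ, Real.exp (c * euclNorm z ^ 2) = ∏ i, Real.exp (c * z i ^ 2) := fun z => by
    rw [← Real.exp_sum, euclNorm, Real.sq_sqrt (Finset.sum_nonneg fun i _ => sq_nonneg _), Finset.mul_sum]
  simp only [this]
  have h := integral_fintype_prod_eq_pow (ι := a) (fun x => Real.exp (c * x ^ 2)) (μ := gaussianReal 0 1)
  rw [gsq hc] at h
  exact h

end Gauss

section Gauss2
variable {a a' b : Type*} [Fintype a] [Fintype b] [Fintype a']

lemma nv_cont : Continuous (euclNorm : (a → ℝ) → ℝ) := by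
  unfold euclNorm; fun_prop

lemma chern_up (R : ℝ) : (gamVec a).real {z | R ≤ euclNorm z ^ 2} ≤ Real.exp (-(R / 4)) * Real.sqrt 2 ^ Fintype.card a := by
  have h := mul_meas_ge_le_integral_of_nonneg (μ := gamVec a) (f := fun z => Real.exp (1 / 4 * euclNorm z ^ 2))
    (Filter.Eventually.of_forall fun z => (Real.exp_pos _).le) (g1sq_int (by norm_num)) (Real.exp (R / 4))
  rw [g1sq (by norm_num)] at h
  have e : (Real.sqrt (1 - 2 * (1 / 4)))⁻¹ = Real.sqrt 2 := by
    rw [← Real.sqrt_inv]; norm_num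
  rw [e] at h
  have hs : {z : a → ℝ | R ≤ euclNorm z ^ 2} ⊆ {z | Real.exp (R / 4) ≤ Real.exp (1 / 4 * euclNorm z ^ 2)} := by
    intro z hz
    simp only [Set.mem_setOf_eq] at hz ⊢
    rw [Real.exp_le_exp]; linarith
  have h2 := measureReal_mono (μ := gamVec a) hs
  rw [Real.exp_neg, ← div_eq_inv_mul, le_div_iff₀' (Real.exp_pos _)]
  exact le_trans (by gcongr) h

lemma chern_low {d : ℕ} (hd : 1 ≤ d) {t : ℝ} (ht : 0 < t) :
    (gamVec (Fin d)).real {z | euclNorm z < t} ≤ (2 * (t / Real.sqrt d)) ^ d := by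
  have hd' : (0 : ℝ) < d := by exact_mod_cast hd
  set c : ℝ := d / (2 * t ^ 2) with hc
  have hc0 : 0 < c := by positivity
  have h := mul_meas_ge_le_integral_of_nonneg (μ := gamVec (Fin d)) (f := fun z => Real.exp (-c * euclNorm z ^ 2))
    (Filter.Eventually.of_forall fun z => (Real.exp_pos _).le) (g1sq_int (by linarith)) (Real.exp (-(d / 2)))
  rw [g1sq (by linarith), Fintype.card_fin] at h
  have hs : {z : Fin d → ℝ | euclNorm z < t} ⊆ {z | Real.exp (-(d / 2)) ≤ Real.exp (-c * euclNorm z ^ 2)} := by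
    intro z hz
    simp only [Set.mem_setOf_eq] at hz ⊢
    rw [Real.exp_le_exp]
    have : euclNorm z ^ 2 ≤ t ^ 2 := by have := nv_nonneg z; gcongr
    have h2 : c * euclNorm z ^ 2 ≤ c * t ^ 2 := by gcongr
    have h3 : c * t ^ 2 = d / 2 := by rw [hc]; field_simp
    linarith
  have h2 := measureReal_mono (μ := gamVec (Fin d)) hs
  have h3 : (Real.sqrt (1 - 2 * -c))⁻¹ ≤ t / Real.sqrt d := by
    have : (Real.sqrt d / t) ≤ Real.sqrt (1 - 2 * -c) := by
      apply Real.le_sqrt_of_sq_le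
      rw [div_pow, Real.sq_sqrt hd'.le, hc]
      have : (d : ℝ) / t ^ 2 = 2 * (d / (2 * t ^ 2)) := by field_simp
      linarith
    rw [← inv_div]
    gcongr
  have h4 : Real.exp (-(d / 2)) * (gamVec (Fin d)).real {z | euclNorm z < t} ≤ (t / Real.sqrt d) ^ d := by
    refine (by gcongr : _ ≤ Real.exp (-(d / 2)) * _).trans (h.trans ?_)
    gcongr
  have h5 : (1 / 2 : ℝ) ^ d ≤ Real.exp (-(d / 2)) := by
    have : Real.exp (-(d / 2 : ℝ)) = Real.exp (-(1 / 2)) ^ d := by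
      rw [← Real.exp_nat_mul]; congr 1; ring
    rw [this]; gcongr
    linarith [Real.add_one_le_exp (-(1 / 2 : ℝ))]
  have h6 : (1 / 2 : ℝ) ^ d * (gamVec (Fin d)).real {z | euclNorm z < t} ≤ (t / Real.sqrt d) ^ d :=
    le_trans (by gcongr) h4
  rw [mul_pow]
  have h7 : (2 : ℝ) ^ d * (1 / 2) ^ d = 1 := by rw [← mul_pow]; norm_num
  calc _ = 2 ^ d * ((1 / 2 : ℝ) ^ d * (gamVec (Fin d)).real {z | euclNorm z < t}) := by
        rw [← mul_assoc, h7, one_mul]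
    _ ≤ _ := by gcongr

lemma gtail {t : ℝ} (ht : 0 ≤ t) : Real.exp (-(t ^ 2) - 2) ≤ (gaussianReal 0 1).real (Set.Ioi t) := by
  have h1 : (gaussianReal 0 1).real (Set.Ioc t (t + 1)) ≤ (gaussianReal 0 1).real (Set.Ioi t) :=
    measureReal_mono fun x hx => hx.1
  refine le_trans ?_ h1
  rw [Measure.real, gaussianReal_apply_eq_integral _ one_ne_zero, ENNReal.toReal_ofReal
    (integral_nonneg fun x => gaussianPDFReal_nonneg _ _ _)]
  have h2 : ∀ x ∈ Set.Ioc t (t + 1), Real.exp (-(t ^ 2) - 2) ≤ gaussianPDFReal 0 1 x := by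
    intro x hx
    rw [gaussianPDFReal]
    simp only [NNReal.coe_one, mul_one, sub_zero]
    have e1 : Real.exp (-1) ≤ (Real.sqrt (2 * Real.pi))⁻¹ := by
      rw [Real.exp_neg]
      gcongr
      rw [Real.sqrt_le_left (Real.exp_pos _).le]
      have := Real.exp_one_gt_d9
      have := Real.pi_lt_d2
      nlinarith
    have e2 : Real.exp (-(t ^ 2) - 1) ≤ Real.exp (-x ^ 2 / 2) := by
      rw [Real.exp_le_exp]
      have : x ^ 2 ≤ (t + 1) ^ 2 := by
        have := hx.1.le; have := hx.2; gcongr; linarith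
      nlinarith [sq_nonneg (t - 1)]
    calc Real.exp (-(t ^ 2) - 2) = Real.exp (-1) * Real.exp (-(t ^ 2) - 1) := by
          rw [← Real.exp_add]; congr 1; ring
      _ ≤ _ := by gcongr
  have h3 := setIntegral_mono_on (μ := volume) (s := Set.Ioc t (t + 1)) (f := fun _ => Real.exp (-(t ^ 2) - 2))
    (g := gaussianPDFReal 0 1) (by simp) (integrable_gaussianPDFReal _ _).integrableOn measurableSet_Ioc h2
  simpa using h3

lemma g_dot (x : a → ℝ) (hx : euclNorm x = 1) : (gamVec a).map (fun z => x ⬝ᵥ z) = gaussianReal 0 1 := by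
  have h1 : (Matrix.of fun (_ : Fin 1) => x) * (Matrix.of fun (_ : Fin 1) => x)ᵀ = 1 := by
    ext i j
    have : x ⬝ᵥ x = 1 := by rw [← nv_sq, hx]; norm_num
    simp only [Matrix.mul_apply, Matrix.of_apply, Matrix.transpose_apply]
    rw [Subsingleton.elim i j, Matrix.one_apply_eq]; exact this
  have h2 := gamVec_map _ h1
  have h3 : (gamVec (Fin 1)).map (fun z => z 0) = gaussianReal 0 1 :=
    (measurePreserving_eval (fun _ : Fin 1 => gaussianReal 0 1) 0).map_eq
  rw [← h3, ← h2, Measure.map_map (by fun_prop) ((by fun_prop : Continuous _).measurable)]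
  rfl

/-- the auxiliary Gaussian lower bound -/
lemma pz {d k : ℕ} (hd : 1 ≤ d) (hdk : d ≤ k) (hr : Fintype.card a ≤ k) (x : a → ℝ) (hx : euclNorm x = 1) :
    Real.exp (-(d : ℝ) - 3) ≤ (gamVec a).real {z | Real.sqrt d < x ⬝ᵥ z ∧ euclNorm z ^ 2 < 20 * k} := by
  have h1 : Real.exp (-(d : ℝ) - 2) ≤ (gamVec a).real {z | Real.sqrt d < x ⬝ᵥ z} := by
    have := gtail (Real.sqrt_nonneg d)
    rw [Real.sq_sqrt (by positivity), ← g_dot x hx, map_measureReal_apply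
      ((by unfold dotProduct; fun_prop : Continuous _).measurable) measurableSet_Ioi] at this
    exact this
  have h2 := chern_up (a := a) (20 * k)
  have h3 : (gamVec a).real {z | Real.sqrt d < x ⬝ᵥ z} ≤
      (gamVec a).real {z | Real.sqrt d < x ⬝ᵥ z ∧ euclNorm z ^ 2 < 20 * k} + (gamVec a).real {z | 20 * k ≤ euclNorm z ^ 2} := by
    refine le_trans (measureReal_mono ?_) (measureReal_union_le _ _)
    intro z hz
    by_cases h : euclNorm z ^ 2 < 20 * k
    · exact Or.inl ⟨hz, h⟩
    · exact Or.inr (not_lt.mp h)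
  have h4 : Real.exp (-(20 * k / 4)) * Real.sqrt 2 ^ Fintype.card a ≤ 1 / 2 * Real.exp (-(d : ℝ) - 2) := by
    have hd' : (d : ℝ) ≤ k := by exact_mod_cast hdk
    have hk : (1 : ℝ) ≤ k := by exact_mod_cast hd.trans hdk
    have e1 : Real.sqrt 2 ^ Fintype.card a ≤ Real.exp (1 / 2) ^ k := by
      have e2 : Real.sqrt 2 ≤ Real.exp (1 / 2) := by
        rw [Real.sqrt_le_left (Real.exp_pos _).le, ← Real.exp_nat_mul]
        have := Real.exp_one_gt_d9
        norm_num; linarith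
      calc Real.sqrt 2 ^ Fintype.card a ≤ Real.exp (1 / 2) ^ Fintype.card a := by gcongr
        _ ≤ _ := pow_le_pow_right₀ (Real.one_le_exp (by norm_num)) hr
    have e3 : (1 / 2 : ℝ) ≥ Real.exp (-1) := by
      rw [Real.exp_neg, ge_iff_le, one_div]
      gcongr
      linarith [Real.exp_one_gt_d9]
    calc _ ≤ Real.exp (-(20 * k / 4)) * Real.exp (1 / 2) ^ k := by gcongr
      _ = Real.exp (-(9 / 2 * k)) := by rw [← Real.exp_nat_mul, ← Real.exp_add]; congr 1; ring
      _ ≤ Real.exp (-1 + (-(d : ℝ) - 2)) := by rw [Real.exp_le_exp]; linarith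
      _ ≤ _ := by rw [Real.exp_add]; gcongr
  have h5 : Real.exp (-(d : ℝ) - 3) ≤ 1 / 2 * Real.exp (-(d : ℝ) - 2) := by
    have e3 : (1 / 2 : ℝ) ≥ Real.exp (-1) := by
      rw [Real.exp_neg, ge_iff_le, one_div]
      gcongr
      linarith [Real.exp_one_gt_d9]
    calc _ = Real.exp (-1) * Real.exp (-(d : ℝ) - 2) := by rw [← Real.exp_add]; congr 1; ring
      _ ≤ _ := by gcongr
  linarith

lemma fub {Ω Ω' : Type*} [MeasurableSpace Ω] [MeasurableSpace Ω'] (μ : Measure Ω) (ν : Measure Ω')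
    [IsProbabilityMeasure μ] [IsProbabilityMeasure ν] {S : Set (Ω × Ω')} (hS : MeasurableSet S)
    {B : Set Ω} (hB : MeasurableSet B) {p q : ℝ} (hp : 0 < p) 
    (h1 : ∀ x ∈ B, p ≤ ν.real {y | (x, y) ∈ S}) (h2 : ∀ y, μ.real {x | (x, y) ∈ S} ≤ q) :
    μ.real B ≤ q / p := by
  rw [le_div_iff₀ hp]
  have hq : 0 ≤ q := measureReal_nonneg.trans (h2 (Classical.choice ν.nonempty_of_neZero))
  have a1 : ENNReal.ofReal p * μ B ≤ (μ.prod ν) S := by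
    rw [Measure.prod_apply hS, ← setLIntegral_const]
    refine le_trans (setLIntegral_mono_ae ?_ ?_) (setLIntegral_le_lintegral B _)
    · exact (measurable_measure_prodMk_left hS).aemeasurable
    · refine Filter.Eventually.of_forall fun x hx => ?_
      exact ENNReal.ofReal_le_of_le_toReal (h1 x hx)
  have a2 : (μ.prod ν) S ≤ ENNReal.ofReal q := by
    rw [Measure.prod_apply_symm hS]
    refine (lintegral_mono (g := fun _ => ENNReal.ofReal q) fun y => ?_).trans (by simp)
    exact (ENNReal.le_ofReal_iff_toReal_le (measure_ne_top _ _) hq).mpr (h2 y)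
  have a3 := ENNReal.toReal_mono ENNReal.ofReal_ne_top (a1.trans a2)
  rw [ENNReal.toReal_mul, ENNReal.toReal_ofReal hp.le, ENNReal.toReal_ofReal hq] at a3
  rw [mul_comm]; exact a3

end Gauss2

section Prob
variable {a b : Type*} [Fintype a] [Fintype b]

/-- transpose times vector on plain functions -/
def tv (Z : a → b → ℝ) (u : a → ℝ) : b → ℝ := fun j => ∑ i, Z i j * u i
/-- matrix times vector on plain functions -/
def zv (Z : a → b → ℝ) (z : b → ℝ) : a → ℝ := fun i => ∑ j, Z i j * z j

lemma tv_eq (Z : a → b → ℝ) (u : a → ℝ) : tv Z u = (Matrix.of Z)ᵀ *ᵥ u := rfl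
lemma zv_eq (Z : a → b → ℝ) (u : b → ℝ) : zv Z u = (Matrix.of Z) *ᵥ u := rfl

lemma zv_law (z : b → ℝ) (hz : euclNorm z = 1) : (gamMat a b).map (fun Z => zv Z z) = gamVec a := by
  have h := measurePreserving_pi (fun _ : a => gamVec b) (fun _ : a => gaussianReal 0 1)
    (f := fun _ x => z ⬝ᵥ x) (fun _ => ⟨(by unfold dotProduct; fun_prop : Continuous _).measurable, g_dot z hz⟩)
  have := h.map_eq
  change Measure.map _ (gamMat a b) = gamVec a at this
  rw [← this]
  congr 1
  funext Z i
  simp [zv, dotProduct, mul_comm]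

lemma zv_tail (z : b → ℝ) {k : ℕ} {R : ℝ} (hR : 0 ≤ R) (hz : euclNorm z ^ 2 < 20 * k) :
    (gamMat a b).real {Z | R * Real.sqrt k < euclNorm (zv Z z)} ≤
      Real.exp (-(R ^ 2 / 80)) * Real.sqrt 2 ^ Fintype.card a := by
  by_cases h0 : euclNorm z = 0
  · have : {Z : a → b → ℝ | R * Real.sqrt k < euclNorm (zv Z z)} = ∅ := by
      ext Z
      simp only [Set.mem_setOf_eq, Set.mem_empty_iff_false, iff_false, not_lt]
      rw [nv_eq_zero h0, zv_eq, Matrix.mulVec_zero, nv_zero]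
      positivity
    rw [this, measureReal_empty]
    positivity
  have hp : 0 < euclNorm z := lt_of_le_of_ne (nv_nonneg _) (Ne.symm h0)
  have h1 := chern_up (a := a) (R ^ 2 / 20)
  have hnm : Measurable (euclNorm : (a → ℝ) → ℝ) := nv_cont.measurable
  have hc : Continuous (fun Z : a → b → ℝ => zv Z ((euclNorm z)⁻¹ • z)) := by
    unfold zv; fun_prop
  rw [← zv_law (b := b) ((euclNorm z)⁻¹ • z) (by rw [nv_smul, abs_of_pos (by positivity)]; field_simp),
    map_measureReal_apply hc.measurable (measurableSet_le measurable_const (by fun_prop : Measurable fun z : a → ℝ => euclNorm z ^ 2))] at h1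
  have e : R ^ 2 / 20 / 4 = R ^ 2 / 80 := by ring
  rw [e] at h1
  refine le_trans (measureReal_mono ?_) h1
  intro Z hZ
  simp only [Set.mem_setOf_eq, Set.mem_preimage] at hZ ⊢
  rw [zv_eq, Matrix.mulVec_smul, nv_smul, abs_of_pos (by positivity), mul_pow, ← zv_eq, inv_pow,
    ← div_eq_inv_mul, le_div_iff₀ (by positivity)]
  have h2 : (R * Real.sqrt k) ^ 2 ≤ euclNorm (zv Z z) ^ 2 := by gcongr
  rw [mul_pow, Real.sq_sqrt (by positivity)] at h2
  have h3 : R ^ 2 / 20 * euclNorm z ^ 2 ≤ R ^ 2 / 20 * (20 * k) := by gcongr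
  linarith

lemma op_tail {k N : ℕ} (hk : 1 ≤ k) (hN : Fintype.card a ≤ N) (hkN : k ≤ N) :
    IsOpen {Z : a → Fin k → ℝ | ∃ u, euclNorm u = 1 ∧ 14 * Real.sqrt N < euclNorm (tv Z u)} ∧
    (gamMat a (Fin k)).real {Z | ∃ u, euclNorm u = 1 ∧ 14 * Real.sqrt N < euclNorm (tv Z u)} ≤
      Real.exp 3 * Real.exp (-(k : ℝ)) := by
  have hB : IsOpen {Z : a → Fin k → ℝ | ∃ u, euclNorm u = 1 ∧ 14 * Real.sqrt N < euclNorm (tv Z u)} := by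
    simp only [Set.setOf_exists]
    refine isOpen_iUnion fun u => ?_
    by_cases hu : euclNorm u = 1
    · simp only [hu, true_and]
      refine isOpen_lt continuous_const (nv_cont.comp ?_)
      unfold tv; fun_prop
    · simp [hu]
  refine ⟨hB, ?_⟩
  have hkN' : (k : ℝ) ≤ N := by exact_mod_cast hkN
  have key := fub (gamMat a (Fin k)) (gamVec (Fin k))
    (S := {p | 14 * Real.sqrt N * Real.sqrt k < euclNorm (zv p.1 p.2) ∧ euclNorm p.2 ^ 2 < 20 * k})
    (IsOpen.measurableSet (by
      refine IsOpen.inter (isOpen_lt continuous_const (nv_cont.comp ?_))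
        (isOpen_lt ((nv_cont.comp continuous_snd).pow 2) continuous_const)
      unfold zv; fun_prop)) hB.measurableSet (Real.exp_pos (-(k : ℝ) - 3)) (q := Real.exp (-(2 * N))) ?_ ?_
  · refine key.trans ?_
    rw [← Real.exp_sub, ← Real.exp_add, Real.exp_le_exp]
    linarith
  · rintro Z ⟨u, hu, hZ⟩
    have hp : 0 < euclNorm (tv Z u) := lt_of_le_of_lt (by positivity) hZ
    refine (pz hk le_rfl (by simp) ((euclNorm (tv Z u))⁻¹ • tv Z u) (by
      rw [nv_smul, abs_of_pos (by positivity)]; field_simp)).trans (measureReal_mono ?_)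
    rintro z ⟨h1, h2⟩
    refine ⟨?_, h2⟩
    rw [smul_dotProduct, smul_eq_mul, ← div_eq_inv_mul, lt_div_iff₀ hp] at h1
    have h3 := dot_le u (zv Z z)
    rw [hu, one_mul, zv_eq, dot_mulVec_comm, ← tv_eq, ← zv_eq] at h3
    refine lt_of_lt_of_le ?_ h3
    refine lt_of_le_of_lt ?_ h1
    rw [mul_comm]
    gcongr
  · intro z
    by_cases hz : euclNorm z ^ 2 < 20 * k
    · refine (measureReal_mono (s₂ := {Z | 14 * Real.sqrt N * Real.sqrt k < euclNorm (zv Z z)})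
        (fun Z hZ => hZ.1)).trans ((zv_tail z (by positivity) hz).trans ?_)
      have e1 : Real.sqrt 2 ≤ Real.exp (9 / 20) := by
        refine le_trans ?_ (Real.add_one_le_exp _)
        rw [Real.sqrt_le_left (by norm_num)]; norm_num
      have e2 : Real.sqrt 2 ^ Fintype.card a ≤ Real.exp (9 / 20) ^ N :=
        calc Real.sqrt 2 ^ Fintype.card a ≤ Real.exp (9 / 20) ^ Fintype.card a := by gcongr
          _ ≤ _ := pow_le_pow_right₀ (Real.one_le_exp (by norm_num)) hN
      calc _ ≤ Real.exp (-((14 * Real.sqrt N) ^ 2 / 80)) * Real.exp (9 / 20) ^ N := by gcongr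
        _ = Real.exp (-(2 * N)) := by
          rw [← Real.exp_nat_mul, ← Real.exp_add, mul_pow, Real.sq_sqrt (by positivity)]
          congr 1; ring
    · have : {Z : a → Fin k → ℝ | (Z, z) ∈ {p : (a → Fin k → ℝ) × (Fin k → ℝ) | 14 * Real.sqrt N * Real.sqrt k < euclNorm (zv p.1 p.2) ∧ euclNorm p.2 ^ 2 < 20 * k}} = ∅ := by
        ext Z; simp only [Set.mem_setOf_eq, hz, and_false, Set.mem_empty_iff_false]
      rw [this, measureReal_empty]; positivity

/-- an orthogonal matrix with prescribed first row -/
lemma exists_orth {r : ℕ} (z : Fin (r + 1) → ℝ) (hz : euclNorm z = 1) :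
    ∃ W : Matrix (Fin (r + 1)) (Fin (r + 1)) ℝ, W * Wᵀ = 1 ∧ W 0 = z := by
  obtain ⟨B, hB⟩ := Orthonormal.exists_orthonormalBasis_extension_of_card_eq (𝕜 := ℝ)
    (E := EuclideanSpace ℝ (Fin (r + 1))) (ι := Fin (r + 1)) (by simp)
    (v := fun _ => WithLp.toLp 2 z) (s := {0}) (by
      constructor
      · intro i; simp only [Set.restrict_apply]; rw [← nv_eq, hz]
      · intro i j hij
        exact absurd (Subtype.ext ((Set.mem_singleton_iff.mp i.2).trans (Set.mem_singleton_iff.mp j.2).symm)) hij)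
  refine ⟨Matrix.of fun i j => (B i) j, ?_, ?_⟩
  · ext i j
    have := orthonormal_iff_ite.mp B.orthonormal i j
    simp only [Matrix.mul_apply, Matrix.of_apply, Matrix.transpose_apply, Matrix.one_apply]
    rw [← this, PiLp.inner_apply]
    simp [mul_comm]
  · have := hB 0 rfl
    funext j
    simp [this]

/-- orthonormal rows orthogonal to few vectors -/
lemma exists_perp {r k d : ℕ} (hd : d + r ≤ k) (G : Fin r → Fin k → ℝ) :
    ∃ W : Matrix (Fin d) (Fin k) ℝ, W * Wᵀ = 1 ∧ ∀ j, W *ᵥ G j = 0 := by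
  obtain ⟨v, hv, hp⟩ : ∃ v : Fin d → EuclideanSpace ℝ (Fin k), Orthonormal ℝ v ∧
      ∀ i j, inner ℝ (WithLp.toLp 2 (G j)) (v i) = 0 := by
    let E : Submodule ℝ (EuclideanSpace ℝ (Fin k)) := Submodule.span ℝ (Set.range fun j => WithLp.toLp 2 (G j))
    have hE : Module.finrank ℝ E ≤ r := by
      have := finrank_range_le_card (R := ℝ) (fun j => (WithLp.toLp 2 (G j) : EuclideanSpace ℝ (Fin k)))
      rw [Fintype.card_fin] at this
      exact this
    have hE2 := E.finrank_add_finrank_orthogonal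
    rw [finrank_euclideanSpace_fin] at hE2
    have hd2 : d ≤ Module.finrank ℝ Eᗮ := by omega
    refine ⟨fun i => (stdOrthonormalBasis ℝ Eᗮ (Fin.castLE hd2 i) : EuclideanSpace ℝ (Fin k)), ?_, ?_⟩
    · exact ((stdOrthonormalBasis ℝ Eᗮ).orthonormal.comp _ (Fin.castLE_injective hd2)).comp_linearIsometry
        (Eᗮ).subtypeₗᵢ
    · intro i j
      exact (Submodule.mem_orthogonal _ _).mp (stdOrthonormalBasis ℝ Eᗮ (Fin.castLE hd2 i)).2 _
        (Submodule.subset_span ⟨j, rfl⟩)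
  refine ⟨Matrix.of fun i j => v i j, ?_, ?_⟩
  · ext i j
    have := orthonormal_iff_ite.mp hv i j
    simp only [Matrix.mul_apply, Matrix.of_apply, Matrix.transpose_apply, Matrix.one_apply]
    rw [← this, PiLp.inner_apply]
    simp [mul_comm]
  · intro j
    funext i
    have := hp i j
    rw [PiLp.inner_apply] at this
    simpa [Matrix.mulVec, dotProduct, mul_comm] using this

lemma slice {Ω Ω' : Type*} [MeasurableSpace Ω] [MeasurableSpace Ω'] (μ : Measure Ω) (ν : Measure Ω')
    [IsProbabilityMeasure μ] [IsProbabilityMeasure ν] {S : Set (Ω × Ω')} (hS : MeasurableSet S) {q : ℝ}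
    (h2 : ∀ y, μ.real {x | (x, y) ∈ S} ≤ q) : (μ.prod ν).real S ≤ q := by
  have hq : 0 ≤ q := measureReal_nonneg.trans (h2 (Classical.choice ν.nonempty_of_neZero))
  have a2 : (μ.prod ν) S ≤ ENNReal.ofReal q := by
    rw [Measure.prod_apply_symm hS]
    refine (lintegral_mono (g := fun _ => ENNReal.ofReal q) fun y => ?_).trans (by simp)
    exact (ENNReal.le_ofReal_iff_toReal_le (measure_ne_top _ _) hq).mpr (h2 y)
  exact ENNReal.toReal_le_of_le_ofReal hq a2

lemma row_slice {r k d : ℕ} (hd : 1 ≤ d) (hdk : d + r ≤ k) {t : ℝ} (ht : 0 < t) (G : Fin r → Fin k → ℝ) :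
    (gamVec (Fin k)).real {g | ∃ y : Fin r → ℝ, euclNorm (g + tv G y) < t} ≤ (2 * (t / Real.sqrt d)) ^ d := by
  obtain ⟨W, hW, hWG⟩ := exists_perp hdk G
  have h := chern_low hd ht
  rw [← gamVec_map W hW, map_measureReal_apply (by fun_prop : Continuous _).measurable
    (measurableSet_lt nv_cont.measurable measurable_const)] at h
  refine le_trans (measureReal_mono ?_) h
  rintro g ⟨y, hy⟩
  simp only [Set.mem_preimage, Set.mem_setOf_eq]
  have e1 : W *ᵥ tv G y = 0 := by
    have : tv G y = ∑ j, y j • G j := by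
      funext i; simp [tv, Finset.sum_apply, mul_comm]
    rw [this, Matrix.mulVec_sum]
    simp [Matrix.mulVec_smul, hWG]
  have e2 : W *ᵥ g = W *ᵥ (g + tv G y) := by rw [Matrix.mulVec_add, e1, add_zero]
  rw [e2]
  refine lt_of_le_of_lt ?_ hy
  open scoped Matrix.Norms.L2Operator in
  have h3 := nv_mulVec W (g + tv G y)
  have h4 := orth_opn_le Wᵀ (by rwa [Matrix.transpose_transpose])
  rw [opn_transpose] at h4
  nlinarith [nv_nonneg (g + tv G y)]

lemma tv_succ {r k : ℕ} (G : Fin (r + 1) → Fin k → ℝ) (y : Fin (r + 1) → ℝ) :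
    tv G y = y 0 • G 0 + tv (fun i => G (Fin.succ i)) (fun i => y (Fin.succ i)) := by
  funext j
  simp [tv, Fin.sum_univ_succ, mul_comm]

lemma q_tail {r k d : ℕ} (hd : 1 ≤ d) (hdk : d + r ≤ k) {t : ℝ} (ht : 0 < t) :
    (gamMat (Fin (r + 1)) (Fin k)).real {G | ∃ y, y 0 = 1 ∧ euclNorm (tv G y) < t} ≤ (2 * (t / Real.sqrt d)) ^ d := by
  have hmp := measurePreserving_piFinSuccAbove (n := r) (α := fun _ => Fin k → ℝ) (fun _ => gamVec (Fin k)) 0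
  set S : Set ((Fin k → ℝ) × (Fin r → Fin k → ℝ)) := {p | ∃ y : Fin r → ℝ, euclNorm (p.1 + tv p.2 y) < t} with hS
  have hSo : IsOpen S := by
    rw [hS]
    simp only [Set.setOf_exists]
    refine isOpen_iUnion fun u => isOpen_lt (nv_cont.comp ?_) continuous_const
    unfold tv; fun_prop
  have h1 := slice (gamVec (Fin k)) (Measure.pi fun _ : Fin r => gamVec (Fin k)) hSo.measurableSet
    (fun G => row_slice hd hdk ht G)
  rw [← hmp.measureReal_preimage hSo.measurableSet.nullMeasurableSet] at h1
  refine le_trans (measureReal_mono ?_) h1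
  rintro G ⟨y, hy0, hy⟩
  refine ⟨fun i => y i.succ, ?_⟩
  rw [tv_succ, hy0, one_smul] at hy
  exact hy

lemma sv_tail {r k d : ℕ} (hd : d + r = k) (hd1 : 1 ≤ d) {ε : ℝ} (hε : 0 < ε) :
    IsOpen {G : Fin (r + 1) → Fin k → ℝ | ∃ x, euclNorm x = 1 ∧ euclNorm (tv G x) < ε * d / Real.sqrt k} ∧
    (gamMat (Fin (r + 1)) (Fin k)).real {G | ∃ x, euclNorm x = 1 ∧ euclNorm (tv G x) < ε * d / Real.sqrt k} ≤
      (Real.exp 4 * 10 * ε) ^ d := by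
  have hB : IsOpen {G : Fin (r + 1) → Fin k → ℝ | ∃ x, euclNorm x = 1 ∧ euclNorm (tv G x) < ε * d / Real.sqrt k} := by
    simp only [Set.setOf_exists]
    refine isOpen_iUnion fun u => ?_
    by_cases hu : euclNorm u = 1
    · simp only [hu, true_and]
      refine isOpen_lt (nv_cont.comp ?_) continuous_const
      unfold tv; fun_prop
    · simp [hu]
  refine ⟨hB, ?_⟩
  have hk : 1 ≤ k := by omega
  have hk0 : (0 : ℝ) < k := by exact_mod_cast hk
  have hd0 : (0 : ℝ) < d := by exact_mod_cast hd1
  set s : ℝ := ε * d / Real.sqrt k with hs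
  have hs0 : 0 < s := by positivity
  set S : Set ((Fin (r + 1) → Fin k → ℝ) × (Fin (r + 1) → ℝ)) :=
    {p | ∃ x, euclNorm x = 1 ∧ euclNorm (tv p.1 x) < s ∧ Real.sqrt d < x ⬝ᵥ p.2 ∧ euclNorm p.2 ^ 2 < 20 * k} with hS
  have hSo : IsOpen S := by
    rw [hS]
    simp only [Set.setOf_exists]
    refine isOpen_iUnion fun u => ?_
    by_cases hu : euclNorm u = 1
    · simp only [hu, true_and]
      have o1 : IsOpen {p : (Fin (r + 1) → Fin k → ℝ) × (Fin (r + 1) → ℝ) | euclNorm (tv p.1 u) < s} :=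
        isOpen_lt (nv_cont.comp (by unfold tv; fun_prop)) continuous_const
      have o2 : IsOpen {p : (Fin (r + 1) → Fin k → ℝ) × (Fin (r + 1) → ℝ) | Real.sqrt d < u ⬝ᵥ p.2} :=
        isOpen_lt continuous_const (by unfold dotProduct; fun_prop)
      have o3 : IsOpen {p : (Fin (r + 1) → Fin k → ℝ) × (Fin (r + 1) → ℝ) | euclNorm p.2 ^ 2 < 20 * k} :=
        isOpen_lt ((nv_cont.comp continuous_snd).pow 2) continuous_const
      exact o1.inter (o2.inter o3)
    · simp [hu]
  set t : ℝ := s * Real.sqrt (20 * k) / Real.sqrt d with ht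
  have ht0 : 0 < t := by positivity
  have key := fub (gamMat (Fin (r + 1)) (Fin k)) (gamVec (Fin (r + 1))) hSo.measurableSet hB.measurableSet
    (Real.exp_pos (-(d : ℝ) - 3)) (q := (2 * (t / Real.sqrt d)) ^ d) ?_ ?_
  · refine key.trans ?_
    have e1 : 2 * (t / Real.sqrt d) ≤ 10 * ε := by
      have h20 : Real.sqrt (20 * k) ≤ 5 * Real.sqrt k := by
        rw [Real.sqrt_le_left (by positivity), mul_pow, Real.sq_sqrt hk0.le]; linarith
      have hk1 : 0 < Real.sqrt k := by positivity
      calc 2 * (t / Real.sqrt d) = 2 * (s * Real.sqrt (20 * k) / (Real.sqrt d * Real.sqrt d)) := by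
            rw [ht]; field_simp
        _ ≤ 2 * (s * (5 * Real.sqrt k) / (Real.sqrt d * Real.sqrt d)) := by gcongr
        _ = 10 * ε := by rw [Real.mul_self_sqrt hd0.le, hs]; field_simp; ring
    have e2 : (Real.exp (-(d : ℝ) - 3))⁻¹ ≤ Real.exp 4 ^ d := by
      rw [← Real.exp_neg, ← Real.exp_nat_mul, Real.exp_le_exp]
      have : (1 : ℝ) ≤ d := by exact_mod_cast hd1
      linarith
    rw [div_eq_inv_mul, mul_assoc, mul_pow (Real.exp 4)]
    refine mul_le_mul e2 (pow_le_pow_left₀ (by positivity) e1 d) (by positivity) (by positivity)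
  · rintro G ⟨x, hx, hG⟩
    refine (pz (k := k) hd1 (by omega) (by rw [Fintype.card_fin]; omega) x hx).trans (measureReal_mono ?_)
    rintro z ⟨h1, h2⟩
    exact ⟨x, hx, hG, h1, h2⟩
  · intro z
    by_cases hz : euclNorm z = 0
    · have : {G | (G, z) ∈ S} = ∅ := by
        ext G
        simp only [hS, Set.mem_setOf_eq, Set.mem_empty_iff_false, iff_false]
        rintro ⟨x, _, _, h1, _⟩
        rw [nv_eq_zero hz, dotProduct_zero] at h1
        exact absurd h1 (not_lt.mpr (Real.sqrt_nonneg _))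
      rw [this, measureReal_empty]; positivity
    have hp : 0 < euclNorm z := lt_of_le_of_ne (nv_nonneg _) (Ne.symm hz)
    obtain ⟨W, hW, hW0⟩ := exists_orth ((euclNorm z)⁻¹ • z) (by
      rw [nv_smul, abs_of_pos (by positivity)]; field_simp)
    have hW' : Wᵀ * W = 1 := mul_eq_one_comm.mp hW
    have h := q_tail (r := r) (k := k) (d := d) hd1 hd.le ht0
    have hQo : IsOpen {G : Fin (r + 1) → Fin k → ℝ | ∃ y, y 0 = 1 ∧ euclNorm (tv G y) < t} := by
      simp only [Set.setOf_exists]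
      refine isOpen_iUnion fun u => ?_
      by_cases hu : u 0 = 1
      · simp only [hu, true_and]
        refine isOpen_lt (nv_cont.comp ?_) continuous_const
        unfold tv; fun_prop
      · simp [hu]
    rw [← gamMat_map W hW, map_measureReal_apply (pm_cont W).measurable hQo.measurableSet] at h
    refine le_trans (measureReal_mono ?_) h
    rintro G ⟨x, hx, h1, h2, h3⟩
    simp only at h1 h2 h3
    have hy0 : (W *ᵥ x) 0 = (x ⬝ᵥ z) / euclNorm z := by
      simp only [Matrix.mulVec, hW0, smul_dotProduct, smul_eq_mul]
      rw [dotProduct_comm, div_eq_inv_mul]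
    have hxz : 0 < x ⬝ᵥ z := lt_of_le_of_lt (Real.sqrt_nonneg _) h2
    have hy1 : 0 < (W *ᵥ x) 0 := by rw [hy0]; positivity
    have e : tv (pm W G) (W *ᵥ x) = tv G x := by
      rw [tv_eq, tv_eq]
      change (W * Matrix.of G)ᵀ *ᵥ _ = _
      rw [Matrix.transpose_mul, Matrix.mulVec_mulVec, Matrix.mul_assoc, hW', Matrix.mul_one]
    refine ⟨((W *ᵥ x) 0)⁻¹ • (W *ᵥ x), ?_, ?_⟩
    · rw [Pi.smul_apply, smul_eq_mul]; field_simp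
    · rw [tv_eq, Matrix.mulVec_smul, nv_smul, abs_of_pos (by positivity), ← tv_eq, e, hy0, inv_div, ht,
        div_mul_eq_mul_div, div_lt_div_iff₀ hxz (by positivity)]
      have hz2 : euclNorm z ≤ Real.sqrt (20 * k) := Real.le_sqrt_of_sq_le h3.le
      have := nv_nonneg (tv G x)
      calc euclNorm z * euclNorm (tv G x) * Real.sqrt d
          ≤ Real.sqrt (20 * k) * s * Real.sqrt d := by gcongr
        _ < Real.sqrt (20 * k) * s * (x ⬝ᵥ z) := by gcongr
        _ = _ := by ring

end Prob

section Num

/-- bundle of numerical relations between the normalized parameters -/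
structure Num (k N κ a e β q g : ℝ) : Prop where
  hk : 1 ≤ k
  hkN : k ≤ N
  hκ : 1 ≤ κ
  ha : 0 < a
  he : 0 < e
  heN : e ≤ Real.sqrt N
  hβ : 0 < β
  hβκ : β ≤ 1 / κ ^ 2
  heβ : e = β * (10 ^ 4 * κ ^ 2 * Real.sqrt N)
  hq : 0 < q
  hqa : q ^ 5 = a
  hq3 : a ^ ((3 : ℝ) / 5) = q ^ 3
  hg : 1 ≤ g
  hg2 : Real.sqrt N ≤ g ^ 2
  hg3 : N ≤ g ^ 3
  hkq : k * q * g ≤ 1 / 10 ^ 20 * β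
  haβ : 14 * Real.sqrt N * a ≤ β ^ (5 * κ)

lemma num_exists {k N κ a e β : ℝ} (hk : 1 ≤ k) (hkN : k ≤ N) (hκ : 1 ≤ κ) (ha : 0 < a) (he : 0 < e)
    (heN : e ≤ Real.sqrt N) (hβe : β = e / (10 ^ 4 * κ ^ 2 * Real.sqrt N))
    (haβ : a ≤ 1 / 10 ^ 100 / (k ^ 5 * N ^ 2) * β ^ (100 * κ)) : ∃ q g, Num k N κ a e β q g := by
  have hN : 1 ≤ N := hk.trans hkN
  have hs1 : 1 ≤ Real.sqrt N := by rw [Real.one_le_sqrt]; exact hN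
  have hk2 : 1 ≤ κ ^ 2 := one_le_pow₀ hκ
  have hβ : 0 < β := by rw [hβe]; positivity
  have hβκ : β ≤ 1 / κ ^ 2 := by
    rw [hβe, div_le_div_iff₀ (by positivity) (by positivity)]
    have : κ ^ 2 * e ≤ κ ^ 2 * Real.sqrt N := by gcongr
    have h0 : 0 ≤ κ ^ 2 * Real.sqrt N := by positivity
    nlinarith
  have hβ1 : β ≤ 1 := hβκ.trans (by rw [div_le_one (by positivity)]; exact hk2)
  have hb5 : β ^ (100 * κ) ≤ β ^ 5 := by
    rw [← Real.rpow_natCast β 5]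
    refine Real.rpow_le_rpow_of_exponent_ge hβ hβ1 ?_
    push_cast; linarith
  have hb6 : β ^ (100 * κ) ≤ β ^ (5 * κ) := Real.rpow_le_rpow_of_exponent_ge hβ hβ1 (by linarith)
  refine ⟨a ^ ((1 : ℝ) / 5), N ^ ((2 : ℝ) / 5), hk, hkN, hκ, ha, he, heN, hβ, hβκ, ?_, by positivity, ?_, ?_, ?_, ?_, ?_, ?_, ?_⟩
  · rw [hβe]; field_simp
  · rw [← Real.rpow_natCast, ← Real.rpow_mul ha.le]; norm_num
  · rw [← Real.rpow_natCast, ← Real.rpow_mul ha.le]; norm_num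
  · exact Real.one_le_rpow hN (by norm_num)
  · rw [← Real.rpow_natCast, ← Real.rpow_mul (by linarith), Real.sqrt_eq_rpow]
    exact Real.rpow_le_rpow_of_exponent_le hN (by norm_num)
  · rw [← Real.rpow_natCast, ← Real.rpow_mul (by linarith)]
    conv_lhs => rw [← Real.rpow_one N]
    exact Real.rpow_le_rpow_of_exponent_le hN (by norm_num)
  · rw [← pow_le_pow_iff_left₀ (n := 5) (by positivity) (by positivity) (by norm_num), mul_pow, mul_pow, mul_pow]
    have e1 : (a ^ ((1 : ℝ) / 5)) ^ 5 = a := by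
      rw [← Real.rpow_natCast, ← Real.rpow_mul ha.le]; norm_num
    have e2 : (N ^ ((2 : ℝ) / 5)) ^ 5 = N ^ 2 := by
      rw [← Real.rpow_natCast, ← Real.rpow_mul (by linarith)]; norm_num
    rw [e1, e2]
    have : k ^ 5 * a * N ^ 2 ≤ k ^ 5 * (1 / 10 ^ 100 / (k ^ 5 * N ^ 2) * β ^ 5) * N ^ 2 := by
      gcongr
      refine haβ.trans ?_
      gcongr
    refine this.trans (le_of_eq ?_)
    field_simp
  · have h1 : 1 / 10 ^ 100 / (k ^ 5 * N ^ 2) ≤ 1 / 10 ^ 100 / (1 * N ^ 2) := by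
      gcongr; exact one_le_pow₀ hk
    have h2 : Real.sqrt N ≤ N := by
      nlinarith [Real.sq_sqrt (show 0 ≤ N by linarith)]
    have hp : 0 < β ^ (5 * κ) := by positivity
    calc 14 * Real.sqrt N * a ≤ 14 * N * (1 / 10 ^ 100 / (1 * N ^ 2) * β ^ (5 * κ)) := by
          gcongr
          exact haβ.trans (by gcongr)
      _ = 14 / 10 ^ 100 / N * β ^ (5 * κ) := by field_simp
      _ ≤ 14 / 10 ^ 100 / 1 * β ^ (5 * κ) := by gcongr
      _ ≤ _ := by linarith

namespace Num
variable {k N κ a e β q g : ℝ}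

lemma x1 (h : Num k N κ a e β q g) : 1 ≤ Real.sqrt N := by rw [Real.one_le_sqrt]; exact h.hk.trans h.hkN
lemma s0 (h : Num k N κ a e β q g) : 0 < 1 / κ := by have := h.hκ; positivity
lemma s1 (h : Num k N κ a e β q g) : 1 / κ ≤ 1 := by
  have := h.hκ; rw [div_le_one (by positivity)]; exact this
lemma b2 (h : Num k N κ a e β q g) : β ≤ (1 / κ) ^ 2 := by
  have := h.hβκ; rw [div_pow, one_pow]; exact this
lemma b1 (h : Num k N κ a e β q g) : β ≤ 1 := h.b2.trans (pow_le_one₀ h.s0.le h.s1)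
lemma qg (h : Num k N κ a e β q g) : q * g ≤ 1 / 10 ^ 20 * β := by
  refine le_trans ?_ h.hkq
  have := h.hk; have := h.hq; have := h.hg
  calc q * g = 1 * q * g := by ring
    _ ≤ _ := by gcongr
lemma qb (h : Num k N κ a e β q g) : q ≤ 1 / 10 ^ 20 * β := by
  refine le_trans ?_ h.qg
  exact le_mul_of_one_le_right h.hq.le h.hg
lemma q1 (h : Num k N κ a e β q g) : q ≤ 1 := by have := h.qb; have := h.b1; linarith
lemma g0 (h : Num k N κ a e β q g) : 0 < g := by have := h.hg; linarith
lemma eb (h : Num k N κ a e β q g) : e = 10 ^ 4 * β * Real.sqrt N / (1 / κ) ^ 2 := by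
  have := h.hκ
  rw [h.heβ]; field_simp
lemma be (h : Num k N κ a e β q g) : β ≤ e := by
  rw [h.heβ]
  have h1 := h.x1
  have h2 : 1 ≤ κ ^ 2 := one_le_pow₀ h.hκ
  refine le_mul_of_one_le_right h.hβ.le ?_
  nlinarith [mul_le_mul h2 h1 (by norm_num) (by positivity)]
lemma ab (h : Num k N κ a e β q g) : a ≤ β := by
  rw [← h.hqa]
  have h1 : q ^ 5 ≤ q := by simpa using pow_le_pow_of_le_one h.hq.le h.q1 (show 1 ≤ 5 by norm_num)
  have := h.qb; have := h.hβ; linarith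
lemma a1 (h : Num k N κ a e β q g) : a ≤ 1 := h.ab.trans h.b1
lemma ae1 (h : Num k N κ a e β q g) : a * e ≤ 1 := by
  have h0 := h.hq
  have hb := h.hβ
  have hg := h.g0
  calc a * e ≤ q ^ 5 * g ^ 2 := by
        rw [h.hqa]; have := h.ha; gcongr; exact h.heN.trans h.hg2
    _ = (q * g) ^ 2 * q ^ 3 := by ring
    _ ≤ 1 ^ 2 * 1 ^ 3 := by
        have := h.qg; have := h.b1; have := h.q1
        gcongr; linarith
    _ = 1 := by norm_num

lemma hz (h : Num k N κ a e β q g) : 14 * Real.sqrt N * a ≤ 1 / 10 ^ 20 * (1 / κ) ^ 4 := by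
  have h0 := h.hq
  have hb := h.hβ
  have hg := h.g0
  have hb2 := h.b2
  have hq : q ≤ 1 / 10 ^ 20 := by have := h.qb; have := h.b1; linarith
  calc 14 * Real.sqrt N * a ≤ 14 * g ^ 2 * q ^ 5 := by
        rw [h.hqa]; have := h.ha; have := h.hg2; gcongr
    _ = 14 * (q * g) ^ 2 * q ^ 3 := by ring
    _ ≤ 14 * (1 / 10 ^ 20 * β) ^ 2 * (1 / 10 ^ 20) ^ 3 := by
        have := h.qg
        gcongr
    _ ≤ 14 * (1 / 10 ^ 20 * (1 / κ) ^ 2) ^ 2 * (1 / 10 ^ 20) ^ 3 := by gcongr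
    _ ≤ _ := by
        have : 0 ≤ (1 / κ) ^ 4 := by have := h.s0; positivity
        ring_nf at this ⊢
        linarith

lemma qE {E : ℝ} (h : Num k N κ a e β q g) (hE : 1 ≤ E) (hqE : q * E ^ 2 ≤ 4) : q * E ≤ 4 := by
  have := h.hq
  refine le_trans ?_ hqE
  gcongr
  nlinarith

lemma hn {E : ℝ} (h : Num k N κ a e β q g) (hE : 1 ≤ E) (hqE : q * E ^ 2 ≤ 4) :
    k * (14 * Real.sqrt N * a * E) ≤ 1 / 10 ^ 10 * (1 / κ) ^ 3 := by
  have h0 := h.hq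
  have hb := h.hβ
  have hg := h.g0
  have hb2 := h.b2
  have hk := h.hk
  have hq : q ≤ 1 / 10 ^ 20 := by have := h.qb; have := h.b1; linarith
  have hs := h.s0
  have h3 := h.qE hE hqE
  calc k * (14 * Real.sqrt N * a * E) ≤ k * (14 * g ^ 2 * q ^ 5 * E) := by
        rw [h.hqa]; have := h.ha; have := h.hg2; gcongr
    _ = 14 * (k * q * g) * (q * g) * q ^ 2 * (q * E) := by ring
    _ ≤ 14 * (1 / 10 ^ 20 * β) * (1 / 10 ^ 20 * β) * (1 / 10 ^ 20) ^ 2 * 4 := by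
        have := h.qg; have := h.hkq
        gcongr
    _ ≤ 14 * (1 / 10 ^ 20 * (1 / κ) ^ 2) * (1 / 10 ^ 20 * (1 / κ) ^ 2) * (1 / 10 ^ 20) ^ 2 * 4 := by gcongr
    _ = 56 / 10 ^ 80 * ((1 / κ) ^ 3 * (1 / κ)) := by ring
    _ ≤ 56 / 10 ^ 80 * ((1 / κ) ^ 3 * 1) := by have := h.s1; gcongr
    _ ≤ _ := by
        have : 0 ≤ (1 / κ) ^ 3 := by positivity
        linarith

lemma hxi {E w : ℝ} (h : Num k N κ a e β q g) (hE : 1 ≤ E) (hqE : q * E ^ 2 ≤ 4) (hw : w ≤ 1) :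
    ((5 * (14 * Real.sqrt N * a) ^ (1 + 1 / κ / 5) + 6 * k * (14 * Real.sqrt N * a) ^ 2) / (4 / 10 * (1 / κ))) * w
      + (10 / (1 / κ) * (14 * Real.sqrt N * a) / (1 / 10 ^ 7 * (1 / κ))) * (14 * Real.sqrt N * a * E - 14 * Real.sqrt N * a)
      ≤ a * e / 2 := by
  have h0 := h.hq
  have hb := h.hβ
  have hg := h.g0
  have hk := h.hk
  have hκ := h.hκ
  have ha := h.ha
  have hx := h.x1
  have hs := h.s0
  have hs1 := h.s1
  have hq : q ≤ 1 / 10 ^ 20 := by have := h.qb; have := h.b1; linarith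
  have hN : 0 ≤ N := by have := h.hkN; linarith
  have hz0 : 0 < 14 * Real.sqrt N * a := by positivity
  have h3 := h.qE hE hqE
  have r1 : (14 * Real.sqrt N * a) ^ (1 + 1 / κ / 5) ≤ 14 * Real.sqrt N * a * β := by
    rw [Real.rpow_add hz0, Real.rpow_one]
    gcongr
    calc (14 * Real.sqrt N * a) ^ (1 / κ / 5) ≤ (β ^ (5 * κ)) ^ (1 / κ / 5) :=
          Real.rpow_le_rpow hz0.le h.haβ (by positivity)
      _ = β := by
          rw [← Real.rpow_mul hb.le]
          have : 5 * κ * (1 / κ / 5) = 1 := by field_simp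
          rw [this, Real.rpow_one]
  have kNa : k * N * a ≤ 1 / 10 ^ 20 * β := by
    calc k * N * a ≤ k * g ^ 3 * q ^ 5 := by
          rw [h.hqa]; have := h.hg3; gcongr
      _ = (k * q * g) * (q * g) ^ 2 * q ^ 2 := by ring
      _ ≤ (1 / 10 ^ 20 * β) * 1 ^ 2 * 1 ^ 2 := by
          have := h.qg; have := h.hkq; have := h.b1; have := h.q1
          gcongr
          linarith
      _ = _ := by ring
  have NaE : N * a * E ≤ 1 / 10 ^ 20 * β := by
    calc N * a * E ≤ g ^ 3 * q ^ 5 * E := by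
          rw [h.hqa]; have := h.hg3; gcongr
      _ = (q * g) * (q * g) ^ 2 * q * (q * E) := by ring
      _ ≤ (1 / 10 ^ 20 * β) * 1 ^ 2 * (1 / 10 ^ 20) * 4 := by
          have := h.qg; have := h.hkq; have := h.b1; have := h.q1
          gcongr
          linarith
      _ ≤ _ := by linarith
  have sqN : Real.sqrt N ^ 2 = N := Real.sq_sqrt hN
  generalize hσ : 1 / κ = σ at *
  have he : a * e = 10 ^ 4 * (a * β * Real.sqrt N / σ ^ 2) := by rw [h.eb, hσ]; ring
  set y : ℝ := a * β * Real.sqrt N / σ ^ 2 with hy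
  have hy0 : 0 ≤ y := by positivity
  have y1 : a * β * Real.sqrt N / σ ≤ y := by
    rw [hy]; gcongr
    nlinarith
  have y2 : a * β / σ ≤ y := by
    refine le_trans ?_ y1
    refine div_le_div_of_nonneg_right ?_ (by positivity)
    exact le_mul_of_one_le_right (by positivity) hx
  have y3 : a * β / σ ^ 2 ≤ y := by
    rw [hy]
    refine div_le_div_of_nonneg_right ?_ (by positivity)
    exact le_mul_of_one_le_right (by positivity) hx
  have p1 : ((5 * (14 * Real.sqrt N * a) ^ (1 + σ / 5) + 6 * k * (14 * Real.sqrt N * a) ^ 2) / (4 / 10 * σ)) * w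
      ≤ 175 * y + 2940 / 10 ^ 20 * y := by
    calc _ ≤ ((5 * (14 * Real.sqrt N * a) ^ (1 + σ / 5) + 6 * k * (14 * Real.sqrt N * a) ^ 2) / (4 / 10 * σ)) * 1 := by
          gcongr
      _ ≤ ((5 * (14 * Real.sqrt N * a * β) + 6 * k * (14 * Real.sqrt N * a) ^ 2) / (4 / 10 * σ)) := by
          rw [mul_one]; gcongr
      _ = 175 * (a * β * Real.sqrt N / σ) + 2940 * ((k * Real.sqrt N ^ 2 * a) * a / σ) := by field_simp; ring
      _ ≤ 175 * y + 2940 * ((1 / 10 ^ 20 * β) * a / σ) := by rw [sqN]; gcongr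
      _ = 175 * y + 2940 / 10 ^ 20 * (a * β / σ) := by ring
      _ ≤ _ := by gcongr
  have p2 : (10 / σ * (14 * Real.sqrt N * a) / (1 / 10 ^ 7 * σ)) * (14 * Real.sqrt N * a * E - 14 * Real.sqrt N * a)
      ≤ y := by
    calc _ ≤ (10 / σ * (14 * Real.sqrt N * a) / (1 / 10 ^ 7 * σ)) * (14 * Real.sqrt N * a * E) := by
          gcongr; linarith
      _ = 19600000000 * ((Real.sqrt N ^ 2 * a * E) * a / σ ^ 2) := by field_simp; ring
      _ ≤ 19600000000 * ((1 / 10 ^ 20 * β) * a / σ ^ 2) := by rw [sqN]; gcongr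
      _ = 19600000000 / 10 ^ 20 * (a * β / σ ^ 2) := by ring
      _ ≤ 19600000000 / 10 ^ 20 * y := by gcongr
      _ ≤ y := by linarith
  rw [he]
  linarith

lemma fin {E F : ℝ} (h : Num k N κ a e β q g) (hE : 1 ≤ E) (hqE : q * E ^ 2 ≤ 4) (hF : F ≤ (a * e) ^ 2) :
    F * (25 * k) + 72000000 * (k ^ 3 * (14 * Real.sqrt N * a * E) ^ 2) / (1 / κ) ≤ (10 ^ 6 * q ^ 3) ^ 2 := by
  have h0 := h.hq
  have hb := h.hβ
  have hg := h.g0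
  have hk := h.hk
  have hκ := h.hκ
  have ha := h.ha
  have he := h.he
  have hx := h.x1
  have hN : 0 ≤ N := by have := h.hkN; linarith
  have sqN : Real.sqrt N ^ 2 = N := Real.sq_sqrt hN
  have hq1 := h.q1
  have c1 : k * q * g ≤ 1 := by have := h.hkq; have := h.b1; linarith
  have c2 : q * g ≤ 1 := by have := h.qg; have := h.b1; linarith
  have c3 : k * q * g * κ ≤ 1 := by
    have h1 : β * κ ≤ 1 := by
      have h2 := h.hβκ
      rw [le_div_iff₀ (by positivity)] at h2
      nlinarith [mul_pos hb (show 0 < κ by linarith)]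
    have : k * q * g * κ ≤ 1 / 10 ^ 20 * β * κ := by have := h.hkq; gcongr
    nlinarith
  have p1 : F * (25 * k) ≤ 25 * q ^ 6 := by
    calc F * (25 * k) ≤ (a * Real.sqrt N) ^ 2 * (25 * k) := by
          gcongr
          refine hF.trans ?_
          have := h.heN
          gcongr
      _ = q ^ 10 * N * (25 * k) := by rw [mul_pow, sqN, ← h.hqa]; ring
      _ ≤ q ^ 10 * g ^ 3 * (25 * k) := by have := h.hg3; gcongr
      _ = 25 * q ^ 6 * ((k * q * g) * (q * g) ^ 2 * q) := by ring
      _ ≤ 25 * q ^ 6 * (1 * 1 ^ 2 * 1) := by gcongr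
      _ = _ := by ring
  have p2 : 72000000 * (k ^ 3 * (14 * Real.sqrt N * a * E) ^ 2) / (1 / κ) ≤ 56448000000 * q ^ 6 := by
    calc 72000000 * (k ^ 3 * (14 * Real.sqrt N * a * E) ^ 2) / (1 / κ)
        = 14112000000 * (k ^ 3 * Real.sqrt N ^ 2 * (q ^ 5) ^ 2 * E ^ 2 * κ) := by
          rw [← h.hqa]; field_simp; ring
      _ ≤ 14112000000 * (k ^ 3 * g ^ 3 * (q ^ 5) ^ 2 * E ^ 2 * κ) := by
          rw [sqN]; have := h.hg3; gcongr
      _ = 14112000000 * q ^ 6 * ((k * q * g) ^ 2 * (k * q * g * κ) * (q * E ^ 2)) := by ring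
      _ ≤ 14112000000 * q ^ 6 * (1 ^ 2 * 1 * 4) := by gcongr
      _ = _ := by ring
  have : 0 ≤ q ^ 6 := by positivity
  calc _ ≤ 25 * q ^ 6 + 56448000000 * q ^ 6 := add_le_add p1 p2
    _ ≤ 10 ^ 12 * q ^ 6 := by linarith
    _ = _ := by ring

lemma expE (h : Num k N κ a e β q g) {x : ℝ} (hx0 : 0 ≤ x)
    (hx : x ≤ 3 / 100 * Real.log (2 * Real.sqrt 2 / (a * e))) : q * Real.exp x ^ 2 ≤ 4 := by
  have ha := h.ha
  have he := h.he
  have hq := h.hq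
  have h1 : Real.log (2 * Real.sqrt 2 / (a * e)) ≤ Real.log (3 / q ^ 10) := by
    refine Real.log_le_log (by positivity) ?_
    gcongr
    · have : Real.sqrt 2 ≤ 3 / 2 := by rw [Real.sqrt_le_left (by norm_num)]; norm_num
      linarith
    · calc q ^ 10 = a * a := by rw [← h.hqa]; ring
        _ ≤ a * e := by have := h.ab; have := h.be; gcongr; linarith
  rw [Real.log_div (x := 3) (by norm_num) (by positivity), Real.log_pow] at h1
  have h3 : Real.log 3 ≤ 2 := by
    have := Real.log_le_sub_one_of_pos (show (0:ℝ) < 3 by norm_num)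
    linarith
  have h4 : Real.log q ≤ 0 := Real.log_nonpos hq.le h.q1
  have h5 : Real.exp x ^ 2 ≤ Real.exp (1 - Real.log q) := by
    rw [← Real.exp_nat_mul, Real.exp_le_exp]
    push_cast at h1 ⊢
    linarith
  rw [Real.exp_sub, Real.exp_log hq, le_div_iff₀ hq] at h5
  have := Real.exp_one_lt_d9
  linarith

lemma l1 (h : Num k N κ a e β q g) : 1 ≤ Real.log (2 * Real.sqrt 2 / (a * e)) := by
  have ha := h.ha
  have he := h.he
  rw [Real.le_log_iff_exp_le (by positivity), le_div_iff₀ (by positivity)]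
  have h1 : (1.4 : ℝ) ≤ Real.sqrt 2 := Real.le_sqrt_of_sq_le (by norm_num)
  have := Real.exp_one_lt_d9
  have := h.ae1
  nlinarith [Real.exp_pos 1]

end Num
end Num

section Asm
open scoped Matrix.Norms.L2Operator
variable {n₁ n₂ m k r : ℕ}

lemma det_all {A : Fin m → Matrix (Fin n₁) (Fin n₂) ℝ} {X : Matrix (Fin n₁) (Fin n₂) ℝ} {δ μ κ N a e β q g : ℝ}
    {U : Matrix (Fin n₁ ⊕ Fin n₂) (Fin r) ℝ} {l : Fin r → ℝ} (h : Ref A X δ (1 / κ) U l)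
    (hnum : Num k N κ a e β q g) (hrk : r ≤ k) (hμ : 0 < μ)
    (hμ2 : μ * Real.log (2 * Real.sqrt 2 / (a * e)) ≤ 1 / 10 ^ 27 * (1 / κ) ^ 5)
    (V₀ : Matrix (Fin n₁) (Fin k) ℝ) (W₀ : Matrix (Fin n₂) (Fin k) ℝ)
    (hZ : ‖fromRows V₀ W₀‖ ≤ 14 * Real.sqrt N * a)
    (hU : ∀ x, a * e * euclNorm x ≤ euclNorm ((Uᵀ * fromRows V₀ W₀)ᵀ *ᵥ x)) {T : ℕ}
    (hT : T = ⌊300000 * Real.log (2 * Real.sqrt 2 / (a * e)) / (μ * (1 / κ))⌋₊) :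
    frobNorm ((iter A X μ V₀ W₀ T).1 * (iter A X μ V₀ W₀ T).2ᵀ - X) ≤ 10 ^ 6 * q ^ 3 := by
  have hσ := h.hσ
  have hσ1 := h.hσ1
  set L := Real.log (2 * Real.sqrt 2 / (a * e)) with hL
  have hL1 : 1 ≤ L := hnum.l1
  have ha := hnum.ha
  have he := hnum.he
  have hq := hnum.hq
  have expEL : ∀ x, 0 ≤ x → x ≤ 3 / 100 * L → q * Real.exp x ^ 2 ≤ 4 := fun x hx0 hx => hnum.expE hx0 hx
  have hexpL : Real.exp L = 2 * Real.sqrt 2 / (a * e) := Real.exp_log (by positivity)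
  clear_value L
  have hμσ0 : μ ≤ 1 / 10 ^ 27 * (1 / κ) ^ 5 := le_trans (le_mul_of_one_le_right hμ.le hL1) hμ2
  have hσ5 : (1 / κ) ^ 5 ≤ 1 := pow_le_one₀ hσ.le hσ1
  have hσ50 : 0 < (1 / κ) ^ 5 := by positivity
  have hμσ : μ ≤ 1 / 10 ^ 20 * (1 / κ) ^ 5 := by linarith
  have hμs : μ ≤ 1 / 10 ^ 27 := by linarith
  have hμs0 : 0 < μ * (1 / κ) := by positivity
  have hms : μ * (1 / κ) ≤ 1 / 10 ^ 27 := by nlinarith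
  have hTu : μ * (1 / κ) * T ≤ 300000 * L := by
    have := Nat.floor_le (show 0 ≤ 300000 * L / (μ * (1 / κ)) by positivity)
    rw [← hT, le_div_iff₀ hμs0] at this
    linarith
  have hTl : 300000 * L - μ * (1 / κ) ≤ μ * (1 / κ) * T := by
    have := Nat.lt_floor_add_one (300000 * L / (μ * (1 / κ)))
    rw [← hT, div_lt_iff₀ hμs0] at this
    linarith
  set t1 : ℕ := ⌈2 * L / (μ * (1 / κ))⌉₊ with ht1
  have ht1l : 2 * L ≤ μ * (1 / κ) * t1 := by
    have := Nat.le_ceil (2 * L / (μ * (1 / κ)))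
    rw [← ht1, div_le_iff₀ hμs0] at this
    linarith
  have ht1u : μ * (1 / κ) * t1 ≤ 2 * L + μ * (1 / κ) := by
    have := Nat.ceil_lt_add_one (show 0 ≤ 2 * L / (μ * (1 / κ)) by positivity)
    rw [← ht1, ← sub_lt_iff_lt_add, lt_div_iff₀ hμs0] at this
    linarith
  clear_value t1
  have ht1T : t1 ≤ T := by
    have : μ * (1 / κ) * t1 ≤ μ * (1 / κ) * T := by linarith
    exact_mod_cast le_of_mul_le_mul_left this hμs0
  set E : ℝ := Real.exp (1 / 10 ^ 7 * (1 / κ) * μ * T) with hE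
  have hE1 : 1 ≤ E := Real.one_le_exp (by positivity)
  have hqE : q * E ^ 2 ≤ 4 := by
    refine expEL _ (by positivity) ?_
    calc 1 / 10 ^ 7 * (1 / κ) * μ * T = 1 / 10 ^ 7 * (μ * (1 / κ) * T) := by ring
      _ ≤ 1 / 10 ^ 7 * (300000 * L) := by gcongr
      _ = _ := by ring
  have hy : (mkDyn h hμ hμσ V₀ W₀).Hyp (14 * Real.sqrt N * a) (a * e) T := by
    refine ⟨?_, ?_, ?_, hZ, hU, hnum.hz, ?_, hnum.hn hE1 hqE, ?_⟩
    · exact_mod_cast hnum.hk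
    · have := hnum.x1; positivity
    · positivity
    · change μ ^ 2 * T ≤ 1 / 10 ^ 21 * (1 / κ) ^ 4
      have h1 : μ * (1 / κ) * (μ * T) ≤ μ * (300000 * L) := by
        calc μ * (1 / κ) * (μ * T) = μ * (μ * (1 / κ) * T) := by ring
          _ ≤ _ := by gcongr
      have h2 : (1 / κ) * (μ ^ 2 * T) ≤ (1 / κ) * (300000 / 10 ^ 27 * (1 / κ) ^ 4) := by
        calc (1 / κ) * (μ ^ 2 * T) = μ * (1 / κ) * (μ * T) := by ring
          _ ≤ 300000 * (μ * L) := by linarith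
          _ ≤ 300000 * (1 / 10 ^ 27 * (1 / κ) ^ 5) := by gcongr
          _ = _ := by ring
      have h3 := le_of_mul_le_mul_left h2 hσ
      have : 0 ≤ (1 / κ) ^ 4 := by positivity
      linarith
    · exact hnum.hxi hE1 hqE (sub_le_self _ (Real.exp_pos _).le)
  have hl : ((1 + 19 / 10 * μ * (1 / κ)) ^ t1)⁻¹ ≤ (a * e) ^ 2 / (1 / κ) := by
    have h1 := Dyn.exp_le_q hμs0.le (by linarith)
    have h2 : Real.exp (18 / 10 * (μ * (1 / κ))) ^ t1 ≤ (1 + 19 / 10 * μ * (1 / κ)) ^ t1 := by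
      gcongr; linarith
    rw [← Real.exp_nat_mul] at h2
    have h3 : Real.exp L ^ 2 ≤ (1 + 19 / 10 * μ * (1 / κ)) ^ t1 := by
      refine le_trans ?_ h2
      rw [← Real.exp_nat_mul, Real.exp_le_exp]
      push_cast
      linarith
    rw [hexpL, div_pow, mul_pow, Real.sq_sqrt (by norm_num)] at h3
    have h4 : ((1 + 19 / 10 * μ * (1 / κ)) ^ t1)⁻¹ ≤ (2 ^ 2 * 2 / (a * e) ^ 2)⁻¹ := by gcongr
    refine h4.trans ?_
    rw [inv_div, div_le_div_iff₀ (by norm_num) hσ]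
    have : 0 < (a * e) ^ 2 := by positivity
    nlinarith
  have hfin := det_final h hμ hμσ hrk V₀ W₀ hy ht1T hl
  have hF : Real.exp (-(μ * (1 / κ) / 120000 * (T - t1 : ℕ))) ≤ (a * e) ^ 2 := by
    have h1 : -(μ * (1 / κ) / 120000 * ((T - t1 : ℕ) : ℝ)) ≤ -(2 * L) := by
      rw [Nat.cast_sub ht1T]
      linarith
    calc _ ≤ Real.exp (-(2 * L)) := Real.exp_le_exp.mpr h1
      _ = (Real.exp L ^ 2)⁻¹ := by rw [Real.exp_neg, ← Real.exp_nat_mul]; norm_num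
      _ = (a * e) ^ 2 / 8 := by
          rw [hexpL, div_pow, mul_pow, Real.sq_sqrt (by norm_num), inv_div]; norm_num
      _ ≤ _ := by have : 0 < (a * e) ^ 2 := by positivity
                  linarith
  have := hfin.trans (hnum.fin hE1 hqE hF)
  exact (abs_le_of_sq_le_sq' this (by positivity)).2

lemma iter_scale (A : Fin m → Matrix (Fin n₁) (Fin n₂) ℝ) (X : Matrix (Fin n₁) (Fin n₂) ℝ) (μ s : ℝ)
    (V₀ : Matrix (Fin n₁) (Fin k) ℝ) (W₀ : Matrix (Fin n₂) (Fin k) ℝ) (t : ℕ) :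
    iter A (s ^ 2 • X) μ (s • V₀) (s • W₀) t =
      (s • (iter A X (μ * s ^ 2) V₀ W₀ t).1, s • (iter A X (μ * s ^ 2) V₀ W₀ t).2) := by
  induction t with
  | zero => rfl
  | succ t ih =>
    have hG : AstarA A ((s • (iter A X (μ * s ^ 2) V₀ W₀ t).1) * (s • (iter A X (μ * s ^ 2) V₀ W₀ t).2)ᵀ - s ^ 2 • X) =
        s ^ 2 • AstarA A ((iter A X (μ * s ^ 2) V₀ W₀ t).1 * (iter A X (μ * s ^ 2) V₀ W₀ t).2ᵀ - X) := by
      rw [← AstarA_smul]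
      congr 1
      rw [Matrix.transpose_smul, Matrix.smul_mul, Matrix.mul_smul, smul_smul, smul_sub, sq]
    simp only [iter, ih, hG]
    ext1
    · simp only [smul_sub, Matrix.smul_mul, Matrix.mul_smul, smul_smul]
      congr 2; ring
    · simp only [smul_sub, Matrix.smul_mul, Matrix.mul_smul, smul_smul, Matrix.transpose_smul]
      congr 2; ring

end Asm

section Prob
variable {n₁ n₂ k r : ℕ}

lemma tv_smul {a b : Type*} [Fintype a] [Fintype b] (Z : a → b → ℝ) (c : ℝ) (u : a → ℝ) :
    tv Z (c • u) = c • tv Z u := by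
  rw [tv_eq, tv_eq, Matrix.mulVec_smul]

lemma unit_scale {a : Type*} [Fintype a] (u : a → ℝ) (hu : euclNorm u ≠ 0) :
    euclNorm ((euclNorm u)⁻¹ • u) = 1 := by
  rw [nv_smul, abs_of_nonneg (inv_nonneg.mpr (nv_nonneg u)), inv_mul_cancel₀ hu]

lemma D_pos {k r : ℕ} (hr : 1 ≤ r) (hrk : r ≤ k) : 0 < Real.sqrt k - Real.sqrt ((r : ℝ) - 1) := by
  have : (r : ℝ) - 1 < k := by
    have : (r : ℝ) ≤ k := by exact_mod_cast hrk
    linarith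
  have h0 : (0 : ℝ) ≤ (r : ℝ) - 1 := by
    have : (1 : ℝ) ≤ r := by exact_mod_cast hr
    linarith
  linarith [Real.sqrt_lt_sqrt h0 this]

lemma prob (U : Matrix (Fin n₁ ⊕ Fin n₂) (Fin r) ℝ) (hU : Uᵀ * U = 1) (hr : 1 ≤ r) (hrk : r ≤ k)
    {ε : ℝ} (hε : 0 < ε) (S : Set ((Fin n₁ → Fin k → ℝ) × (Fin n₂ → Fin k → ℝ)))
    (hS : ∀ ω, (∀ u, euclNorm (tv (stk ω) u) ≤ 14 * Real.sqrt ((max (n₁ + n₂) k : ℕ) : ℝ) * euclNorm u) →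
      (∀ x, ε * (Real.sqrt k - Real.sqrt ((r : ℝ) - 1)) * euclNorm x ≤ euclNorm (tv (pm Uᵀ (stk ω)) x)) → ω ∈ S) :
    ENNReal.ofReal (1 - Real.exp 3 * Real.exp (-(1 * k)) - (Real.exp 4 * 10 * ε) ^ (k - r + 1)) ≤
      gaussPair n₁ n₂ k S := by
  obtain ⟨r', rfl⟩ : ∃ r', r = r' + 1 := ⟨r - 1, by omega⟩
  have hk : 1 ≤ k := by omega
  set N := max (n₁ + n₂) k with hN
  obtain ⟨d, hd⟩ : ∃ d, d + r' = k := ⟨k - r', by omega⟩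
  have hd1 : 1 ≤ d := by omega
  have hde : k - (r' + 1) + 1 = d := by omega
  have hcard : Fintype.card (Fin n₁ ⊕ Fin n₂) ≤ N := by simp [N]
  obtain ⟨o1, p1⟩ := op_tail (a := Fin n₁ ⊕ Fin n₂) hk hcard (le_max_right _ _)
  obtain ⟨o2, p2⟩ := sv_tail hd hd1 hε
  set B1 := {Z : Fin n₁ ⊕ Fin n₂ → Fin k → ℝ | ∃ u, euclNorm u = 1 ∧ 14 * Real.sqrt N < euclNorm (tv Z u)} with hB1
  set B2 := {G : Fin (r' + 1) → Fin k → ℝ | ∃ x, euclNorm x = 1 ∧ euclNorm (tv G x) < ε * d / Real.sqrt k} with hB2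
  have hD : Real.sqrt k - Real.sqrt (((r' + 1 : ℕ) : ℝ) - 1) ≤ d / Real.sqrt k := by
    have hk0 : (0 : ℝ) < k := by exact_mod_cast hk
    have e1 : (((r' + 1 : ℕ) : ℝ) - 1) = r' := by push_cast; ring
    have e2 : (d : ℝ) = k - r' := by rw [← hd]; push_cast; ring
    rw [e1, e2, le_div_iff₀ (by positivity)]
    have s1 := Real.mul_self_sqrt hk0.le
    have s2 := Real.mul_self_sqrt (Nat.cast_nonneg (α := ℝ) r')
    have s3 : Real.sqrt r' ≤ Real.sqrt k := Real.sqrt_le_sqrt (by rw [← hd]; push_cast; linarith [Nat.cast_nonneg (α := ℝ) d])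
    nlinarith [Real.sqrt_nonneg (r' : ℝ)]
  have : IsProbabilityMeasure (gaussPair n₁ n₂ k) := by unfold gaussPair; infer_instance
  have q1 : gaussPair n₁ n₂ k (stk ⁻¹' B1) = gamMat (Fin n₁ ⊕ Fin n₂) (Fin k) B1 := by
    rw [← gaussPair_map, Measure.map_apply stk_cont.measurable o1.measurableSet]
  have q2 : gaussPair n₁ n₂ k (stk ⁻¹' (pm Uᵀ ⁻¹' B2)) = gamMat (Fin (r' + 1)) (Fin k) B2 := by
    rw [← gamMat_map (a := Fin n₁ ⊕ Fin n₂) Uᵀ (by simpa using hU), Measure.map_apply (pm_cont _).measurable o2.measurableSet,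
      ← gaussPair_map, Measure.map_apply stk_cont.measurable
        ((pm_cont _).measurable o2.measurableSet)]
  have hcov : (Set.univ : Set ((Fin n₁ → Fin k → ℝ) × (Fin n₂ → Fin k → ℝ))) ⊆
      S ∪ (stk ⁻¹' B1 ∪ stk ⁻¹' (pm Uᵀ ⁻¹' B2)) := by
    intro ω _
    by_cases h1 : ω ∈ stk ⁻¹' B1
    · exact Or.inr (Or.inl h1)
    by_cases h2 : ω ∈ stk ⁻¹' (pm Uᵀ ⁻¹' B2)
    · exact Or.inr (Or.inr h2)
    left
    simp only [hB1, hB2, Set.mem_preimage, Set.mem_setOf_eq, not_exists, not_and, not_lt] at h1 h2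
    refine hS ω (fun u => ?_) (fun x => ?_)
    · by_cases hu : euclNorm u = 0
      · have := nv_eq_zero hu
        rw [hu, this, tv_eq, Matrix.mulVec_zero, nv_zero, mul_zero]
      · have := h1 _ (unit_scale u hu)
        have hp : 0 < euclNorm u := lt_of_le_of_ne (nv_nonneg u) (Ne.symm hu)
        rw [tv_smul, nv_smul, abs_of_nonneg (inv_nonneg.mpr (nv_nonneg u)), inv_mul_le_iff₀ hp] at this
        linarith
    · by_cases hu : euclNorm x = 0
      · rw [hu, mul_zero]; exact nv_nonneg _
      · have := h2 _ (unit_scale x hu)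
        have hp : 0 < euclNorm x := lt_of_le_of_ne (nv_nonneg x) (Ne.symm hu)
        rw [tv_smul, nv_smul, abs_of_nonneg (inv_nonneg.mpr (nv_nonneg x)), le_inv_mul_iff₀ hp] at this
        refine le_trans ?_ this
        rw [mul_comm]
        gcongr
        rw [mul_div_assoc]
        gcongr
  have hm := (measure_mono hcov).trans ((measure_union_le (μ := gaussPair n₁ n₂ k) _ _).trans
    (add_le_add_right (measure_union_le _ _) _))
  rw [measure_univ, q1, q2, ← ofReal_measureReal (s := B1), ← ofReal_measureReal (s := B2)] at hm
  have p1' := ENNReal.ofReal_le_ofReal p1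
  have p2' := ENNReal.ofReal_le_ofReal p2
  have hm2 := hm.trans (add_le_add_right (add_le_add p1' p2') _)
  rw [hde, one_mul, sub_sub, ENNReal.ofReal_sub _ (by positivity), ENNReal.ofReal_one,
    ENNReal.ofReal_add (by positivity) (by positivity)]
  exact tsub_le_iff_right.mpr hm2

end Prob

section Fin
open scoped Matrix.Norms.L2Operator
variable {n₁ n₂ m k r : ℕ}

lemma sigmaPos_spec (X : Matrix (Fin n₁) (Fin n₂) ℝ) (x : Fin n₂ → ℝ) (hx : ∀ y, X *ᵥ y = 0 → x ⬝ᵥ y = 0) :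
    sigmaPos X * euclNorm x ≤ euclNorm (X *ᵥ x) := by
  by_cases hu : euclNorm x = 0
  · rw [hu, mul_zero]; exact nv_nonneg _
  have hp : 0 < euclNorm x := lt_of_le_of_ne (nv_nonneg x) (Ne.symm hu)
  have : sigmaPos X ≤ euclNorm (X *ᵥ ((euclNorm x)⁻¹ • x)) := by
    refine csInf_le ⟨0, ?_⟩ ⟨_, unit_scale x hu, fun y hy => ?_, rfl⟩
    · rintro c ⟨z, -, -, rfl⟩
      exact nv_nonneg _
    · rw [smul_dotProduct, hx y hy, smul_zero]
  rw [Matrix.mulVec_smul, nv_smul, abs_of_nonneg (inv_nonneg.mpr (nv_nonneg x)), le_inv_mul_iff₀ hp] at this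
  linarith

lemma sigmaPos_nonneg (X : Matrix (Fin n₁) (Fin n₂) ℝ) : 0 ≤ sigmaPos X := by
  refine Real.sInf_nonneg ?_
  rintro c ⟨z, -, -, rfl⟩
  exact nv_nonneg _

lemma sigmaPos_le (X : Matrix (Fin n₁) (Fin n₂) ℝ) : sigmaPos X ≤ ‖X‖ := by
  by_cases hne : {c : ℝ | ∃ x : Fin n₂ → ℝ, euclNorm x = 1 ∧
    (∀ y : Fin n₂ → ℝ, X.mulVec y = 0 → x ⬝ᵥ y = 0) ∧ c = euclNorm (X.mulVec x)}.Nonempty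
  · obtain ⟨c, x, hx, hy, -⟩ := hne
    have h1 := sigmaPos_spec X x hy
    have h2 := nv_mulVec X x
    rw [hx] at h1 h2
    linarith
  · rw [Set.not_nonempty_iff_eq_empty] at hne
    rw [sigmaPos, hne, Real.sInf_empty]
    exact norm_nonneg _

lemma of_stk (a : ℝ) (ω : (Fin n₁ → Fin k → ℝ) × (Fin n₂ → Fin k → ℝ)) :
    fromRows (a • Matrix.of ω.1 : Matrix (Fin n₁) (Fin k) ℝ) (a • Matrix.of ω.2 : Matrix (Fin n₂) (Fin k) ℝ) =
      a • Matrix.of (stk ω) := by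
  ext i j
  rcases i with i | i <;> simp [stk]

lemma main_aux (A : Fin m → Matrix (Fin n₁) (Fin n₂) ℝ) (X : Matrix (Fin n₁) (Fin n₂) ℝ)
    (hX : X.rank = r) (hrk : r ≤ k) {δ μ α ε x κ D L σ : ℝ} (hr : 1 ≤ r)
    (hx : ‖X‖ = x) (hx0 : 0 < x) (hκ : 1 ≤ κ) (hσ : σ = x / κ) (hσs : sigmaPos X = σ)
    (hDd : D = Real.sqrt k - Real.sqrt ((r : ℝ) - 1))
    (hL : L = Real.log (2 * Real.sqrt (2 * x) / (ε * α * D)))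
    (hδ0 : 0 < δ) (hδ : δ ≤ 1 / 10 ^ 10 / (κ ^ 3 * Real.sqrt r)) (hA : HasRIP A (2 * r + 1) δ)
    (hα : 0 < α) (hε : 0 < ε) (hε1 : ε < 1) (hμ : 0 < μ)
    (hμ2 : μ ≤ 1 / 10 ^ 27 / (κ ^ 5 * x) * (1 / L))
    (hα2 : α ≤ 1 / 10 ^ 100 * Real.sqrt x / ((k : ℝ) ^ 5 * ((max (n₁ + n₂) k : ℕ) : ℝ) ^ 2)
      * (ε * D / (10 ^ 4 * κ ^ 2 * Real.sqrt ((max (n₁ + n₂) k : ℕ) : ℝ))) ^ (100 * κ)) :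
    ∃ T : ℕ, (T : ℝ) ≤ 10 ^ 6 * L / (μ * σ) ∧
      ENNReal.ofReal (1 - Real.exp 3 * Real.exp (-(1 * k)) - (Real.exp 4 * 10 * ε) ^ (k - r + 1))
        ≤ gaussPair n₁ n₂ k {ω |
            let p := iter A X μ (α • Matrix.of ω.1) (α • Matrix.of ω.2) T
            specNorm (p.1 * p.2ᵀ - X) / x ≤ 10 ^ 6 * α ^ ((3 : ℝ) / 5) / x ^ ((3 : ℝ) / 10)} := by
  have hκ0 : 0 < κ := by linarith
  have hD : 0 < D := hDd ▸ D_pos hr hrk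
  set s := Real.sqrt x with hs
  have hs0 : 0 < s := Real.sqrt_pos.mpr hx0
  have hs2 : s ^ 2 = x := Real.sq_sqrt hx0.le
  set N : ℕ := max (n₁ + n₂) k with hN
  have hkN : k ≤ N := le_max_right _ _
  have hk1 : 1 ≤ k := hr.trans hrk
  have hk1' : (1 : ℝ) ≤ k := by exact_mod_cast hk1
  have hkN' : (k : ℝ) ≤ N := by exact_mod_cast hkN
  set a := α / s with ha
  have ha0 : 0 < a := by positivity
  have hαa : α = s * a := by rw [ha]; field_simp
  have heN : ε * D ≤ Real.sqrt N := by
    have h1 : D ≤ Real.sqrt k := by rw [hDd]; linarith [Real.sqrt_nonneg ((r : ℝ) - 1)]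
    have h2 : Real.sqrt k ≤ Real.sqrt N := Real.sqrt_le_sqrt hkN'
    nlinarith
  obtain ⟨q, g, hnum⟩ := num_exists (k := k) (N := N) (κ := κ) (a := a) (e := ε * D) hk1' hkN' hκ ha0 (by positivity) heN rfl (by
    rw [ha, div_le_iff₀ hs0]
    refine hα2.trans (le_of_eq ?_)
    ring)
  have hLe : L = Real.log (2 * Real.sqrt 2 / (a * (ε * D))) := by
    rw [hL, Real.sqrt_mul (by norm_num), ← hs, hαa]
    congr 1
    field_simp
  have hL1 : 1 ≤ L := by rw [hLe]; exact hnum.l1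
  have hL0 : 0 < L := by linarith
  set X' := x⁻¹ • X with hX'
  have hXs : X = s ^ 2 • X' := by rw [hs2, hX', smul_smul, mul_inv_cancel₀ hx0.ne', one_smul]
  have hX'r : X'.rank = r := by
    rw [hX', Matrix.rank_smul_of_mem_nonZeroDivisors _ (mem_nonZeroDivisors_of_ne_zero (inv_ne_zero hx0.ne')), hX]
  have hX'n : ‖X'‖ ≤ 1 := by
    rw [hX', norm_smul, hx, Real.norm_eq_abs, abs_of_pos (by positivity), inv_mul_cancel₀ hx0.ne']
  have hsp : ∀ z : Fin n₂ → ℝ, (∀ y, X' *ᵥ y = 0 → z ⬝ᵥ y = 0) → 1 / κ * euclNorm z ≤ euclNorm (X' *ᵥ z) := by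
    intro z hz
    have h1 := sigmaPos_spec X z (fun y hy => hz y (by rw [hX', Matrix.smul_mulVec, hy, smul_zero]))
    rw [hX', Matrix.smul_mulVec, nv_smul, abs_of_pos (by positivity), le_inv_mul_iff₀ hx0]
    rw [hσs, hσ] at h1
    calc _ = x / κ * euclNorm z := by ring
      _ ≤ _ := h1
  have hr0 : (0 : ℝ) < r := by exact_mod_cast hr
  obtain ⟨U, l, hR⟩ := ref_exists A X' (σ := 1 / κ) hδ0.le hr hA hX'r hX'n (by positivity)
    ((div_le_one hκ0).mpr hκ) (by
      calc δ * Real.sqrt r ≤ 1 / 10 ^ 10 / (κ ^ 3 * Real.sqrt r) * Real.sqrt r := by gcongr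
        _ = _ := by field_simp) hsp
  have hμ' : 0 < μ * s ^ 2 := by positivity
  have hμκ : μ * s ^ 2 * (1 / κ) = μ * σ := by rw [hs2, hσ]; ring
  have hσ0 : 0 < σ := by rw [hσ]; positivity
  refine ⟨⌊300000 * L / (μ * s ^ 2 * (1 / κ))⌋₊, ?_, ?_⟩
  · refine (Nat.floor_le (by positivity)).trans ?_
    rw [hμκ]
    gcongr
    norm_num
  refine prob U hR.hU hr hrk hε _ fun ω h1 h2 => ?_
  rw [← hDd] at h2
  set T := ⌊300000 * L / (μ * s ^ 2 * (1 / κ))⌋₊ with hT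
  have hdet := det_all hR hnum hrk hμ' (by
      rw [← hLe, hs2]
      calc μ * x * L ≤ (1 / 10 ^ 27 / (κ ^ 5 * x) * (1 / L)) * x * L := by gcongr
        _ = _ := by field_simp) (a • Matrix.of ω.1) (a • Matrix.of ω.2)
    (by
      rw [of_stk, norm_smul, Real.norm_eq_abs, abs_of_pos ha0, mul_comm]
      gcongr
      rw [← opn_transpose]
      exact opn_le _ (by positivity) h1)
    (fun z => by
      have h3 := h2 z
      rw [of_stk, Matrix.mul_smul, Matrix.transpose_smul, Matrix.smul_mulVec, nv_smul, abs_of_pos ha0, mul_assoc]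
      gcongr
      exact h3) (T := T) (by rw [hT, ← hLe])
  change specNorm ((iter A X μ (α • Matrix.of ω.1) (α • Matrix.of ω.2) T).1 * (iter A X μ (α • Matrix.of ω.1) (α • Matrix.of ω.2) T).2ᵀ - X) / x ≤ _
  have hit := iter_scale A X' μ s (a • Matrix.of ω.1 : Matrix (Fin n₁) (Fin k) ℝ) (a • Matrix.of ω.2 : Matrix (Fin n₂) (Fin k) ℝ) T
  rw [← hXs, smul_smul, smul_smul, ← hαa] at hit
  rw [hit]
  set p := iter A X' (μ * s ^ 2) (a • Matrix.of ω.1) (a • Matrix.of ω.2) T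
  have hdiff : (s • p.1) * (s • p.2)ᵀ - X = x • (p.1 * p.2ᵀ - X') := by
    rw [Matrix.transpose_smul, Matrix.smul_mul, Matrix.mul_smul, smul_smul, smul_sub, ← sq, hs2]
    congr 1
    rw [← hs2]; exact hXs
  have hfin : specNorm ((s • p.1) * (s • p.2)ᵀ - X) / x ≤ 10 ^ 6 * q ^ 3 := by
    rw [hdiff, specNorm_eq, norm_smul, Real.norm_eq_abs, abs_of_pos hx0, mul_div_cancel_left₀ _ hx0.ne']
    exact (opn_le_fro _).trans hdet
  refine hfin.trans (le_of_eq ?_)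
  rw [← hnum.hq3, ha, Real.div_rpow hα.le hs0.le, hs, Real.sqrt_eq_rpow, ← Real.rpow_mul hx0.le]
  norm_num
  ring

end Fin

theorem statement0_main :
    ∃ C₁ C₂ C₃ C₄ c₁ c₂ c₃ c₄ C : ℝ,
      0 < C₁ ∧ 0 < C₂ ∧ 0 < C₃ ∧ 0 < C₄ ∧ 0 < c₁ ∧ 0 < c₂ ∧ 0 < c₃ ∧ 0 < c₄ ∧ 0 < C ∧
    ∀ (n₁ n₂ m k r : ℕ)
      (A : Fin m → Matrix (Fin n₁) (Fin n₂) ℝ) (X : Matrix (Fin n₁) (Fin n₂) ℝ),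
      X.rank = r → r ≤ k →
      ∀ δ μ α ε : ℝ,
        0 < δ → δ ≤ c₁ / (condNum X ^ 3 * Real.sqrt r) → HasRIP A (2 * r + 1) δ →
        0 < α → 0 < ε → ε < 1 → 0 < μ →
        μ ≤ c₂ / (condNum X ^ 5 * specNorm X)
            * (1 / Real.log (2 * Real.sqrt (2 * specNorm X)
                / (ε * α * (Real.sqrt k - Real.sqrt ((r : ℝ) - 1))))) →
        α ≤ c₃ * Real.sqrt (specNorm X) / ((k : ℝ) ^ 5 * ((max (n₁ + n₂) k : ℕ) : ℝ) ^ 2)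
            * (ε * (Real.sqrt k - Real.sqrt ((r : ℝ) - 1))
                / (C₁ * condNum X ^ 2 * Real.sqrt ((max (n₁ + n₂) k : ℕ) : ℝ)))
              ^ (C₂ * condNum X) →
        ∃ T : ℕ,
          (T : ℝ) ≤ C * Real.log (2 * Real.sqrt (2 * specNorm X)
              / (ε * α * (Real.sqrt k - Real.sqrt ((r : ℝ) - 1)))) / (μ * sigmaPos X) ∧
          ENNReal.ofReal (1 - C₃ * Real.exp (-(c₄ * k)) - (C₄ * ε) ^ (k - r + 1))
            ≤ gaussPair n₁ n₂ k {ω |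
                let p := iter A X μ (α • Matrix.of ω.1) (α • Matrix.of ω.2) T
                specNorm (p.1 * p.2ᵀ - X) / specNorm X
                  ≤ C * α ^ ((3 : ℝ) / 5) / specNorm X ^ ((3 : ℝ) / 10)} := by
  refine ⟨10 ^ 4, 100, Real.exp 3, Real.exp 4 * 10, 1 / 10 ^ 10, 1 / 10 ^ 27, 1 / 10 ^ 100, 1, 10 ^ 6,
    by norm_num, by norm_num, by positivity, by positivity, by norm_num, by norm_num, by norm_num,
    by norm_num, by norm_num, ?_⟩
  intro n₁ n₂ m k r A X hX hrk δ μ α ε hδ0 hδ hA hα hε hε1 hμ hμ2 hα2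
  have hc : 0 < condNum X ^ 3 * Real.sqrt r := by
    by_contra hcon
    exact absurd (hδ0.trans_le hδ) (not_lt.mpr (div_nonpos_of_nonneg_of_nonpos (by norm_num) (not_lt.mp hcon)))
  have hr : 1 ≤ r := by
    rcases Nat.eq_zero_or_pos r with h0 | h0
    · rw [h0] at hc; simp at hc
    · exact h0
  have hσn := sigmaPos_nonneg X
  have hx : specNorm X = _ := specNorm_eq X
  have hσ0 : 0 < sigmaPos X := by
    refine lt_of_le_of_ne hσn fun h0 => ?_
    rw [condNum, ← h0, div_zero] at hc
    simp at hc
  have hσx : sigmaPos X ≤ specNorm X := by rw [hx]; exact sigmaPos_le X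
  have hx0 : 0 < specNorm X := hσ0.trans_le hσx
  have hσe : sigmaPos X = specNorm X / condNum X := by rw [condNum]; field_simp
  exact main_aux A X hX hrk (κ := condNum X) hr hx.symm hx0 ((one_le_div hσ0).mpr hσx) hσe rfl rfl rfl hδ0 hδ hA hα hε hε1 hμ hμ2 hα2

end AsymMatrixSensing
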